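/- arXiv:math/0410303 — 2 statements merged into one kernel-verified Lean document; each statement's English description precedes it below -/
import Mathlib

section
/- Let (R, m) be a commutative Noetherian local ring, M a finitely generated R-module, and I an ideal such that I + ann_R M is m-primary. Fix i with 0 ≤ i ≤ dim M. Then Ext_R^i(R/I^n, M) has finite length for all n ≥ 1, and the polynomial p with rational coefficients satisfying λ(Ext_R^i(R/I^n, M)) = p(n) for all sufficiently large n has deg p ≤ max{dim R/ann_R H_m^i(M), ℓ(I) − 1}, where H_m^i(M) is the i-th local cohomology module of M with support in m. -/
set_option synthInstance.maxHeartbeats 1000000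

open CategoryTheory

universe u

/-- The length `λ(M)` of a module `M`, realized as the Krull dimension of the lattice of
submodules of `M`. -/
noncomputable def moduleLength (R M : Type*) [Ring R] [AddCommGroup M] [Module R M] :
    WithBot ℕ∞ :=
  Order.krullDim (Submodule R M)

/-- The analytic spread of the ideal `I` relative to the ideal `m`: the Krull dimension of
the special fiber ring `⊕ₙ Iⁿ/(m Iⁿ)`, realized as the quotient of the Rees algebra
`R[It] = ⊕ₙ Iⁿ` by the extension of `m`. -/
noncomputable def analyticSpread {R : Type*} [CommRing R] (I m : Ideal R) : WithBot ℕ∞ :=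
  ringKrullDim ((reesAlgebra I) ⧸ (Ideal.map (algebraMap R (reesAlgebra I)) m))

/-- The degree of a polynomial, viewed in `WithBot ℕ∞`. -/
noncomputable def polyDeg (p : Polynomial ℚ) : WithBot ℕ∞ :=
  p.degree.map (Nat.cast : ℕ → ℕ∞)

/-- `Ext_R^i(A, B)`, as an `R`-module. -/
noncomputable abbrev extModule (R : Type u) [CommRing R] (i : ℕ) (A B : Type u)
    [AddCommGroup A] [Module R A] [AddCommGroup B] [Module R B] : Type u :=
  ↥(((Ext R (ModuleCat.{u} R) i).obj (Opposite.op (ModuleCat.of R A))).obj (ModuleCat.of R B))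

/-- An antitone family indexed by `ℕ` and a well-quasi-order, with values in a well-founded order,
stabilizes uniformly. -/
theorem exists_stable_of_wellQuasiOrdered {α β : Type*} [Preorder α] [WellQuasiOrderedLE α]
    [PartialOrder β] [WellFoundedLT β] (F : ℕ → α → β)
    (hk : ∀ a, Antitone fun k => F k a) (ha : ∀ k, Antitone (F k)) :
    ∃ k₀, ∀ k ≥ k₀, ∀ a, F k a = F k₀ a := by
  by_contra! h
  choose k hk' a hne using h
  let s : ℕ → ℕ := fun j => k^[j] 0
  have hs : ∀ j, s (j + 1) = k (s j) := fun j => Function.iterate_succ_apply' _ _ _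
  have hsm : Monotone s := monotone_nat_of_le_succ fun j => by rw [hs]; exact hk' _
  obtain ⟨g, hg⟩ := (wellQuasiOrderedLE_def α).1 inferInstance |>.exists_monotone_subseq
    (fun j => a (s j))
  have hlt : ∀ t, F (s (g (t + 1))) (a (s (g (t + 1)))) < F (s (g t)) (a (s (g t))) := by
    intro t
    have h1 : F (s (g t + 1)) (a (s (g t))) < F (s (g t)) (a (s (g t))) := by
      refine lt_of_le_of_ne (hk _ (hsm (Nat.le_succ _))) ?_
      rw [hs]; exact hne _
    refine lt_of_le_of_lt ?_ h1
    exact (hk _ (hsm (g.strictMono (Nat.lt_succ_self t)))).trans (ha _ (hg _ _ (Nat.le_succ t)))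
  exact (RelEmbedding.natGT (r := (· < ·)) (fun t => F (s (g t)) (a (s (g t)))) hlt).not_wellFounded
    wellFounded_lt

section
variable {R A : Type*} [CommRing R] [AddCommGroup A] [Module R A]

/-- The submodule of elements killed by the ideal `J`. -/
def killedBy (A : Type*) [AddCommGroup A] [Module R A] (J : Ideal R) : Submodule R A where
  carrier := {z | ∀ c ∈ J, c • z = 0}
  add_mem' := fun ha hb c hc => by rw [smul_add, ha c hc, hb c hc, add_zero]
  zero_mem' := fun c _ => smul_zero c
  smul_mem' := fun r z hz c hc => by rw [smul_comm, hz c hc, smul_zero]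

theorem killedBy_anti {J K : Ideal R} (h : J ≤ K) : killedBy A K ≤ killedBy A J :=
  fun _ hz c hc => hz c (h hc)

theorem mem_killedBy_mul {J K : Ideal R} {z : A} :
    z ∈ killedBy A (J * K) ↔ ∀ c ∈ K, c • z ∈ killedBy A J := by
  constructor
  · intro h c hc d hd
    rw [← mul_smul]
    exact h _ (Ideal.mul_mem_mul hd hc)
  · intro h c hc
    refine Submodule.mul_induction_on hc ?_ ?_
    · intro a ha b hb
      rw [mul_smul]; exact h b hb a ha
    · intro a b ha hb
      rw [add_smul, ha, hb, add_zero]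

theorem mem_killedBy_span {S : Set R} {z : A} :
    z ∈ killedBy A (Ideal.span S) ↔ ∀ c ∈ S, c • z = 0 := by
  constructor
  · intro h c hc
    exact h c (Ideal.subset_span hc)
  · intro h c hc
    have : Ideal.span S ≤ LinearMap.ker (LinearMap.toSpanSingleton R A z) :=
      Ideal.span_le.2 fun c hc => by simpa using h c hc
    simpa using this hc

theorem Submodule.smul_mem_of_mem_span {S : Set R} {z : A} {B : Submodule R A}
    (h : ∀ c ∈ S, c • z ∈ B) {c : R} (hc : c ∈ Ideal.span S) : c • z ∈ B := by
  have : Ideal.span S ≤ B.comap (LinearMap.toSpanSingleton R A z) :=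
    Ideal.span_le.2 fun c hc => by simpa using h c hc
  simpa using this hc

section monomials
variable {r : ℕ}

/-- The monomial with exponent vector `α` in the elements `y`. -/
def monomialAt (y : Fin r → R) (α : Fin r →₀ ℕ) : R := α.prod fun i e => y i ^ e

theorem monomialAt_add (y : Fin r → R) (α β : Fin r →₀ ℕ) :
    monomialAt y (α + β) = monomialAt y α * monomialAt y β :=
  Finsupp.prod_add_index' (by simp) (by simp [pow_add])

theorem monomialAt_single (y : Fin r → R) (i : Fin r) :
    monomialAt y (Finsupp.single i 1) = y i := by
  simp [monomialAt]

theorem mem_killedBy_pow_of_monomialAt (y : Fin r → R) (n : ℕ) :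
    ∀ z : A, (∀ α : Fin r →₀ ℕ, α.degree = n → monomialAt y α • z = 0) →
      z ∈ killedBy A (Ideal.span (Set.range y) ^ n) := by
  induction n with
  | zero =>
    intro z h c _
    have := h 0 (by simp)
    simp only [monomialAt, Finsupp.prod_zero_index, one_smul] at this
    rw [this, smul_zero]
  | succ n ih =>
    intro z h
    rw [pow_succ, mem_killedBy_mul]
    intro c hc
    refine Submodule.smul_mem_of_mem_span ?_ hc
    rintro _ ⟨i, rfl⟩
    refine ih _ fun α hα => ?_
    rw [← mul_smul, ← monomialAt_single y i, ← monomialAt_add]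
    exact h _ (by simp [hα])

theorem monomialAt_smul_mem {y : Fin r → R} {Q : ℕ → Submodule R A}
    (hy : ∀ n i, ∀ z ∈ Q (n + 1), y i • z ∈ Q n) (α : Fin r →₀ ℕ) :
    ∀ n, ∀ z ∈ Q (n + α.degree), monomialAt y α • z ∈ Q n := by
  induction α using Finsupp.induction_linear with
  | zero => intro n z hz; simpa [monomialAt] using hz
  | add α β hα hβ =>
    intro n z hz
    rw [monomialAt_add, mul_smul]
    refine hα _ _ (hβ _ _ ?_)
    simpa [add_assoc] using hz
  | single i e =>
    induction e with
    | zero => intro n z hz; simpa [monomialAt] using hz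
    | succ e ih =>
      intro n z hz
      rw [Finsupp.single_add, monomialAt_add, mul_smul]
      refine ih _ _ ?_
      rw [monomialAt_single]
      refine hy _ _ _ ?_
      simpa [add_assoc] using hz

/-- The leading-term submodules attached to a graded family of submodules. -/
def leadingSubmodule (y : Fin r → R) (Q : ℕ → Submodule R A) (α : Fin r →₀ ℕ) :
    Submodule R A where
  carrier := {w | ∃ z ∈ Q α.degree, (∀ β : Fin r →₀ ℕ, β.degree = α.degree →
    MonomialOrder.lex.toSyn α < MonomialOrder.lex.toSyn β → monomialAt y β • z = 0) ∧
    monomialAt y α • z = w}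
  add_mem' := by
    rintro _ _ ⟨z, hz, h, rfl⟩ ⟨z', hz', h', rfl⟩
    refine ⟨z + z', add_mem hz hz', fun β hβ hl => ?_, smul_add _ _ _⟩
    rw [smul_add, h β hβ hl, h' β hβ hl, add_zero]
  zero_mem' := ⟨0, zero_mem _, by simp, by simp⟩
  smul_mem' := by
    rintro c _ ⟨z, hz, h, rfl⟩
    refine ⟨c • z, Submodule.smul_mem _ _ hz, fun β hβ hl => ?_, smul_comm _ _ _⟩
    rw [smul_comm, h β hβ hl, smul_zero]

/-- A descending chain condition for graded families of submodules, modulo torsion. -/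
theorem graded_dcc (y : Fin r → R) (W : Submodule R A) [IsArtinian R W]
    (Q : ℕ → ℕ → Submodule R A) (hanti : ∀ n, Antitone fun k => Q k n)
    (hy : ∀ k n i, ∀ z ∈ Q k (n + 1), y i • z ∈ Q k n)
    (hW : ∀ α : Fin r →₀ ℕ, ∀ z ∈ Q 0 α.degree, monomialAt y α • z ∈ W) :
    ∃ k₀, ∀ k ≥ k₀, ∀ n, Q k₀ n ≤ Q k n ⊔ killedBy A (Ideal.span (Set.range y) ^ n) := by
  classical
  have hLW : ∀ k α, leadingSubmodule y (Q k) α ≤ W := by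
    rintro k α _ ⟨z, hz, -, rfl⟩
    exact hW α z (hanti _ (Nat.zero_le k) hz)
  obtain ⟨k₀, hk₀⟩ := exists_stable_of_wellQuasiOrdered
    (fun k (α : Fin r →₀ ℕ) => (leadingSubmodule y (Q k) α).comap W.subtype) (by
      intro α k k' hkk
      refine Submodule.comap_mono ?_
      rintro _ ⟨z, hz, h, rfl⟩
      exact ⟨z, hanti _ hkk hz, h, rfl⟩) (by
      intro k α α' hα
      refine Submodule.comap_mono ?_
      obtain ⟨γ, rfl⟩ := exists_add_of_le hα
      rintro _ ⟨z, hz, h, rfl⟩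
      refine ⟨monomialAt y γ • z, monomialAt_smul_mem (hy k) γ _ _ (by simpa using hz), ?_, ?_⟩
      · intro β hβ hl
        rw [← mul_smul, ← monomialAt_add]
        exact h _ (by simp [hβ]) (by simpa using hl)
      · rw [← mul_smul, ← monomialAt_add])
  have hL : ∀ k ≥ k₀, ∀ α, leadingSubmodule y (Q k₀) α ≤ leadingSubmodule y (Q k) α := by
    intro k hk α w hw
    have h1 : (⟨w, hLW _ _ hw⟩ : W) ∈ (leadingSubmodule y (Q k₀) α).comap W.subtype := hw
    have h2 := hk₀ k hk α
    rw [← h2] at h1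
    exact h1
  refine ⟨k₀, fun k hk n => ?_⟩
  set T := killedBy A (Ideal.span (Set.range y) ^ n) with hT
  have hpick : ∀ z : A, z ∉ T → ∃ α : Fin r →₀ ℕ, α.degree = n ∧ monomialAt y α • z ≠ 0 ∧
      ∀ β : Fin r →₀ ℕ, β.degree = n → MonomialOrder.lex.toSyn α < MonomialOrder.lex.toSyn β →
        monomialAt y β • z = 0 := by
    intro z hz
    have hfin : {α : Fin r →₀ ℕ | α.degree = n ∧ monomialAt y α • z ≠ 0}.Finite :=
      (Finsupp.finite_of_degree_le n).subset fun α hα => hα.1.le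
    have hne : {α : Fin r →₀ ℕ | α.degree = n ∧ monomialAt y α • z ≠ 0}.Nonempty := by
      by_contra hem
      rw [Set.not_nonempty_iff_eq_empty] at hem
      refine hz (mem_killedBy_pow_of_monomialAt y n z fun α hα => ?_)
      by_contra hc
      exact (hem ▸ (show α ∈ {α : Fin r →₀ ℕ | α.degree = n ∧ monomialAt y α • z ≠ 0} from
        ⟨hα, hc⟩) : α ∈ (∅ : Set (Fin r →₀ ℕ)))
    obtain ⟨α, hα, hmax⟩ := Set.exists_max_image _ MonomialOrder.lex.toSyn hfin hne
    refine ⟨α, hα.1, hα.2, fun β hβ hl => ?_⟩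
    by_contra hc
    exact absurd (hmax β ⟨hβ, hc⟩) (not_le.2 hl)
  have key : ∀ s : MonomialOrder.lex.syn, ∀ α : Fin r →₀ ℕ, MonomialOrder.lex.toSyn α = s →
      α.degree = n → ∀ z ∈ Q k₀ n, (∀ β : Fin r →₀ ℕ, β.degree = n →
        MonomialOrder.lex.toSyn α < MonomialOrder.lex.toSyn β → monomialAt y β • z = 0) →
      z ∈ Q k n ⊔ T := by
    intro s
    induction s using WellFoundedLT.induction with
    | ind s ih =>
      rintro α rfl hα z hz hβ
      subst hα
      obtain ⟨z', hz', hβ', he⟩ := hL k hk α ⟨z, hz, hβ, rfl⟩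
      have hsub : z - z' ∈ Q k₀ α.degree := sub_mem hz (hanti _ hk hz')
      suffices h : z - z' ∈ Q k α.degree ⊔ T by
        have := add_mem h (Submodule.mem_sup_left hz' : z' ∈ Q k α.degree ⊔ T)
        simpa using this
      by_cases hzT : z - z' ∈ T
      · exact Submodule.mem_sup_right hzT
      obtain ⟨γ, hγ, hγne, hγmax⟩ := hpick _ hzT
      refine ih _ ?_ γ rfl hγ _ hsub hγmax
      by_contra hlt
      rcases (not_lt.1 hlt).eq_or_lt with h | h
      · have : α = γ := MonomialOrder.lex.toSyn.injective h
        subst this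
        exact hγne (by rw [smul_sub, he, sub_self])
      · exact hγne (by rw [smul_sub, hβ γ hγ h, hβ' γ hγ h, sub_zero])
  intro z hz
  by_cases hzT : z ∈ T
  · exact Submodule.mem_sup_right hzT
  obtain ⟨γ, hγ, -, hγmax⟩ := hpick _ hzT
  exact key _ γ rfl hγ z hz hγmax
end monomials
end

section
variable {R A : Type*} [CommRing R] [AddCommGroup A] [Module R A]

theorem isArtinian_of_killedBy {J : Ideal R} (hJ : J.FG) [IsArtinian R (killedBy A J)]
    (htor : ∀ z : A, ∃ k, z ∈ killedBy A (J ^ k)) : IsArtinian R A := by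
  obtain ⟨r, y, hy⟩ := Submodule.fg_iff_exists_fin_generating_family.1 hJ
  change Ideal.span (Set.range y) = J at hy
  have hyJ : ∀ i, y i ∈ J := fun i => hy ▸ Ideal.subset_span ⟨i, rfl⟩
  have hstep : ∀ n i, ∀ z ∈ killedBy A (J ^ (n + 1 + 1)), y i • z ∈ killedBy A (J ^ (n + 1)) := by
    intro n i z hz
    rw [pow_succ, mem_killedBy_mul] at hz
    exact hz _ (hyJ i)
  rw [← monotone_stabilizes_iff_artinian]
  intro N
  let F : ℕ → Submodule R A := fun k => OrderDual.ofDual (N k)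
  have hN : ∀ {k k'}, k ≤ k' → F k' ≤ F k := fun h => N.monotone h
  obtain ⟨k₀, hk₀⟩ := graded_dcc y (killedBy A J)
    (fun k n => F k ⊓ killedBy A (J ^ (n + 1)))
    (fun n k k' h => inf_le_inf_right _ (hN h))
    (fun k n i z hz => ⟨Submodule.smul_mem _ _ hz.1, hstep n i z hz.2⟩)
    (fun α z hz => by
      have := monomialAt_smul_mem (Q := fun n => killedBy A (J ^ (n + 1))) hstep α 0 z
        (by simpa using hz.2)
      simpa using this)
  refine ⟨k₀, fun k hk => le_antisymm (N.monotone hk) ?_⟩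
  have key : ∀ n, F k₀ ⊓ killedBy A (J ^ n) ≤ F k := by
    intro n
    induction n with
    | zero =>
      rintro z ⟨-, hz⟩
      have : z = 0 := by simpa using hz 1 (by simp)
      rw [this]; exact zero_mem _
    | succ n ih =>
      intro z hz
      obtain ⟨w, hw, t, ht, rfl⟩ := Submodule.mem_sup.1 (hk₀ k hk n hz)
      refine add_mem hw.1 (ih ⟨?_, hy ▸ ht⟩)
      have := sub_mem hz.1 (hN hk hw.1)
      simpa using this
  intro z hz
  obtain ⟨n, hn⟩ := htor z
  exact key n ⟨hz, hn⟩

/-- A dual Artin–Rees property of Artinian modules. -/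
theorem dual_artin_rees [IsArtinian R A] {I : Ideal R} (hI : I.FG) (Z : Submodule R A) :
    ∃ n₀, ∀ n ≥ n₀, ∀ z : A, (∀ c ∈ I, c • z ∈ Z ⊔ killedBy A (I ^ n)) →
      z ∈ Z ⊔ killedBy A (I ^ (n + 1)) := by
  classical
  obtain ⟨r, y, hy⟩ := Submodule.fg_iff_exists_fin_generating_family.1 hI
  change Ideal.span (Set.range y) = I at hy
  have hyI : ∀ i, y i ∈ I := fun i => hy ▸ Ideal.subset_span ⟨i, rfl⟩
  let P : ℕ → Submodule R A := fun n => Z ⊔ killedBy A (I ^ n)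
  have hPI : ∀ n, ∀ c ∈ I, ∀ z ∈ P (n + 1), c • z ∈ P n := by
    intro n c hc z hz
    obtain ⟨w, hw, t, ht, rfl⟩ := Submodule.mem_sup.1 hz
    rw [smul_add]
    rw [pow_succ, mem_killedBy_mul] at ht
    exact Submodule.add_mem_sup (Submodule.smul_mem _ _ hw) (ht c hc)
  let S : ℕ → Submodule R A := fun n =>
    { carrier := {z | ∀ c ∈ I, c • z ∈ P (n - 1)}
      add_mem' := fun ha hb c hc => by rw [smul_add]; exact add_mem (ha c hc) (hb c hc)
      zero_mem' := fun c _ => by rw [smul_zero]; exact zero_mem _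
      smul_mem' := fun r z hz c hc => by
        rw [smul_comm]; exact Submodule.smul_mem _ _ (hz c hc) }
  have hPS : ∀ n, P n ≤ S n := by
    rintro (_ | n) z hz c hc
    · exact Submodule.smul_mem _ _ hz
    · exact hPI n c hc z hz
  obtain ⟨k₀, hk₀⟩ := graded_dcc y (⊤ : Submodule R A) (fun k n => if k ≤ n then S n else P n)
    (by
      intro n k k' hkk
      dsimp only
      split_ifs with h1 h2 h2
      · exact le_rfl
      · omega
      · exact hPS n
      · exact le_rfl)
    (by
      intro k n i z hz
      have hP : y i • z ∈ P n := by
        split_ifs at hz with h1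
        · exact hz _ (hyI i)
        · exact hPI n _ (hyI i) z hz
      split_ifs
      · exact hPS n hP
      · exact hP)
    (fun _ _ _ => Submodule.mem_top)
  refine ⟨k₀, fun n hn z hz => ?_⟩
  have := hk₀ (n + 2) (by omega) (n + 1)
  simp only [show k₀ ≤ n + 1 by omega, if_true, show ¬ (n + 2 ≤ n + 1) by omega, if_false,
    hy] at this
  have h2 := this (show z ∈ S (n + 1) from hz)
  rwa [sup_eq_left.2 (show killedBy A (I ^ (n + 1)) ≤ P (n + 1) from le_sup_right)] at h2
end

section
variable {R A : Type*} [CommRing R] [AddCommGroup A] [Module R A]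

theorem Module.length_le_add_of_exact {N M P : Type*} [AddCommGroup N] [Module R N]
    [AddCommGroup M] [Module R M] [AddCommGroup P] [Module R P] (f : N →ₗ[R] M) (g : M →ₗ[R] P)
    (h : Function.Exact f g) : Module.length R M ≤ Module.length R N + Module.length R P := by
  have h1 := Module.length_eq_add_of_exact (LinearMap.range f).subtype g.rangeRestrict
    (Submodule.subtype_injective _) g.surjective_rangeRestrict (by
      intro x
      rw [← LinearMap.mem_ker, LinearMap.ker_rangeRestrict, LinearMap.mem_ker, h x]
      simp)
  rw [h1]
  exact add_le_add (Module.length_le_of_surjective _ f.surjective_rangeRestrict)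
    (Module.length_le_of_injective _ (Submodule.subtype_injective _))

theorem Submodule.length_mono {P Q : Submodule R A} (h : P ≤ Q) :
    Module.length R P ≤ Module.length R Q :=
  Module.length_le_of_injective _ (Submodule.inclusion_injective h)

theorem isFiniteLength_of_pow_smul_eq_zero {m : Ideal R} [m.IsMaximal] (n : ℕ) :
    ∀ (X : Type u) [AddCommGroup X] [Module R X], (∀ c ∈ m ^ n, ∀ z : X, c • z = 0) →
      (IsNoetherian R X ∨ IsArtinian R X) → IsFiniteLength R X := by
  induction n with
  | zero =>
    intro X _ _ h _
    have : Subsingleton X := ⟨fun a b => by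
      have h1 := h 1 (by simp)
      simp only [one_smul] at h1
      rw [h1 a, h1 b]⟩
    exact .of_subsingleton
  | succ n ih =>
    intro X _ _ h hX
    rw [← Module.length_ne_top_iff]
    have h1 : IsFiniteLength R (m • ⊤ : Submodule R X) := by
      refine ih _ ?_ (by rcases hX with hX | hX <;> [left; right] <;> infer_instance)
      rintro c hc ⟨z, hz⟩
      apply Subtype.ext
      change c • z = 0
      refine Submodule.smul_induction_on hz ?_ ?_
      · intro r hr y _
        rw [← mul_smul]
        exact h _ (by rw [pow_succ]; exact Ideal.mul_mem_mul hc hr) y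
      · intro x y hx hy
        rw [smul_add, hx, hy, add_zero]
    have h2 : IsFiniteLength R (X ⧸ (m • ⊤ : Submodule R X)) := by
      have htor : Module.IsTorsionBySet R (X ⧸ (m • ⊤ : Submodule R X)) m := by
        intro z c
        obtain ⟨z, rfl⟩ := Submodule.Quotient.mk_surjective _ z
        rw [← Submodule.Quotient.mk_smul, Submodule.Quotient.mk_eq_zero]
        exact Submodule.smul_mem_smul c.2 trivial
      let _ := Ideal.Quotient.field m
      let _ := htor.module
      have : IsSemisimpleModule R (X ⧸ (m • ⊤ : Submodule R X)) :=
        htor.isSemisimpleModule_iff.1 inferInstance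
      rcases hX with hX | hX
      · have h3 : IsNoetherian R (X ⧸ (m • ⊤ : Submodule R X)) ↔ IsFiniteLength R _ :=
          IsSemisimpleModule.finite_tfae.out 1 3
        exact h3.1 inferInstance
      · have h3 : IsArtinian R (X ⧸ (m • ⊤ : Submodule R X)) ↔ IsFiniteLength R _ :=
          IsSemisimpleModule.finite_tfae.out 2 3
        exact h3.1 inferInstance
    rw [← Module.length_ne_top_iff] at h1 h2
    refine ne_top_of_le_ne_top (WithTop.add_ne_top.2 ⟨h1, h2⟩)
      (Module.length_le_add_of_exact (m • ⊤ : Submodule R X).subtype (Submodule.mkQ _) ?_)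
    exact LinearMap.exact_subtype_mkQ _

theorem length_inf_killedBy_pow_le (P : Submodule R A) (x : R) (t : ℕ) :
    Module.length R ↥(P ⊓ killedBy A (Ideal.span {x ^ t})) ≤
      t * Module.length R ↥(P ⊓ killedBy A (Ideal.span {x})) := by
  induction t with
  | zero =>
    have : P ⊓ killedBy A (Ideal.span {x ^ 0}) = ⊥ := by
      rw [eq_bot_iff]
      rintro z ⟨-, hz⟩
      simpa using hz 1 (by simp)
    rw [this]
    simp
  | succ t ih =>
    let f : ↥(P ⊓ killedBy A (Ideal.span {x ^ (t + 1)})) →ₗ[R]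
        ↥(P ⊓ killedBy A (Ideal.span {x ^ t})) :=
      (LinearMap.lsmul R A x).restrict (by
        rintro z ⟨h1, h2⟩
        refine ⟨Submodule.smul_mem _ _ h1, ?_⟩
        rw [SetLike.mem_coe, mem_killedBy_span] at h2 ⊢
        rintro _ rfl
        have := h2 _ rfl
        rwa [pow_succ, mul_smul] at this)
    have h1 := Module.length_le_add_of_exact (LinearMap.ker f).subtype f
      (LinearMap.exact_subtype_ker_map f)
    have h2 : Module.length R (LinearMap.ker f) ≤
        Module.length R ↥(P ⊓ killedBy A (Ideal.span {x})) := by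
      refine Module.length_le_of_injective
        ((Submodule.subtype _ ∘ₗ (LinearMap.ker f).subtype).codRestrict _ ?_) ?_
      · rintro ⟨⟨z, hz1, hz2⟩, hz⟩
        refine ⟨hz1, ?_⟩
        rw [SetLike.mem_coe, mem_killedBy_span]
        rintro _ rfl
        exact congrArg Subtype.val hz
      · intro a b hab
        have h3 := congrArg Subtype.val hab
        exact Subtype.ext (Subtype.ext h3)
    refine h1.trans ((add_le_add h2 ih).trans_eq ?_)
    push_cast
    ring

theorem killedBy_sup (J K : Ideal R) : killedBy A (J ⊔ K) = killedBy A J ⊓ killedBy A K := by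
  refine le_antisymm (le_inf (killedBy_anti le_sup_left) (killedBy_anti le_sup_right)) ?_
  rintro z ⟨h1, h2⟩ c hc
  obtain ⟨a, ha, b, hb, rfl⟩ := Submodule.mem_sup.1 hc
  rw [add_smul, h1 a ha, h2 b hb, add_zero]

theorem length_inf_killedBy_ofList_le (l : List R) (t : ℕ) : ∀ P : Submodule R A,
    Module.length R ↥(P ⊓ killedBy A (Ideal.ofList (l.map (· ^ t)))) ≤
      (t ^ l.length : ℕ) * Module.length R ↥(P ⊓ killedBy A (Ideal.ofList l)) := by
  induction l with
  | nil => intro P; rw [List.map_nil, List.length_nil, pow_zero, Nat.cast_one, one_mul]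
  | cons x l ih =>
    intro P
    rw [List.map_cons, Ideal.ofList_cons, Ideal.ofList_cons, killedBy_sup, killedBy_sup]
    have h1 := length_inf_killedBy_pow_le (P ⊓ killedBy A (Ideal.ofList (l.map (· ^ t)))) x t
    have h2 := ih (P ⊓ killedBy A (Ideal.span {x}))
    rw [← inf_assoc, inf_right_comm, ← inf_assoc]
    refine h1.trans ?_
    rw [inf_right_comm]
    refine (mul_le_mul_right h2 _).trans_eq ?_
    rw [List.length_cons, pow_succ']
    push_cast
    ring

theorem exists_list_mem_minimalPrimes [IsNoetherianRing R] (p : Ideal R) [p.IsPrime] :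
    ∃ l : List R, p ∈ (Ideal.ofList l).minimalPrimes ∧ (l.length : ℕ∞) = p.height := by
  obtain ⟨s, hs, hc⟩ := p.exists_finset_card_eq_height_of_isNoetherianRing
  refine ⟨s.toList, ?_, ?_⟩
  · convert hs using 2
    ext x
    simp [Ideal.ofList]
  · rw [Finset.length_toList, hc]

theorem exists_pow_le_sup_pow_of_mem_minimalPrimes [IsNoetherianRing R] {m q : Ideal R}
    [m.IsMaximal] (h : m ∈ q.minimalPrimes) : ∃ e, ∀ n, m ^ e ≤ q ⊔ m ^ n := by
  let L := Localization.AtPrime m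
  let q' : Ideal L := q.map (algebraMap R L)
  have hrad : IsLocalRing.maximalIdeal L ≤ q'.radical := by
    rw [Ideal.radical_eq_sInf]
    refine le_sInf ?_
    rintro P ⟨hqP, hP⟩
    have h1 : P.comap (algebraMap R L) ≤ m := by
      exact (Ideal.comap_mono (f := algebraMap R L)
        (IsLocalRing.le_maximalIdeal hP.ne_top)).trans_eq
        (IsLocalization.AtPrime.under_maximalIdeal L m)
    have h2 : m ≤ P.comap (algebraMap R L) :=
      h.2 ⟨inferInstance, Ideal.map_le_iff_le_comap.1 hqP⟩ h1
    rw [← IsLocalization.AtPrime.map_eq_maximalIdeal m L]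
    exact Ideal.map_le_iff_le_comap.2 h2
  obtain ⟨e, he⟩ := Ideal.exists_radical_pow_le_of_fg q' (IsNoetherian.noetherian _)
  refine ⟨e, fun n a ha => ?_⟩
  have h1 : algebraMap R L a ∈ q' := by
    refine he (Ideal.pow_right_mono hrad e ?_)
    rw [← IsLocalization.AtPrime.map_eq_maximalIdeal m L, ← Ideal.map_pow]
    exact Ideal.mem_map_of_mem _ ha
  rw [IsLocalization.algebraMap_mem_map_algebraMap_iff m.primeCompl] at h1
  obtain ⟨s, hs, hsa⟩ := h1
  have htop : Ideal.span {s} ⊔ m ^ n = ⊤ := by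
    refine Ideal.sup_pow_eq_top ?_
    rw [sup_comm]
    exact Ideal.IsMaximal.out.2 _ (left_lt_sup.2 fun hle => hs (hle (Ideal.subset_span rfl)))
  obtain ⟨b, hb, c, hc, hbc⟩ := Submodule.mem_sup.1 ((Ideal.eq_top_iff_one _).1 htop)
  obtain ⟨u, rfl⟩ := Ideal.mem_span_singleton'.1 hb
  have : a = u * (s * a) + a * c := by
    calc a = a * (u * s + c) := by rw [hbc, mul_one]
      _ = _ := by ring
  rw [this]
  exact add_mem (Ideal.mem_sup_left (Ideal.mul_mem_left _ _ hsa))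
    (Ideal.mem_sup_right (Ideal.mul_mem_left _ _ hc))

theorem exists_fin_span_eq_of_fg {J : Ideal R} (hJ : J.FG) :
    ∃ (r : ℕ) (y : Fin r → R), Ideal.span (Set.range y) = J :=
  Submodule.fg_iff_exists_fin_generating_family.1 hJ

section
variable {B : Type*} [CommRing B] [Algebra R B]

theorem length_quotient_sup_span_pow_le (Q : Ideal B) (x : B) (t : ℕ) :
    Module.length R (B ⧸ (Q ⊔ Ideal.span {x ^ t})) ≤
      t * Module.length R (B ⧸ (Q ⊔ Ideal.span {x})) := by
  induction t with
  | zero =>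
    have : Q ⊔ Ideal.span {x ^ 0} = ⊤ := by simp
    rw [this]
    simp
  | succ t ih =>
    have hle : Q ⊔ Ideal.span {x ^ (t + 1)} ≤ Q ⊔ Ideal.span {x ^ t} :=
      sup_le_sup_left (Ideal.span_singleton_le_span_singleton.2 (pow_dvd_pow x (Nat.le_succ t))) _
    let f : (B ⧸ (Q ⊔ Ideal.span {x})) →ₗ[B] (B ⧸ (Q ⊔ Ideal.span {x ^ (t + 1)})) :=
      Submodule.mapQ _ _ (LinearMap.lsmul B B (x ^ t)) (by
        refine sup_le ?_ ?_
        · intro z hz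
          exact Ideal.mul_mem_left _ _ (Ideal.mem_sup_left hz)
        · rw [Ideal.span_le, Set.singleton_subset_iff]
          change x ^ t * x ∈ Q ⊔ Ideal.span {x ^ (t + 1)}
          rw [← pow_succ]
          exact Ideal.mem_sup_right (Ideal.subset_span rfl))
    have h1 := Module.length_le_add_of_exact (f.restrictScalars R)
      ((Submodule.factor hle).restrictScalars R) (by
      intro z
      obtain ⟨z, rfl⟩ := Submodule.Quotient.mk_surjective _ z
      constructor
      · intro hz
        have hz' : z ∈ Q ⊔ Ideal.span {x ^ t} :=
          (Submodule.Quotient.mk_eq_zero _).1 hz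
        obtain ⟨q, hq, w, hw, rfl⟩ := Submodule.mem_sup.1 hz'
        obtain ⟨c, rfl⟩ := Ideal.mem_span_singleton'.1 hw
        refine ⟨Submodule.Quotient.mk c, ?_⟩
        change Submodule.Quotient.mk (x ^ t * c) = _
        rw [Submodule.Quotient.eq]
        have : x ^ t * c - (q + c * x ^ t) = -q := by ring
        rw [this]
        exact Ideal.mem_sup_left (neg_mem hq)
      · rintro ⟨c, hc⟩
        rw [← hc]
        obtain ⟨c, rfl⟩ := Submodule.Quotient.mk_surjective _ c
        change Submodule.Quotient.mk (x ^ t * c) = _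
        rw [Submodule.Quotient.mk_eq_zero]
        exact Ideal.mem_sup_right (Ideal.mul_mem_right _ _ (Ideal.subset_span rfl)))
    refine h1.trans ((add_le_add le_rfl ih).trans_eq ?_)
    push_cast
    ring

theorem length_quotient_sup_ofList_le (l : List B) (t : ℕ) : ∀ Q : Ideal B,
    Module.length R (B ⧸ (Q ⊔ Ideal.ofList (l.map (· ^ t)))) ≤
      (t ^ l.length : ℕ) * Module.length R (B ⧸ (Q ⊔ Ideal.ofList l)) := by
  induction l with
  | nil => intro Q; rw [List.map_nil, List.length_nil, pow_zero, Nat.cast_one, one_mul]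
  | cons x l ih =>
    intro Q
    rw [List.map_cons, Ideal.ofList_cons, Ideal.ofList_cons]
    have h1 := length_quotient_sup_span_pow_le (R := R) (Q ⊔ Ideal.ofList (l.map (· ^ t))) x t
    have h2 := ih (Q ⊔ Ideal.span {x})
    rw [← sup_assoc, sup_right_comm, ← sup_assoc]
    refine h1.trans ?_
    rw [sup_right_comm]
    refine (mul_le_mul_right h2 _).trans_eq ?_
    rw [List.length_cons, pow_succ']
    push_cast
    ring

theorem length_quotient_pow_ne_top {J : Ideal B} (hJ : J.FG) (h : Module.length R (B ⧸ J) ≠ ⊤)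
    (e : ℕ) : Module.length R (B ⧸ J ^ e) ≠ ⊤ := by
  obtain ⟨r, y, hy⟩ := exists_fin_span_eq_of_fg hJ
  have hyJ : ∀ i, y i ∈ J := fun i => hy ▸ Ideal.subset_span ⟨i, rfl⟩
  induction e with
  | zero => simp
  | succ e ih =>
    let f : (Fin r → B ⧸ J ^ e) →ₗ[B] B ⧸ J ^ (e + 1) :=
      LinearMap.lsum B (fun _ => B ⧸ J ^ e) B fun i =>
        Submodule.mapQ _ _ (LinearMap.lsmul B B (y i)) (by
          intro z hz
          change y i * z ∈ J ^ (e + 1)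
          rw [pow_succ']
          exact Ideal.mul_mem_mul (hyJ i) hz)
    have hle : J ^ (e + 1) ≤ J := Ideal.pow_le_self (Nat.succ_ne_zero e)
    have hf : ∀ b : Fin r → B, f (fun i => Submodule.Quotient.mk (b i)) =
        Submodule.Quotient.mk (∑ i, y i * b i) := by
      intro b
      simp only [f, LinearMap.lsum_apply, LinearMap.sum_apply]
      exact (map_sum (Submodule.mkQ (J ^ (e + 1))) _ _).symm
    have h1 := Module.length_le_add_of_exact (f.restrictScalars R)
      ((Submodule.factor hle).restrictScalars R) (by
      intro z
      obtain ⟨z, rfl⟩ := Submodule.Quotient.mk_surjective _ z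
      constructor
      · intro hz
        have hz' : z ∈ Ideal.span (Set.range y) := by
          rw [hy]
          exact (Submodule.Quotient.mk_eq_zero _).1 hz
        obtain ⟨c, rfl⟩ := Ideal.mem_span_range_iff_exists_fun.1 hz'
        refine ⟨fun i => Submodule.Quotient.mk (c i), ?_⟩
        refine (hf c).trans ?_
        simp_rw [mul_comm]
      · rintro ⟨c, hc⟩
        rw [← hc]
        choose b hb using fun i => Submodule.Quotient.mk_surjective _ (c i)
        obtain rfl : (fun i => Submodule.Quotient.mk (b i)) = c := funext hb
        refine (congrArg (Submodule.factor hle) (hf b)).trans ?_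
        exact (Submodule.Quotient.mk_eq_zero _).2
          (show ∑ i, y i * b i ∈ J from
            Ideal.sum_mem _ fun i _ => Ideal.mul_mem_right _ _ (hyJ i)))
    refine ne_top_of_le_ne_top (WithTop.add_ne_top.2 ⟨?_, h⟩) h1
    rw [Module.length_pi_of_fintype]
    simp only [Finset.sum_const, Finset.card_univ, Fintype.card_fin, nsmul_eq_mul]
    exact WithTop.mul_ne_top (WithTop.coe_ne_top) ih

/-- The length of `B ⧸ mⁿ` grows at most like `n ^ height m`. -/
theorem exists_length_quotient_pow_le [IsNoetherianRing B] (m : Ideal B) [m.IsMaximal]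
    (hm : Module.length R (B ⧸ m) ≠ ⊤) :
    ∃ h C : ℕ, (h : ℕ∞) = m.height ∧
      ∀ n, Module.length R (B ⧸ m ^ n) ≤ (C * n ^ h : ℕ) := by
  obtain ⟨l, hl, hlen⟩ := exists_list_mem_minimalPrimes m
  obtain ⟨e, he⟩ := exists_pow_le_sup_pow_of_mem_minimalPrimes hl
  have hfin := length_quotient_pow_ne_top (IsNoetherian.noetherian m) hm e
  obtain ⟨C, hC⟩ := ENat.ne_top_iff_exists.1 hfin
  refine ⟨l.length, C, hlen, fun n => ?_⟩
  have h1 : m ^ n ⊔ Ideal.ofList (l.map (· ^ n)) = m ^ n := by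
    rw [sup_eq_left, Ideal.ofList, Ideal.span_le]
    intro x hx
    obtain ⟨y, hy, rfl⟩ := List.mem_map.1 hx
    exact Ideal.pow_mem_pow (hl.1.2 (Ideal.subset_span hy)) n
  have h2 := length_quotient_sup_ofList_le (R := R) l n (m ^ n)
  rw [h1] at h2
  refine h2.trans ?_
  have h3 : Module.length R (B ⧸ (m ^ n ⊔ Ideal.ofList l)) ≤ Module.length R (B ⧸ m ^ e) :=
    have hle : m ^ e ≤ m ^ n ⊔ Ideal.ofList l := (he n).trans_eq (sup_comm _ _)
    Module.length_le_of_surjective ((Submodule.factor hle).restrictScalars R)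
      (Submodule.factor_surjective hle)
  rw [← hC] at h3
  refine (mul_le_mul_right h3 _).trans_eq ?_
  push_cast
  ring
end
end

section
theorem Module.length_le_of_ker_le {R X Y Z : Type*} [Ring R] [AddCommGroup X] [Module R X]
    [AddCommGroup Y] [Module R Y] [AddCommGroup Z] [Module R Z] (f : Z →ₗ[R] X) (g : Z →ₗ[R] Y)
    (hf : Function.Surjective f) (hg : Function.Surjective g)
    (h : LinearMap.ker f ≤ LinearMap.ker g) : Module.length R Y ≤ Module.length R X := by
  rw [← (f.quotKerEquivOfSurjective hf).length_eq]
  refine Module.length_le_of_surjective ((LinearMap.ker f).liftQ g h) ?_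
  rw [← LinearMap.range_eq_top, Submodule.range_liftQ, LinearMap.range_eq_top]
  exact hg

variable {R : Type u} [CommRing R]

/-- The Rees algebra elements whose coefficients in degrees `< n` lie in `m * Iʲ`. -/
def reesFilter (m I : Ideal R) (n : ℕ) : Ideal (reesAlgebra I) where
  carrier := {f | ∀ j < n, (f : Polynomial R).coeff j ∈ m * I ^ j}
  add_mem' := fun {f g} hf hg j hj => by
    have : ((f + g : reesAlgebra I) : Polynomial R).coeff j =
      (f : Polynomial R).coeff j + (g : Polynomial R).coeff j := by simp
    rw [this]; exact add_mem (hf j hj) (hg j hj)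
  zero_mem' := fun j _ => by simp
  smul_mem' := fun s f hf j hj => by
    have : ((s • f : reesAlgebra I) : Polynomial R).coeff j =
      ((s : Polynomial R) * (f : Polynomial R)).coeff j := by simp
    rw [this, Polynomial.coeff_mul]
    refine Ideal.sum_mem _ fun p hp => ?_
    rw [Finset.HasAntidiagonal.mem_antidiagonal] at hp
    rw [← hp, pow_add, mul_left_comm]
    exact Ideal.mul_mem_mul (s.2 p.1) (hf p.2 (by omega))

theorem reesFilter_one_mul_le (m I : Ideal R) (n : ℕ) :
    reesFilter m I 1 * reesFilter m I n ≤ reesFilter m I (n + 1) := by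
  rw [Ideal.mul_le]
  intro f hf g hg j hj
  have : ((f * g : reesAlgebra I) : Polynomial R).coeff j =
    ((f : Polynomial R) * (g : Polynomial R)).coeff j := by simp
  rw [this, Polynomial.coeff_mul]
  refine Ideal.sum_mem _ fun p hp => ?_
  rw [Finset.HasAntidiagonal.mem_antidiagonal] at hp
  rcases Nat.eq_zero_or_pos p.1 with h0 | h0
  · have h1 : p.2 = j := by omega
    rw [h0, h1]
    exact Ideal.mul_mem_mul (by simpa using hf 0 one_pos) (g.2 j)
  · rw [← hp, pow_add, mul_left_comm]
    exact Ideal.mul_mem_mul (f.2 p.1) (hg p.2 (by omega))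

theorem reesFilter_one_pow_le (m I : Ideal R) (n : ℕ) :
    reesFilter m I 1 ^ n ≤ reesFilter m I n := by
  induction n with
  | zero => intro f _ j hj; omega
  | succ n ih =>
    rw [pow_succ']
    exact (Ideal.mul_mono_right ih).trans (reesFilter_one_mul_le m I n)

theorem map_le_reesFilter (m I : Ideal R) (n : ℕ) :
    m.map (algebraMap R (reesAlgebra I)) ≤ reesFilter m I n := by
  rw [Ideal.map_le_iff_le_comap]
  intro r hr j _
  have : ((algebraMap R (reesAlgebra I) r : reesAlgebra I) : Polynomial R) = Polynomial.C r := rfl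
  rw [this, Polynomial.coeff_C]
  split_ifs with h
  · subst h; simpa using hr
  · exact zero_mem _

/-- The coefficient map from the Rees algebra to `Iʲ`. -/
noncomputable def reesCoeff (I : Ideal R) (j : ℕ) : reesAlgebra I →ₗ[R] ↥(I ^ j) :=
  ((Polynomial.lcoeff R j).comp (reesAlgebra I).val.toLinearMap).codRestrict (I ^ j)
    fun f => f.2 j

/-- The map from the Rees algebra to the first `n` graded pieces of the special fiber. -/
noncomputable def reesTruncation (m I : Ideal R) (n : ℕ) :
    reesAlgebra I →ₗ[R] ((j : Fin n) → ↥(I ^ (j : ℕ)) ⧸ (m • ⊤ : Submodule R ↥(I ^ (j : ℕ)))) :=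
  LinearMap.pi fun j => (Submodule.mkQ _).comp (reesCoeff I j)

theorem reesTruncation_surjective (m I : Ideal R) (n : ℕ) :
    Function.Surjective (reesTruncation m I n) := by
  intro v
  choose a ha using fun j => Submodule.Quotient.mk_surjective _ (v j)
  refine ⟨⟨∑ j : Fin n, Polynomial.monomial (j : ℕ) (a j : R), sum_mem fun j _ =>
    reesAlgebra.monomial_mem.2 (a j).2⟩, ?_⟩
  funext j
  rw [← ha j]
  change Submodule.Quotient.mk (reesCoeff I j _) = _
  congr 1
  apply Subtype.ext
  change (∑ j : Fin n, Polynomial.monomial (j : ℕ) (a j : R)).coeff (j : ℕ) = a j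
  rw [Polynomial.finsetSum_coeff, Finset.sum_eq_single j]
  · simp
  · intro b _ hb
    rw [Polynomial.coeff_monomial, if_neg (fun h => hb (Fin.ext h))]
  · simp

theorem reesFilter_le_ker (m I : Ideal R) (n : ℕ) {f : reesAlgebra I}
    (hf : f ∈ reesFilter m I n) : reesTruncation m I n f = 0 := by
  funext j
  change Submodule.Quotient.mk (reesCoeff I j f) = 0
  rw [Submodule.Quotient.mk_eq_zero, Submodule.mem_smul_top_iff]
  exact hf j j.2

/-- Lengths of quotients of a Noetherian algebra `S` with an augmentation to the residue field
of the base grow at most as dictated by the dimension of `S ⧸ J`. -/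
theorem exists_length_le_of_augmentation [IsLocalRing R] {S : Type*} [CommRing S] [Algebra R S]
    [IsNoetherianRing S] (J : Ideal S) (ψ : S →+* IsLocalRing.ResidueField R)
    (hψC : ∀ r, ψ (algebraMap R S r) = IsLocalRing.residue R r) (hJ : J ≤ RingHom.ker ψ) :
    ∃ h C : ℕ, (h : WithBot ℕ∞) ≤ ringKrullDim (S ⧸ J) ∧
      ∀ (n : ℕ) (Y : Type u) [AddCommGroup Y] [Module R Y] (T : S →ₗ[R] Y),
        Function.Surjective T → (∀ f ∈ RingHom.ker ψ ^ n ⊔ J, T f = 0) →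
        Module.length R Y ≤ (C * n ^ h : ℕ) := by
  let ψ' : (S ⧸ J) →+* IsLocalRing.ResidueField R := Ideal.Quotient.lift J ψ hJ
  have hψ' : Function.Surjective ψ' := by
    intro x
    obtain ⟨r, rfl⟩ := IsLocalRing.residue_surjective x
    exact ⟨Ideal.Quotient.mk J (algebraMap R _ r), hψC r⟩
  obtain ⟨N, hN⟩ : ∃ N : Ideal (S ⧸ J), N = RingHom.ker ψ' := ⟨_, rfl⟩
  have hmax : N.IsMaximal := hN ▸ RingHom.ker_isMaximal_of_surjective ψ' hψ'
  have hmap : (RingHom.ker ψ).map (Ideal.Quotient.mk J) = N := by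
    rw [← Ideal.map_comap_of_surjective _ Ideal.Quotient.mk_surjective N, hN]
    rfl
  have hpow : ∀ n, ∀ f, Ideal.Quotient.mk J f ∈ N ^ n → f ∈ RingHom.ker ψ ^ n ⊔ J := by
    intro n f hf
    have h0 : f ∈ ((RingHom.ker ψ ^ n).map (Ideal.Quotient.mk J)).comap (Ideal.Quotient.mk J) := by
      rw [Ideal.map_pow, hmap]
      exact hf
    rwa [Ideal.comap_map_of_surjective _ Ideal.Quotient.mk_surjective, ← RingHom.ker_eq_comap_bot,
      Ideal.mk_ker] at h0
  have hlen : Module.length R ((S ⧸ J) ⧸ N) ≠ ⊤ := by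
    let g : R →ₗ[R] ((S ⧸ J) ⧸ N) := Algebra.linearMap R ((S ⧸ J) ⧸ N)
    have hsurj : Function.Surjective g := by
      intro x
      obtain ⟨x, rfl⟩ := Ideal.Quotient.mk_surjective x
      obtain ⟨r, hr⟩ := IsLocalRing.residue_surjective (ψ' x)
      refine ⟨r, ?_⟩
      change Ideal.Quotient.mk N (Ideal.Quotient.mk J (algebraMap R _ r)) = _
      rw [Ideal.Quotient.eq, hN, RingHom.mem_ker, map_sub, sub_eq_zero, ← hr]
      exact hψC r
    refine ne_top_of_le_ne_top ?_ (Module.length_le_of_ker_le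
      (Submodule.mkQ (IsLocalRing.maximalIdeal R)) g (Submodule.mkQ_surjective _) hsurj ?_)
    · have : IsSimpleModule R (R ⧸ IsLocalRing.maximalIdeal R) :=
        isSimpleModule_iff_isCoatom.2 (Ideal.IsMaximal.out)
      rw [Module.length_eq_one]
      exact ENat.one_ne_top
    · intro c hc
      rw [Submodule.ker_mkQ] at hc
      change Ideal.Quotient.mk N (Ideal.Quotient.mk J (algebraMap R _ c)) = 0
      rw [Ideal.Quotient.eq_zero_iff_mem, hN, RingHom.mem_ker]
      exact (hψC c).trans ((IsLocalRing.residue_eq_zero_iff c).2 hc)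
  obtain ⟨h, C, hh, hC⟩ := exists_length_quotient_pow_le (R := R) N hlen
  refine ⟨h, C, ?_, fun n Y _ _ T hT hTker => ?_⟩
  · have := Ideal.height_le_ringKrullDim_of_ne_top hmax.ne_top
    rw [← hh] at this
    exact this
  · refine le_trans ?_ (hC n)
    refine Module.length_le_of_ker_le
      ((Ideal.Quotient.mkₐ R (N ^ n)).comp (Ideal.Quotient.mkₐ R J)).toLinearMap T ?_ hT ?_
    · exact Ideal.Quotient.mk_surjective.comp Ideal.Quotient.mk_surjective
    · intro f hf
      exact hTker f (hpow n f (Ideal.Quotient.eq_zero_iff_mem.1 hf))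

/-- The numbers of generators of the powers of `I` grow at most as dictated by the dimension of
the special fiber ring. -/
theorem exists_sum_length_le [IsNoetherianRing R] [IsLocalRing R] (I : Ideal R) :
    ∃ h C : ℕ, (h : WithBot ℕ∞) ≤ ringKrullDim ((reesAlgebra I) ⧸
        (IsLocalRing.maximalIdeal R).map (algebraMap R (reesAlgebra I))) ∧
      ∀ n, ∑ j ∈ Finset.range n, Module.length R
        (↥(I ^ j) ⧸ (IsLocalRing.maximalIdeal R • ⊤ : Submodule R ↥(I ^ j))) ≤ (C * n ^ h : ℕ) := by
  let ψ : reesAlgebra I →+* IsLocalRing.ResidueField R :=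
    (IsLocalRing.residue R).comp (Polynomial.constantCoeff.comp (reesAlgebra I).val.toRingHom)
  have hψ : RingHom.ker ψ = reesFilter (IsLocalRing.maximalIdeal R) I 1 := by
    ext f
    change IsLocalRing.residue R ((f : Polynomial R).coeff 0) = 0 ↔ _
    rw [IsLocalRing.residue_eq_zero_iff]
    constructor
    · intro h j hj
      obtain rfl : j = 0 := by omega
      rwa [pow_zero, Ideal.one_eq_top, Ideal.mul_top]
    · intro h
      have := h 0 one_pos
      rwa [pow_zero, Ideal.one_eq_top, Ideal.mul_top] at this
  have hψC : ∀ r, ψ (algebraMap R _ r) = IsLocalRing.residue R r := by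
    intro r
    change IsLocalRing.residue R ((Polynomial.C r).coeff 0) = _
    rw [Polynomial.coeff_C_zero]
  obtain ⟨h, C, hh, hC⟩ := exists_length_le_of_augmentation
    ((IsLocalRing.maximalIdeal R).map (algebraMap R (reesAlgebra I))) ψ hψC
    (hψ ▸ map_le_reesFilter _ I 1)
  refine ⟨h, C, hh, fun n => ?_⟩
  rw [Finset.sum_range, ← Module.length_pi_of_fintype]
  refine hC n _ (reesTruncation _ I n) (reesTruncation_surjective _ I n) fun f hf => ?_
  rw [hψ] at hf
  exact reesFilter_le_ker _ I n
    ((sup_le (reesFilter_one_pow_le _ I n) (map_le_reesFilter _ I n)) hf)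
end

theorem IsLocalRing.exists_fin_span_eq {R : Type*} [CommRing R] [IsNoetherianRing R]
    [IsLocalRing R] (J : Ideal R) : ∃ (r : ℕ) (y : Fin r → R), Ideal.span (Set.range y) = J ∧
      (r : ℕ∞) = Module.length R (↥J ⧸ (maximalIdeal R • ⊤ : Submodule R ↥J)) := by
  have hfg : Submodule.FG (J : Submodule R R) := IsNoetherian.noetherian J
  have hr := IsLocalRing.spanFinrank_eq_finrank_quotient (R := R) (M := R) J hfg
  obtain ⟨s, hs, hspan⟩ := hfg.exists_span_set_encard_eq_spanFinrank
  have hsf : s.Finite := Set.finite_of_encard_eq_coe hs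
  have hc : hsf.toFinset.card = Submodule.spanFinrank (J : Submodule R R) := by
    rw [hsf.encard_eq_coe_toFinset_card] at hs
    exact_mod_cast hs
  refine ⟨Submodule.spanFinrank (J : Submodule R R),
    fun i => (hsf.toFinset.equivFinOfCardEq hc).symm i, ?_, ?_⟩
  · refine Eq.trans ?_ hspan
    change Ideal.span _ = Ideal.span s
    congr 1
    ext x
    constructor
    · rintro ⟨i, rfl⟩
      exact hsf.mem_toFinset.1 ((hsf.toFinset.equivFinOfCardEq hc).symm i).2
    · intro hx
      exact ⟨hsf.toFinset.equivFinOfCardEq hc ⟨x, hsf.mem_toFinset.2 hx⟩, by simp⟩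
  · let : Field (R ⧸ maximalIdeal R) := Ideal.Quotient.field _
    let Q := ↥J ⧸ (maximalIdeal R • ⊤ : Submodule R ↥J)
    have : IsScalarTower R (R ⧸ maximalIdeal R) Q := inferInstance
    have hf : Module.Finite (R ⧸ maximalIdeal R) Q := by
      have : Module.Finite R Q := inferInstance
      exact Module.Finite.of_restrictScalars_finite R _ _
    rw [hr, Module.length_eq_of_surjective (M := Q) (R := R ⧸ maximalIdeal R) (S := R)
      Ideal.Quotient.mk_surjective]
    rw [Module.length_eq_finrank]

section

variable {R : Type*} [CommRing R] {D C : Type*} [AddCommGroup D] [Module R D] [AddCommGroup C]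
  [Module R C]

theorem dual_artin_rees_pow [IsArtinian R D] {I : Ideal R} (hI : I.FG) (Z : Submodule R D) :
    ∃ n₀, ∀ t, ∀ z : D, (∀ c ∈ I ^ t, c • z ∈ Z ⊔ killedBy D (I ^ n₀)) →
      z ∈ Z ⊔ killedBy D (I ^ (n₀ + t)) := by
  obtain ⟨n₀, h₀⟩ := dual_artin_rees hI Z
  refine ⟨n₀, fun t => ?_⟩
  induction t with
  | zero => exact fun z hz => by simpa using hz 1 (by simp)
  | succ t ih =>
    refine fun z hz => h₀ _ (Nat.le_add_right _ _) z fun d hd => ih _ fun c hc => ?_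
    rw [← mul_smul]
    exact hz _ (by rw [pow_succ]; exact Ideal.mul_mem_mul hc hd)

theorem exists_length_comap_killedBy_pow_le [IsArtinian R D] {I : Ideal R} (hI : I.FG)
    (f : D →ₗ[R] C) : ∃ n₀, ∀ t, ∀ (r : ℕ) (y : Fin r → R), Ideal.span (Set.range y) = I ^ t →
      Module.length R (↥((killedBy C (I ^ (n₀ + t))).comap f) ⧸
        (LinearMap.ker f ⊔ killedBy D (I ^ (n₀ + t))).submoduleOf
          ((killedBy C (I ^ (n₀ + t))).comap f)) ≤
      r * Module.length R (↥((killedBy C (I ^ n₀)).comap f) ⧸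
        (LinearMap.ker f ⊔ killedBy D (I ^ n₀)).submoduleOf
          ((killedBy C (I ^ n₀)).comap f)) := by
  obtain ⟨n₀, h₀⟩ := dual_artin_rees_pow hI (LinearMap.ker f)
  refine ⟨n₀, fun t r y hy => ?_⟩
  have hmem : ∀ j, ∀ z ∈ (killedBy C (I ^ (n₀ + t))).comap f,
      LinearMap.lsmul R D (y j) z ∈ (killedBy C (I ^ n₀)).comap f := by
    intro j z hz c hc
    rw [LinearMap.lsmul_apply, map_smul, ← mul_smul]
    exact hz _ (by
      rw [pow_add]
      exact Ideal.mul_mem_mul hc (hy ▸ Ideal.subset_span ⟨j, rfl⟩))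
  let g := LinearMap.pi fun j => (Submodule.mkQ ((LinearMap.ker f ⊔ killedBy D (I ^ n₀)).submoduleOf
    ((killedBy C (I ^ n₀)).comap f))).comp ((LinearMap.lsmul R D (y j)).restrict (hmem j))
  have hlen : Module.length R (Fin r → (↥((killedBy C (I ^ n₀)).comap f) ⧸
        (LinearMap.ker f ⊔ killedBy D (I ^ n₀)).submoduleOf
          ((killedBy C (I ^ n₀)).comap f))) = r * Module.length R
        (↥((killedBy C (I ^ n₀)).comap f) ⧸
        (LinearMap.ker f ⊔ killedBy D (I ^ n₀)).submoduleOf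
          ((killedBy C (I ^ n₀)).comap f)) := by
    rw [Module.length_pi_of_fintype]
    simp
  rw [← hlen]
  refine (Module.length_le_of_ker_le g.rangeRestrict (Submodule.mkQ _)
    g.surjective_rangeRestrict (Submodule.mkQ_surjective _) ?_).trans
    (Module.length_le_of_injective _ (Submodule.subtype_injective (LinearMap.range g)))
  rw [LinearMap.ker_rangeRestrict, Submodule.ker_mkQ]
  intro z hz
  refine h₀ t _ ?_
  rw [← hy]
  intro c hc
  refine Submodule.smul_mem_of_mem_span ?_ hc
  rintro _ ⟨j, rfl⟩
  have hj : g z j = 0 := congrFun (LinearMap.mem_ker.1 hz) j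
  exact (Submodule.Quotient.mk_eq_zero _
    (x := (LinearMap.lsmul R D (y j)).restrict (hmem j) z)).1 hj

/-- The cokernel of the map induced by `f` on the elements killed by `J`. -/
abbrev killedCoker (f : D →ₗ[R] C) (J : Ideal R) : Type _ :=
  ↥(killedBy C J) ⧸ ((killedBy D J).map f).submoduleOf (killedBy C J)

/-- The map from `f⁻¹` of the elements killed by `J` to `killedCoker f J`. -/
def toKilledCoker (f : D →ₗ[R] C) (J : Ideal R) :
    ↥((killedBy C J).comap f) →ₗ[R] killedCoker f J :=
  (Submodule.mkQ _).comp (f.restrict fun _ hz => hz)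

theorem ker_toKilledCoker (f : D →ₗ[R] C) (J : Ideal R) :
    LinearMap.ker (toKilledCoker f J) =
      (LinearMap.ker f ⊔ killedBy D J).submoduleOf ((killedBy C J).comap f) := by
  ext z
  rw [LinearMap.mem_ker]
  refine (Submodule.Quotient.mk_eq_zero _).trans ?_
  change f z ∈ (killedBy D J).map f ↔ (z : D) ∈ LinearMap.ker f ⊔ killedBy D J
  rw [sup_comm, ← Submodule.comap_map_eq, Submodule.mem_comap]

theorem length_killedCoker_le (f : D →ₗ[R] C) (J : Ideal R) :
    Module.length R (killedCoker f J) ≤ Module.length R (↥((killedBy C J).comap f) ⧸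
      (LinearMap.ker f ⊔ killedBy D J).submoduleOf ((killedBy C J).comap f)) +
      Module.length R (killedBy (C ⧸ LinearMap.range f) J) := by
  have hmem : ∀ z ∈ killedBy C J, (LinearMap.range f).mkQ z ∈ killedBy (C ⧸ LinearMap.range f) J :=
    fun z hz c hc => by rw [← map_smul, hz c hc, map_zero]
  let h : killedCoker f J →ₗ[R] killedBy (C ⧸ LinearMap.range f) J :=
    Submodule.liftQ _ ((LinearMap.range f).mkQ.restrict hmem) (by
      rintro z ⟨w, -, hw⟩
      rw [LinearMap.mem_ker]
      ext
      exact (Submodule.Quotient.mk_eq_zero _).2 ⟨w, hw⟩)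
  refine (Module.length_le_add_of_exact (LinearMap.range (toKilledCoker f J)).subtype h ?_).trans
    (add_le_add ?_ le_rfl)
  · intro x
    obtain ⟨z, rfl⟩ := Submodule.mkQ_surjective _ x
    rw [Submodule.coe_subtype, Subtype.range_coe, SetLike.mem_coe]
    constructor
    · intro hz
      obtain ⟨w, hw⟩ := (Submodule.Quotient.mk_eq_zero _).1 (congrArg Subtype.val hz)
      exact ⟨⟨w, by rw [Submodule.mem_comap, hw]; exact z.2⟩,
        congrArg (Submodule.mkQ _) (Subtype.ext hw)⟩
    · rintro ⟨w, hw⟩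
      rw [← hw]
      ext
      exact (Submodule.Quotient.mk_eq_zero _).2 ⟨w, rfl⟩
  · rw [← (toKilledCoker f J).quotKerEquivRange.length_eq, ker_toKilledCoker]

theorem length_comap_quotient_le (f : D →ₗ[R] C) (J : Ideal R) :
    Module.length R (↥((killedBy C J).comap f) ⧸
      (LinearMap.ker f ⊔ killedBy D J).submoduleOf ((killedBy C J).comap f)) ≤
      Module.length R (killedCoker f J) := by
  rw [← ker_toKilledCoker, (toKilledCoker f J).quotKerEquivRange.length_eq]
  exact Module.length_le_of_injective _ (Submodule.subtype_injective _)

end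

theorem Ideal.sup_pow_le_pow_sup {R : Type*} [CommRing R] (I b : Ideal R) (n : ℕ) :
    (I ⊔ b) ^ n ≤ I ^ n ⊔ b := by
  induction n with
  | zero => simp
  | succ n ih =>
    calc (I ⊔ b) ^ (n + 1) ≤ (I ^ n ⊔ b) * (I ⊔ b) := by
          rw [pow_succ]; exact Ideal.mul_mono_left ih
      _ ≤ I ^ (n + 1) ⊔ b := by
          rw [Ideal.sup_mul, Ideal.mul_sup, ← pow_succ]
          exact sup_le (sup_le_sup (le_refl (I ^ (n + 1))) (Ideal.mul_le_right : I ^ n * b ≤ b))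
            ((Ideal.mul_le_left : b * (I ⊔ b) ≤ b).trans le_sup_right)

theorem exists_list_pow_le_sup {R : Type*} [CommRing R] [IsNoetherianRing R] [IsLocalRing R]
    (b : Ideal R) (hb : b ≠ ⊤) : ∃ (l : List R) (e : ℕ),
      (∀ x ∈ l, x ∈ IsLocalRing.maximalIdeal R) ∧
      IsLocalRing.maximalIdeal R ^ e ≤ Ideal.ofList l ⊔ b ∧
      (l.length : WithBot ℕ∞) = ringKrullDim (R ⧸ b) := by
  have : Nontrivial (R ⧸ b) := Ideal.Quotient.nontrivial_iff.2 hb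
  have : IsLocalRing (R ⧸ b) := IsLocalRing.of_surjective' _ Ideal.Quotient.mk_surjective
  have hloc : IsLocalHom (Ideal.Quotient.mk b) :=
    IsLocalHom.of_surjective _ Ideal.Quotient.mk_surjective
  obtain ⟨l', hmin, hlen⟩ := exists_list_mem_minimalPrimes (IsLocalRing.maximalIdeal (R ⧸ b))
  obtain ⟨e, he⟩ := exists_pow_le_sup_pow_of_mem_minimalPrimes hmin
  have he' : IsLocalRing.maximalIdeal (R ⧸ b) ^ e ≤ Ideal.ofList l' := by
    refine Submodule.le_of_le_smul_of_le_jacobson_bot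
      (I := IsLocalRing.maximalIdeal (R ⧸ b)) (IsNoetherian.noetherian _)
      (IsLocalRing.maximalIdeal_le_jacobson _) ?_
    have := he (e + 1)
    rwa [pow_succ'] at this
  obtain ⟨l, rfl⟩ : ∃ l : List R, l.map (Ideal.Quotient.mk b) = l' :=
    List.map_surjective_iff.2 Ideal.Quotient.mk_surjective l'
  refine ⟨l, e, fun x hx => ?_, fun x hx => ?_, ?_⟩
  · have hx' : Ideal.Quotient.mk b x ∈ IsLocalRing.maximalIdeal (R ⧸ b) :=
      hmin.1.2 (Ideal.subset_span (List.mem_map_of_mem hx))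
    rw [IsLocalRing.mem_maximalIdeal, mem_nonunits_iff] at hx' ⊢
    exact fun h => hx' (h.map _)
  · have h1 : Ideal.Quotient.mk b x ∈ IsLocalRing.maximalIdeal (R ⧸ b) ^ e := by
      have := Ideal.mem_map_of_mem (Ideal.Quotient.mk b) hx
      rw [Ideal.map_pow] at this
      exact Ideal.pow_right_mono (((IsLocalRing.local_hom_TFAE (Ideal.Quotient.mk b)).out 0 2).1
        hloc) e this
    have h2 := he' h1
    rw [← Ideal.map_ofList, ← Ideal.mem_comap, Ideal.comap_map_quotientMk, sup_comm] at h2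
    exact h2
  · rw [← IsLocalRing.maximalIdeal_height_eq_ringKrullDim, ← hlen, List.length_map]
    rfl

theorem exists_length_killedBy_pow_le {R : Type u} [CommRing R] [IsNoetherianRing R]
    [IsLocalRing R] {Q : Type u} [AddCommGroup Q] [Module R Q] [IsArtinian R Q] (I b : Ideal R)
    (hb : ∀ s ∈ b, ∀ z : Q, s • z = 0) (e₀ : ℕ) (he₀ : IsLocalRing.maximalIdeal R ^ e₀ ≤ I ⊔ b) :
    ∃ K d : ℕ, (K = 0 ∨ (d : WithBot ℕ∞) = ringKrullDim (R ⧸ b)) ∧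
      ∀ n, Module.length R (killedBy Q (I ^ n)) ≤ (K * n ^ d : ℕ) := by
  by_cases hbt : b = ⊤
  · refine ⟨0, 0, Or.inl rfl, fun n => ?_⟩
    have : Subsingleton Q := ⟨fun z w => by
      rw [← one_smul R z, ← one_smul R w, hb 1 (by simp [hbt]), hb 1 (by simp [hbt])]⟩
    rw [Module.length_eq_zero]
    exact zero_le
  obtain ⟨l, e, hl, hle, hd⟩ := exists_list_pow_le_sup b hbt
  have hbot : ∀ J : Ideal R, killedBy Q (J ⊔ b) = killedBy Q J := fun J => by
    rw [killedBy_sup, inf_eq_left]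
    exact fun z _ s hs => hb s hs z
  have hfin : Module.length R (killedBy Q (Ideal.ofList l)) ≠ ⊤ := by
    rw [Module.length_ne_top_iff]
    refine isFiniteLength_of_pow_smul_eq_zero (m := IsLocalRing.maximalIdeal R) e _
      (fun c hc z => ?_) (Or.inr inferInstance)
    exact Subtype.ext (((hbot _).ge z.2 : (z : Q) ∈ _) c (hle hc))
  obtain ⟨k, hk⟩ := ENat.ne_top_iff_exists.1 hfin
  refine ⟨e₀ ^ l.length * k, l.length, Or.inr hd, fun n => ?_⟩
  have hsub : killedBy Q (I ^ n) ≤ killedBy Q (Ideal.ofList (l.map (· ^ (e₀ * n)))) := by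
    rw [← hbot (I ^ n)]
    refine killedBy_anti (Ideal.span_le.2 ?_)
    intro y hy
    obtain ⟨x, hx, rfl⟩ := List.mem_map.1 hy
    refine Ideal.sup_pow_le_pow_sup I b n (Ideal.pow_right_mono he₀ n ?_)
    rw [← pow_mul]
    exact Ideal.pow_mem_pow (hl x hx) _
  have := length_inf_killedBy_ofList_le l (e₀ * n) (⊤ : Submodule R Q)
  rw [top_inf_eq, top_inf_eq, ← hk] at this
  refine (Submodule.length_mono hsub).trans (this.trans ?_)
  rw [← Nat.cast_mul, Nat.cast_le, mul_pow]
  exact le_of_eq (by ring)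

theorem isFiniteLength_killedCoker {R D C : Type*} [CommRing R] [IsLocalRing R]
    [AddCommGroup D] [Module R D] [AddCommGroup C] [Module R C] [IsArtinian R C]
    (f : D →ₗ[R] C) (I a : Ideal R) (e₀ : ℕ)
    (he₀ : IsLocalRing.maximalIdeal R ^ e₀ ≤ I ⊔ a) (n : ℕ)
    (ha : ∀ z ∈ killedBy C (I ^ n), ∀ s ∈ a, s • z ∈ (killedBy D (I ^ n)).map f) :
    IsFiniteLength R (killedCoker f (I ^ n)) := by
  refine isFiniteLength_of_pow_smul_eq_zero (m := IsLocalRing.maximalIdeal R) (e₀ * n) _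
    (fun c hc z => ?_) (Or.inr inferInstance)
  obtain ⟨z, rfl⟩ := Submodule.mkQ_surjective _ z
  rw [pow_mul] at hc
  obtain ⟨x, hx, s, hs, rfl⟩ := Submodule.mem_sup.1
    (Ideal.sup_pow_le_pow_sup I a n (Ideal.pow_right_mono he₀ n hc))
  rw [← map_smul]
  refine (Submodule.Quotient.mk_eq_zero _).2 ?_
  change (x + s) • (z : C) ∈ (killedBy D (I ^ n)).map f
  rw [add_smul, z.2 x hx, zero_add]
  exact ha _ z.2 s hs

section

variable {R : Type u} [CommRing R] [IsNoetherianRing R] [IsLocalRing R] {D C : Type u}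
  [AddCommGroup D] [Module R D] [IsArtinian R D] [AddCommGroup C] [Module R C] [IsArtinian R C]

theorem exists_length_killedCoker_le (f : D →ₗ[R] C) (I a b : Ideal R) (hab : a ≤ b) (e₀ : ℕ)
    (he₀ : IsLocalRing.maximalIdeal R ^ e₀ ≤ I ⊔ a)
    (ha : ∀ n, ∀ z ∈ killedBy C (I ^ n), ∀ s ∈ a, s • z ∈ (killedBy D (I ^ n)).map f)
    (hb : ∀ s ∈ b, ∀ z : C, s • z ∈ LinearMap.range f) :
    ∃ n₀ K₁ K₂ d : ℕ, (K₁ = 0 ∨ (d : WithBot ℕ∞) = ringKrullDim (R ⧸ b)) ∧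
      ∀ t, Module.length R (killedCoker f (I ^ (n₀ + t))) ≤ (K₁ * (n₀ + t) ^ d : ℕ) + K₂ *
        Module.length R (↥(I ^ t) ⧸ (IsLocalRing.maximalIdeal R • ⊤ : Submodule R ↥(I ^ t))) := by
  obtain ⟨n₀, h₀⟩ := exists_length_comap_killedBy_pow_le (IsNoetherian.noetherian I) f
  obtain ⟨K₁, d, hd, h₁⟩ := exists_length_killedBy_pow_le (Q := C ⧸ LinearMap.range f) I b
    (fun s hs z => by
      obtain ⟨z, rfl⟩ := Submodule.mkQ_surjective _ z
      rw [← map_smul]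
      exact (Submodule.Quotient.mk_eq_zero _).2 (hb s hs z)) e₀ (he₀.trans (sup_le_sup_left hab _))
  have hfin := (Module.length_ne_top_iff).2 (isFiniteLength_killedCoker f I a e₀ he₀ n₀ (ha n₀))
  obtain ⟨K₂, hK₂⟩ := ENat.ne_top_iff_exists.1
    (ne_top_of_le_ne_top hfin (length_comap_quotient_le f (I ^ n₀)))
  refine ⟨n₀, K₁, K₂, d, hd, fun t => (length_killedCoker_le f _).trans ?_⟩
  obtain ⟨r, y, hy, hr⟩ := IsLocalRing.exists_fin_span_eq (I ^ t)
  rw [add_comm]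
  refine add_le_add (h₁ _) ((h₀ t r y hy).trans ?_)
  rw [← hK₂, hr, mul_comm]

end

theorem Polynomial.exists_mul_pow_le_eval {p : Polynomial ℚ} (hp : p ≠ 0) (N : ℕ)
    (hN : ∀ n : ℕ, N ≤ n → 0 ≤ p.eval (n : ℚ)) :
    ∃ c : ℚ, 0 < c ∧ ∃ T : ℕ, ∀ n : ℕ, T ≤ n → c * (n : ℚ) ^ p.natDegree ≤ p.eval (n : ℚ) := by
  have hlim : Filter.Tendsto (fun n : ℕ => p.eval (n : ℚ) / (n : ℚ) ^ p.natDegree) Filter.atTop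
      (nhds p.leadingCoeff) := by
    have := (Polynomial.div_tendsto_atTop_leadingCoeff_div_of_degree_eq p
      ((Polynomial.X : Polynomial ℚ) ^ p.natDegree)
      (by rw [Polynomial.degree_X_pow, Polynomial.degree_eq_natDegree hp])).comp
      tendsto_natCast_atTop_atTop
    simpa [Function.comp_def] using this
  have h0 : 0 ≤ p.leadingCoeff := by
    refine ge_of_tendsto hlim (Filter.eventually_atTop.2 ⟨N, fun n hn => ?_⟩)
    exact div_nonneg (hN n hn) (by positivity)
  have hpos : 0 < p.leadingCoeff := lt_of_le_of_ne h0 (Ne.symm (by simpa using hp))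
  refine ⟨p.leadingCoeff / 2, by positivity, ?_⟩
  obtain ⟨T, hT⟩ := Filter.eventually_atTop.1
    (hlim.eventually (lt_mem_nhds (show p.leadingCoeff / 2 < p.leadingCoeff by linarith)))
  refine ⟨T + 1, fun n hn => ?_⟩
  have hn' : (0 : ℚ) < n := by exact_mod_cast (by omega : 0 < n)
  have := hT n (by omega)
  rw [lt_div_iff₀ (by positivity)] at this
  exact this.le

theorem Polynomial.natDegree_le_of_eval_le {p : Polynomial ℚ} {n₀ N₀ K₁ K₂ d h C : ℕ}
    {μ : ℕ → ℕ∞} (hμ : ∀ N, ∑ j ∈ Finset.range N, μ j ≤ (C * N ^ h : ℕ))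
    (hp : ∀ t ≥ N₀, ∃ l : ℕ, (l : ℚ) = p.eval ((n₀ + t : ℕ) : ℚ) ∧
      (l : ℕ∞) ≤ (K₁ * (n₀ + t) ^ d : ℕ) + K₂ * μ t) :
    p = 0 ∨ (p.natDegree ≤ d ∧ K₁ ≠ 0) ∨ p.natDegree + 1 ≤ h := by
  by_contra! hcon
  obtain ⟨hp0, hd, hh⟩ := hcon
  have hfin : ∀ j, ∃ k : ℕ, (k : ℕ∞) = μ j := fun j => by
    refine ENat.ne_top_iff_exists.1 (ne_top_of_le_ne_top (ENat.natCast_ne_top (C * (j + 1) ^ h)) ?_)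
    exact (Finset.single_le_sum (fun _ _ => zero_le) (Finset.self_mem_range_succ j)).trans
      (hμ (j + 1))
  choose ν hν using hfin
  have hν' : ∀ N, ∑ j ∈ Finset.range N, ν j ≤ C * N ^ h := fun N => by
    have := hμ N
    simp_rw [← hν] at this
    exact_mod_cast this
  have hub : ∀ t ≥ N₀, 0 ≤ p.eval ((n₀ + t : ℕ) : ℚ) ∧
      p.eval ((n₀ + t : ℕ) : ℚ) ≤ ((K₁ * (n₀ + t) ^ d + K₂ * ν t : ℕ) : ℚ) := fun t ht => by
    obtain ⟨l, hl, hle⟩ := hp t ht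
    rw [← hν] at hle
    rw [← hl]
    exact ⟨by positivity, by exact_mod_cast hle⟩
  obtain ⟨c, hc, T, hT⟩ := Polynomial.exists_mul_pow_le_eval hp0 (n₀ + N₀) (fun n hn => by
    obtain ⟨t, rfl⟩ := Nat.exists_eq_add_of_le ((Nat.le_add_right n₀ N₀).trans hn)
    exact (hub t (by omega)).1)
  set e := p.natDegree
  have hsum : ∀ N, 1 ≤ N → ∑ t ∈ Finset.range N, (K₁ * (n₀ + t) ^ d + K₂ * ν t) ≤
      (K₁ + K₂ * C) * (n₀ + N) ^ e := fun N hN => by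
    rw [Finset.sum_add_distrib, ← Finset.mul_sum, ← Finset.mul_sum, add_mul, mul_assoc]
    refine add_le_add ?_ (Nat.mul_le_mul_left _ ((hν' N).trans (Nat.mul_le_mul_left _ ?_)))
    · rcases Nat.eq_zero_or_pos K₁ with h0 | h0
      · simp [h0]
      have hde : d < e := by
        by_contra! hle
        exact h0.ne' (hd hle)
      refine Nat.mul_le_mul_left _ ?_
      calc ∑ t ∈ Finset.range N, (n₀ + t) ^ d ≤ ∑ t ∈ Finset.range N, (n₀ + N) ^ d :=
            Finset.sum_le_sum fun t ht => Nat.pow_le_pow_left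
              (by have := Finset.mem_range.1 ht; omega) _
        _ = N * (n₀ + N) ^ d := by simp
        _ ≤ (n₀ + N) ^ (d + 1) := by
            rw [pow_succ']; exact Nat.mul_le_mul_right _ (by omega)
        _ ≤ (n₀ + N) ^ e := Nat.pow_le_pow_right (by omega) hde
    · exact (Nat.pow_le_pow_left (by omega) _).trans (Nat.pow_le_pow_right (by omega) (by omega))
  have hkey : ∀ N : ℕ, T + N₀ + 1 ≤ N →
      c * N ≤ (((K₁ + K₂ * C) * (n₀ + 2) ^ e : ℕ) : ℚ) := fun N hN => by
    have hN0 : (0 : ℚ) < (N : ℚ) ^ e := by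
      have : (0 : ℚ) < N := by exact_mod_cast (by omega : 0 < N)
      positivity
    refine le_of_mul_le_mul_right ?_ hN0
    calc c * N * (N : ℚ) ^ e = ∑ t ∈ Finset.Ico N (2 * N), c * (N : ℚ) ^ e := by
          rw [Finset.sum_const, Nat.card_Ico, nsmul_eq_mul, show 2 * N - N = N by omega]; ring
      _ ≤ ∑ t ∈ Finset.Ico N (2 * N), ((K₁ * (n₀ + t) ^ d + K₂ * ν t : ℕ) : ℚ) := by
          refine Finset.sum_le_sum fun t ht => ?_
          have htN := (Finset.mem_Ico.1 ht).1
          refine le_trans ?_ ((hT (n₀ + t) (by omega)).trans (hub t (by omega)).2)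
          refine mul_le_mul_of_nonneg_left (pow_le_pow_left₀ (by positivity) ?_ _) hc.le
          exact_mod_cast (by omega : N ≤ n₀ + t)
      _ = ((∑ t ∈ Finset.Ico N (2 * N), (K₁ * (n₀ + t) ^ d + K₂ * ν t) : ℕ) : ℚ) := by
          rw [Nat.cast_sum]
      _ ≤ (((K₁ + K₂ * C) * (n₀ + 2) ^ e * N ^ e : ℕ) : ℚ) := by
          rw [Nat.cast_le]
          refine ((Finset.sum_le_sum_of_subset (fun t ht => ?_)).trans
            (hsum (2 * N) (by omega))).trans ?_
          · exact Finset.mem_range.2 (Finset.mem_Ico.1 ht).2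
          · rw [mul_assoc, ← mul_pow]
            refine Nat.mul_le_mul_left _ (Nat.pow_le_pow_left ?_ _)
            nlinarith [Nat.zero_le n₀]
      _ = _ := by push_cast; ring
  obtain ⟨N, hN⟩ := exists_nat_gt ((((K₁ + K₂ * C) * (n₀ + 2) ^ e : ℕ) : ℚ) / c)
  rw [div_lt_iff₀ hc] at hN
  have h1 := hkey (N + (T + N₀ + 1)) (by omega)
  have h2 : c * (N : ℚ) ≤ c * ((N + (T + N₀ + 1) : ℕ) : ℚ) :=
    mul_le_mul_of_nonneg_left (by exact_mod_cast Nat.le_add_right _ _) hc.le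
  linarith

section

variable {R : Type u} [CommRing R] {X X' : ModuleCat.{u} R} (P : ProjectiveResolution X)
  (P' : ProjectiveResolution X') (Y : ModuleCat.{u} R)

/-- The contravariant functor `Hom(-, Y)`, as a covariant functor to the opposite category. -/
noncomputable abbrev homToOp : ModuleCat.{u} R ⥤ (ModuleCat.{u} R)ᵒᵖ :=
  ((linearYoneda R (ModuleCat.{u} R)).obj Y).rightOp

/-- The complex `Hom(P, Y)`, viewed in the opposite category. -/
noncomputable abbrev homComplexOp : ChainComplex (ModuleCat.{u} R)ᵒᵖ ℕ :=
  ((homToOp Y).mapHomologicalComplex _).obj P.complex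

variable {Y}

/-- `Ext_R^n(X, Y)`, as an object of the category of modules. -/
noncomputable abbrev extObj (n : ℕ) (X Y : ModuleCat.{u} R) : ModuleCat.{u} R :=
  ((Ext R (ModuleCat.{u} R) n).obj (Opposite.op X)).obj Y

variable (Y) in
/-- `Ext` is computed by the homology of `Hom(P, Y)`. -/
noncomputable def extObjIso (n : ℕ) :
    Opposite.op (extObj n X Y) ≅ (homComplexOp P Y).homology n :=
  P.isoLeftDerivedObj (homToOp Y) n

/-- The map from `G`, in the opposite category, picking out an element of `G`. -/
noncomputable def elementOp {G : (ModuleCat.{u} R)ᵒᵖ} (z : G.unop) :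
    G ⟶ Opposite.op (ModuleCat.of R R) :=
  Quiver.Hom.op (ModuleCat.ofHom (LinearMap.toSpanSingleton R G.unop z))

/-- The element picked out by a map to the ring in the opposite category. -/
def evalOne {G : (ModuleCat.{u} R)ᵒᵖ} (g : G ⟶ Opposite.op (ModuleCat.of R R)) : G.unop :=
  g.unop.hom (1 : R)

theorem evalOne_elementOp {G : (ModuleCat.{u} R)ᵒᵖ} (z : G.unop) :
    evalOne (elementOp z) = z :=
  one_smul R z

theorem elementOp_evalOne {G : (ModuleCat.{u} R)ᵒᵖ} (g : G ⟶ Opposite.op (ModuleCat.of R R)) :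
    elementOp (evalOne g) = g := by
  apply Quiver.Hom.unop_inj
  ext
  exact evalOne_elementOp _

theorem evalOne_comp {G H : (ModuleCat.{u} R)ᵒᵖ} (h : G ⟶ H)
    (g : H ⟶ Opposite.op (ModuleCat.of R R)) : evalOne (h ≫ g) = h.unop.hom (evalOne g) :=
  rfl

theorem evalOne_injective {G : (ModuleCat.{u} R)ᵒᵖ} :
    Function.Injective (evalOne : (G ⟶ Opposite.op (ModuleCat.of R R)) → G.unop) :=
  Function.LeftInverse.injective elementOp_evalOne

theorem comp_elementOp {G H : (ModuleCat.{u} R)ᵒᵖ} (h : G ⟶ H) (z : H.unop) :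
    h ≫ elementOp z = elementOp (h.unop.hom z) := by
  apply evalOne_injective
  rw [evalOne_comp, evalOne_elementOp, evalOne_elementOp]

theorem elementOp_add {G : (ModuleCat.{u} R)ᵒᵖ} (z w : G.unop) :
    elementOp (z + w) = elementOp z + elementOp w := by
  apply evalOne_injective
  exact (evalOne_elementOp _).trans
    (congrArg₂ (· + ·) (evalOne_elementOp z).symm (evalOne_elementOp w).symm)

/-- The map from `Hom(Pₙ, Y)`, in the opposite category, picking out a homomorphism. -/
noncomputable def homElementOp {n : ℕ} (f : P.complex.X n ⟶ Y) :
    (homComplexOp P Y).X n ⟶ Opposite.op (ModuleCat.of R R) :=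
  elementOp (G := (homComplexOp P Y).X n) f

/-- The homomorphism picked out by a map to the ring in the opposite category. -/
noncomputable def evalHom {n : ℕ} (g : (homComplexOp P Y).X n ⟶ Opposite.op (ModuleCat.of R R)) :
    P.complex.X n ⟶ Y :=
  evalOne g

theorem evalHom_homElementOp {n : ℕ} (f : P.complex.X n ⟶ Y) :
    evalHom P (homElementOp P f) = f :=
  evalOne_elementOp (G := (homComplexOp P Y).X n) f

theorem homElementOp_evalHom {n : ℕ}
    (g : (homComplexOp P Y).X n ⟶ Opposite.op (ModuleCat.of R R)) :
    homElementOp P (evalHom P g) = g :=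
  elementOp_evalOne g

theorem d_comp_homElementOp {n m : ℕ} (f : P.complex.X n ⟶ Y) :
    (homComplexOp P Y).d m n ≫ homElementOp P f = homElementOp P (P.complex.d m n ≫ f) :=
  comp_elementOp (G := (homComplexOp P Y).X m) (H := (homComplexOp P Y).X n)
    ((homComplexOp P Y).d m n) f

theorem map_comp_homElementOp {P : ProjectiveResolution X} {P' : ProjectiveResolution X'} {n : ℕ}
    (φ : P'.complex ⟶ P.complex) (f : P.complex.X n ⟶ Y) :
    (((homToOp Y).mapHomologicalComplex _).map φ).f n ≫ homElementOp P f =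
      homElementOp P' (φ.f n ≫ f) :=
  comp_elementOp (G := (homComplexOp P' Y).X n) (H := (homComplexOp P Y).X n)
    ((((homToOp Y).mapHomologicalComplex _).map φ).f n) f

theorem homElementOp_zero {n : ℕ} : homElementOp P (0 : P.complex.X n ⟶ Y) = 0 := by
  apply evalOne_injective
  exact evalOne_elementOp (G := (homComplexOp P Y).X n) (0 : P.complex.X n ⟶ Y)

theorem homElementOp_add {n : ℕ} (f g : P.complex.X n ⟶ Y) :
    homElementOp P (f + g) = homElementOp P f + homElementOp P g :=
  elementOp_add (G := (homComplexOp P Y).X n) f g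

theorem homElementOp_smul {n : ℕ} (r : R) (f : P.complex.X n ⟶ Y) :
    homElementOp P (r • f) = homElementOp P f ≫ (r • 𝟙 (ModuleCat.of R R)).op := by
  apply evalOne_injective
  refine (evalOne_elementOp (G := (homComplexOp P Y).X n) (r • f)).trans ?_
  change r • f = LinearMap.toSpanSingleton R (P.complex.X n ⟶ Y) f (r • (1 : R))
  simp

theorem evalOne_comp_smul {G : (ModuleCat.{u} R)ᵒᵖ} (r : R)
    (g : G ⟶ Opposite.op (ModuleCat.of R R)) :
    evalOne (g ≫ (r • 𝟙 (ModuleCat.of R R)).op) = r • evalOne g :=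
  map_smul g.unop.hom r (1 : R)

variable (Y) in
/-- The cocycles in `Hom(Pₙ, Y)`. -/
def homCocycles (n : ℕ) : Submodule R (P.complex.X n ⟶ Y) :=
  LinearMap.ker (Linear.leftComp R Y (P.complex.d (n + 1) n))

theorem mem_homCocycles {n : ℕ} {f : P.complex.X n ⟶ Y} :
    f ∈ homCocycles P Y n ↔ P.complex.d (n + 1) n ≫ f = 0 := Iff.rfl

/-- The map from the opcycles of `Hom(P, Y)`, in the opposite category, defined by a cocycle. -/
noncomputable def descCocycle {n : ℕ} (f : homCocycles P Y n) :
    (homComplexOp P Y).opcycles n ⟶ Opposite.op (ModuleCat.of R R) :=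
  (homComplexOp P Y).descOpcycles (homElementOp P f.1) (n + 1)
    (ChainComplex.prev ℕ n) (by
      rw [d_comp_homElementOp, (mem_homCocycles P).1 f.2, homElementOp_zero])

theorem p_descCocycle {n : ℕ} (f : homCocycles P Y n) :
    (homComplexOp P Y).pOpcycles n ≫ descCocycle P f = homElementOp P f.1 :=
  HomologicalComplex.p_descOpcycles _ _ _ _ _

variable (Y) in
/-- The class in `Ext` of a cocycle, as a linear map. -/
noncomputable def extClass (n : ℕ) : homCocycles P Y n →ₗ[R] extObj n X Y where
  toFun f := evalOne ((extObjIso P Y n).hom ≫ (homComplexOp P Y).homologyι n ≫ descCocycle P f)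
  map_add' f g := by
    have : descCocycle P (f + g) = descCocycle P f + descCocycle P g := by
      rw [← cancel_epi ((homComplexOp P Y).pOpcycles n), Preadditive.comp_add, p_descCocycle,
        p_descCocycle, p_descCocycle]
      exact homElementOp_add _ _ _
    rw [this, Preadditive.comp_add, Preadditive.comp_add]
    rfl
  map_smul' r f := by
    have : descCocycle P (r • f) =
        descCocycle P f ≫ (r • (𝟙 (ModuleCat.of R R))).op := by
      rw [← cancel_epi ((homComplexOp P Y).pOpcycles n), p_descCocycle, ← Category.assoc,
        p_descCocycle]
      exact homElementOp_smul _ _ _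
    rw [this, ← Category.assoc, ← Category.assoc, evalOne_comp_smul, Category.assoc]
    rfl

theorem extClass_surjective (n : ℕ) : Function.Surjective (extClass P Y n) := by
  intro x
  let y : (homComplexOp P Y).homology n ⟶ Opposite.op (ModuleCat.of R R) :=
    (extObjIso P Y n).inv ≫ elementOp (G := Opposite.op (extObj n X Y)) x
  let y' := Injective.factorThru y ((homComplexOp P Y).homologyι n)
  have hf : P.complex.d (n + 1) n ≫ evalHom P ((homComplexOp P Y).pOpcycles n ≫ y') = 0 := by
    rw [← evalHom_homElementOp P (P.complex.d (n + 1) n ≫ _), ← d_comp_homElementOp,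
      homElementOp_evalHom, HomologicalComplex.d_pOpcycles_assoc, Limits.zero_comp]
    rfl
  refine ⟨⟨_, hf⟩, ?_⟩
  have h1 : descCocycle P ⟨_, hf⟩ = y' := by
    rw [← cancel_epi ((homComplexOp P Y).pOpcycles n), p_descCocycle, homElementOp_evalHom]
  change evalOne ((extObjIso P Y n).hom ≫ (homComplexOp P Y).homologyι n ≫ descCocycle P _) = x
  rw [h1, Injective.comp_factorThru, Iso.hom_inv_id_assoc]
  exact evalOne_elementOp (G := Opposite.op (extObj n X Y)) x

theorem descCocycle_of_extClass_eq_zero {n : ℕ} {f : homCocycles P Y n} (h : extClass P Y n f = 0) :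
    (homComplexOp P Y).homologyι n ≫ descCocycle P f = 0 := by
  have : (extObjIso P Y n).hom ≫ (homComplexOp P Y).homologyι n ≫
      descCocycle P f = 0 := evalOne_injective h
  rwa [← cancel_epi (extObjIso P Y n).hom, Limits.comp_zero]

theorem extClass_zero_eq_zero_iff {f : homCocycles P Y 0} : extClass P Y 0 f = 0 ↔ f.1 = 0 := by
  constructor
  · intro h
    have h := descCocycle_of_extClass_eq_zero P h
    have : IsIso ((homComplexOp P Y).homologyι 0) :=
      HomologicalComplex.isIso_homologyι _ 0 _ rfl (by
        apply HomologicalComplex.shape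
        simp)
    have h2 : descCocycle P f = 0 := by
      rwa [← cancel_epi ((homComplexOp P Y).homologyι 0), Limits.comp_zero]
    have h3 := p_descCocycle P f
    rw [h2, Limits.comp_zero] at h3
    rw [← evalHom_homElementOp P f.1, ← h3]
    rfl
  · intro h
    rw [show f = 0 from Subtype.ext h, map_zero]

theorem extClass_succ_eq_zero_iff {n : ℕ} {f : homCocycles P Y (n + 1)} :
    extClass P Y (n + 1) f = 0 ↔ ∃ g : P.complex.X n ⟶ Y, P.complex.d (n + 1) n ≫ g = f.1 := by
  constructor
  · intro h
    have h := descCocycle_of_extClass_eq_zero P h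
    have hex := ShortComplex.exact_of_f_is_kernel
      (ShortComplex.mk ((homComplexOp P Y).homologyι (n + 1))
        ((homComplexOp P Y).fromOpcycles (n + 1) n) (by simp))
      ((homComplexOp P Y).homologyIsKernel (n + 1) n (by simp))
    refine ⟨evalHom P (hex.descToInjective _ h), ?_⟩
    have h3 := p_descCocycle P f
    have h4 : (homComplexOp P Y).fromOpcycles (n + 1) n ≫ hex.descToInjective _ h =
      descCocycle P f := hex.comp_descToInjective _ h
    rw [← h4, HomologicalComplex.p_fromOpcycles_assoc,
      ← homElementOp_evalHom P (hex.descToInjective _ h), d_comp_homElementOp] at h3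
    rw [← evalHom_homElementOp P f.1, ← h3, evalHom_homElementOp]
  · rintro ⟨g, hg⟩
    have : descCocycle P f = (homComplexOp P Y).fromOpcycles (n + 1) n ≫
        homElementOp P g := by
      rw [← cancel_epi ((homComplexOp P Y).pOpcycles (n + 1)), p_descCocycle,
        HomologicalComplex.p_fromOpcycles_assoc, d_comp_homElementOp, hg]
    change evalOne ((extObjIso P Y (n + 1)).hom ≫ (homComplexOp P Y).homologyι (n + 1) ≫
      descCocycle P f) = 0
    rw [this, HomologicalComplex.homologyι_comp_fromOpcycles_assoc, Limits.zero_comp,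
      Limits.comp_zero]
    rfl

/-- The map on cocycles defined by a lift of a morphism. -/
def homCocyclesMap {n : ℕ} (φ : P'.complex ⟶ P.complex) :
    homCocycles P Y n →ₗ[R] homCocycles P' Y n :=
  (Linear.leftComp R Y (φ.f n)).restrict (p := homCocycles P Y n) fun f hf => by
    rw [mem_homCocycles] at hf ⊢
    change _ ≫ _ ≫ f = 0
    rw [← φ.comm_assoc, hf, Limits.comp_zero]

/-- The map on `Ext` induced by a morphism in the first variable. -/
noncomputable abbrev extObjMap (n : ℕ) (g : X' ⟶ X) (Y : ModuleCat.{u} R) :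
    extObj n X Y ⟶ extObj n X' Y :=
  ((Ext R (ModuleCat.{u} R) n).map g.op).app Y

theorem extObjIso_naturality {n : ℕ} (g : X' ⟶ X) (φ : P'.complex ⟶ P.complex)
    (hφ : φ.f 0 ≫ P.π.f 0 = P'.π.f 0 ≫ g) :
    (extObjMap n g Y).op ≫ (extObjIso P Y n).hom = (extObjIso P' Y n).hom ≫
      HomologicalComplex.homologyMap (((homToOp Y).mapHomologicalComplex _).map φ) n :=
  P'.isoLeftDerivedObj_hom_naturality g P φ hφ (homToOp Y) n

theorem extClass_naturality {n : ℕ} (g : X' ⟶ X) (φ : P'.complex ⟶ P.complex)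
    (hφ : φ.f 0 ≫ P.π.f 0 = P'.π.f 0 ≫ g) (f : homCocycles P Y n) :
    (extObjMap n g Y).hom (extClass P Y n f) =
      extClass P' Y n (homCocyclesMap P P' φ f) := by
  have h2 : HomologicalComplex.opcyclesMap (((homToOp Y).mapHomologicalComplex _).map φ) n ≫
        descCocycle P f = descCocycle P' (homCocyclesMap P P' φ f) := by
    rw [← cancel_epi ((homComplexOp P' Y).pOpcycles n), p_descCocycle,
      HomologicalComplex.p_opcyclesMap_assoc, p_descCocycle, map_comp_homElementOp]
    rfl
  change evalOne ((extObjMap n g Y).op ≫ (extObjIso P Y n).hom ≫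
    (homComplexOp P Y).homologyι n ≫ descCocycle P f) =
    evalOne ((extObjIso P' Y n).hom ≫ (homComplexOp P' Y).homologyι n ≫
      descCocycle P' (homCocyclesMap P P' φ f))
  rw [← Category.assoc, extObjIso_naturality P P' g φ hφ, ← h2, Category.assoc,
    HomologicalComplex.homologyι_naturality_assoc]

end

section

variable {R : Type u} [CommRing R] {X X' : ModuleCat.{u} R} (P : ProjectiveResolution X)
  (P' : ProjectiveResolution X') (Y : ModuleCat.{u} R)

/-- The class in the derived category `Ext` of a cocycle, as a linear map. -/
noncomputable def derivedExtClass (n : ℕ) : homCocycles P Y n →ₗ[R] Abelian.Ext X Y n where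
  toFun f := P.extMk f.1 (n + 1) rfl ((mem_homCocycles P).1 f.2)
  map_add' f g := (P.add_extMk _ _ _ _ _ _).symm
  map_smul' r f := by
    rw [RingHom.id_apply, Abelian.Ext.smul_eq_comp_mk₀, P.extMk_comp_mk₀]
    congr 1

theorem derivedExtClass_surjective (n : ℕ) : Function.Surjective (derivedExtClass P Y n) := by
  intro x
  obtain ⟨f, hf, rfl⟩ := P.extMk_surjective x (n + 1) rfl
  exact ⟨⟨f, hf⟩, rfl⟩

theorem ker_derivedExtClass_succ (n : ℕ) :
    LinearMap.ker (derivedExtClass P Y (n + 1)) = LinearMap.ker (extClass P Y (n + 1)) := by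
  ext f
  rw [LinearMap.mem_ker, LinearMap.mem_ker, extClass_succ_eq_zero_iff]
  exact P.extMk_eq_zero_iff f.1 (n + 2) rfl f.2 n rfl

/-- The two definitions of `Ext` agree in positive degrees. -/
noncomputable def derivedExtEquiv (n : ℕ) :
    Abelian.Ext X Y (n + 1) ≃ₗ[R] extObj (n + 1) X Y :=
  ((derivedExtClass P Y (n + 1)).quotKerEquivOfSurjective (derivedExtClass_surjective P Y _)).symm
    ≪≫ₗ Submodule.quotEquivOfEq _ _ (ker_derivedExtClass_succ P Y n)
    ≪≫ₗ (extClass P Y (n + 1)).quotKerEquivOfSurjective (extClass_surjective P _)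

theorem derivedExtEquiv_derivedExtClass (n : ℕ) (f : homCocycles P Y (n + 1)) :
    derivedExtEquiv P Y n (derivedExtClass P Y (n + 1) f) = extClass P Y (n + 1) f := by
  have : ((derivedExtClass P Y (n + 1)).quotKerEquivOfSurjective
      (derivedExtClass_surjective P Y _)).symm (derivedExtClass P Y (n + 1) f) =
      Submodule.Quotient.mk f := by
    rw [LinearEquiv.symm_apply_eq]
    rfl
  rw [derivedExtEquiv, LinearEquiv.trans_apply, LinearEquiv.trans_apply, this]
  rfl

theorem derivedExtEquiv_naturality (n : ℕ) (g : X' ⟶ X) (x : Abelian.Ext X Y (n + 1)) :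
    (extObjMap (n + 1) g Y).hom (derivedExtEquiv P Y n x) =
      derivedExtEquiv P' Y n ((Abelian.Ext.mk₀ g).comp x (zero_add _)) := by
  obtain ⟨f, rfl⟩ := derivedExtClass_surjective P Y _ x
  let φ : ProjectiveResolution.Hom P' P g :=
    ⟨ProjectiveResolution.lift g P' P, ProjectiveResolution.lift_commutes_zero g P' P⟩
  have h : (Abelian.Ext.mk₀ g).comp (derivedExtClass P Y (n + 1) f) (zero_add _) =
      derivedExtClass P' Y (n + 1) (homCocyclesMap P P' φ.hom f) :=
    ProjectiveResolution.mk₀_comp_extMk f.1 (n + 2) rfl f.2 φ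
  rw [h, derivedExtEquiv_derivedExtClass, derivedExtEquiv_derivedExtClass]
  exact extClass_naturality P P' g φ.hom (ProjectiveResolution.lift_commutes_zero g P' P) f

/-- The augmentation of a projective resolution. -/
noncomputable def augmentation : P.complex.X 0 ⟶ X := P.π.f 0

theorem d_comp_augmentation : P.complex.d 1 0 ≫ augmentation P = 0 :=
  P.complex_d_comp_π_f_zero

instance epi_augmentation : Epi (augmentation P) :=
  inferInstanceAs (Epi (P.π.f 0))

theorem lift_comp_augmentation (g : X' ⟶ X) :
    (ProjectiveResolution.lift g P' P).f 0 ≫ augmentation P = augmentation P' ≫ g :=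
  ProjectiveResolution.lift_commutes_zero g P' P

/-- The cocycle of degree zero defined by a homomorphism. -/
noncomputable def homToCocycles : (X ⟶ Y) →ₗ[R] homCocycles P Y 0 :=
  (Linear.leftComp R Y (augmentation P)).codRestrict (homCocycles P Y 0) fun f => by
    rw [mem_homCocycles, Linear.leftComp_apply, ← Category.assoc, d_comp_augmentation,
      Limits.zero_comp]

theorem coe_homToCocycles (f : X ⟶ Y) : (homToCocycles P Y f).1 = augmentation P ≫ f := rfl

theorem homToCocycles_surjective : Function.Surjective (homToCocycles P Y) := by
  intro f
  have h : (ShortComplex.mk (P.complex.d 1 0) (augmentation P) (d_comp_augmentation P)).Exact :=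
    P.exact₀
  have : Epi (ShortComplex.mk (P.complex.d 1 0) (augmentation P) (d_comp_augmentation P)).g :=
    epi_augmentation P
  exact ⟨h.desc f.1 f.2, Subtype.ext (h.g_desc _ _)⟩

/-- The map from homomorphisms to `Ext` in degree zero. -/
noncomputable def extZeroClass : (X ⟶ Y) →ₗ[R] extObj 0 X Y :=
  extClass P Y 0 ∘ₗ homToCocycles P Y

theorem extZeroClass_surjective : Function.Surjective (extZeroClass P Y) :=
  (extClass_surjective P 0).comp (homToCocycles_surjective P Y)

theorem extZeroClass_eq_zero_iff (f : X ⟶ Y) : extZeroClass P Y f = 0 ↔ f = 0 := by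
  refine (extClass_zero_eq_zero_iff P).trans ?_
  rw [coe_homToCocycles]
  refine ⟨fun h => ?_, ?_⟩
  · rw [← cancel_epi (augmentation P), Limits.comp_zero]
    exact h
  · rintro rfl
    exact Limits.comp_zero

theorem extZeroClass_naturality (g : X' ⟶ X) (f : X ⟶ Y) :
    (extObjMap 0 g Y).hom (extZeroClass P Y f) = extZeroClass P' Y (g ≫ f) := by
  refine (extClass_naturality P P' g (ProjectiveResolution.lift g P' P)
    (ProjectiveResolution.lift_commutes_zero g P' P) _).trans ?_
  refine congrArg (extClass P' Y 0) (Subtype.ext ?_)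
  change (ProjectiveResolution.lift g P' P).f 0 ≫ augmentation P ≫ f = augmentation P' ≫ g ≫ f
  rw [← Category.assoc, lift_comp_augmentation, Category.assoc]

end

section

variable {R : Type u} [CommRing R]

/-- An element annihilating the second variable annihilates `Ext`. -/
theorem smul_extObj_eq_zero (n : ℕ) (X Y : ModuleCat.{u} R) {r : R} (hr : ∀ y : Y, r • y = 0)
    (x : extObj n X Y) : r • x = 0 := by
  obtain ⟨f, rfl⟩ := extClass_surjective (projectiveResolution X) n x
  rw [← map_smul]
  have : r • f = 0 := by
    ext z
    exact hr _
  rw [this, map_zero]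

end

section

variable {R : Type u} [CommRing R]

/-- A linear map is essential when every nonzero element has a nonzero multiple in the range. -/
def LinearMap.IsEssential {M E : Type*} [AddCommGroup M] [Module R M] [AddCommGroup E]
    [Module R E] (f : M →ₗ[R] E) : Prop :=
  ∀ x : E, x ≠ 0 → ∃ r : R, r • x ≠ 0 ∧ r • x ∈ LinearMap.range f

/-- There is a maximal essential extension inside any given module. -/
theorem Submodule.exists_maximal_essential {J : Type*} [AddCommGroup J] [Module R J]
    (N : Submodule R J) :
    ∃ E : Submodule R J, Maximal
      (· ∈ {E : Submodule R J | ∀ x ∈ E, x ≠ 0 → ∃ r : R, r • x ≠ 0 ∧ r • x ∈ N}) E ∧ N ≤ E := by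
  obtain ⟨E, hNE, hE⟩ := zorn_le_nonempty₀
    {E : Submodule R J | ∀ x ∈ E, x ≠ 0 → ∃ r : R, r • x ≠ 0 ∧ r • x ∈ N}
    (fun c hc hchain y hy => ⟨sSup c, fun x hx => by
      obtain ⟨z, hz, hxz⟩ := (Submodule.mem_sSup_of_directed ⟨y, hy⟩ hchain.directedOn).1 hx
      exact hc hz x hxz, fun z hz => le_sSup hz⟩) N
    fun x hx hx0 => ⟨1, by simpa using hx0, by simpa using hx⟩
  exact ⟨E, hE, hNE⟩

/-- Every submodule has a maximal complement up to intersection. -/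
theorem Submodule.exists_maximal_disjoint {J : Type*} [AddCommGroup J] [Module R J]
    (E : Submodule R J) :
    ∃ U : Submodule R J, Maximal (· ∈ {U : Submodule R J | ∀ x ∈ U, x ∈ E → x = 0}) U := by
  obtain ⟨U, -, hU⟩ := zorn_le_nonempty₀ {U : Submodule R J | ∀ x ∈ U, x ∈ E → x = 0}
    (fun c hc hchain y hy => ⟨sSup c, fun x hx => by
      obtain ⟨z, hz, hxz⟩ := (Submodule.mem_sSup_of_directed ⟨y, hy⟩ hchain.directedOn).1 hx
      exact hc hz x hxz, fun z hz => le_sSup hz⟩) ⊥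
    fun x hx _ => (Submodule.mem_bot R).1 hx
  exact ⟨U, hU⟩

/-- A maximal essential extension inside an injective module is a retract. -/
theorem Submodule.exists_retraction_of_maximal_essential {J : Type u} [AddCommGroup J]
    [Module R J] [Module.Injective R J] {N E : Submodule R J}
    (hE : Maximal
      (· ∈ {E : Submodule R J | ∀ x ∈ E, x ≠ 0 → ∃ r : R, r • x ≠ 0 ∧ r • x ∈ N}) E) :
    ∃ π : J →ₗ[R] J, (∀ x, π x ∈ E) ∧ ∀ x ∈ E, π x = x := by
  obtain ⟨U, hU⟩ := E.exists_maximal_disjoint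
  have hess : ∀ x ∉ U, ∃ r : R, ∃ e ∈ E, e ≠ 0 ∧ U.mkQ (r • x) = U.mkQ e := by
    intro x hx
    by_contra! h
    refine hx (hU.2 (y := U ⊔ Submodule.span R {x}) ?_ le_sup_left
      (Submodule.mem_sup_right (Submodule.mem_span_singleton_self x)))
    intro e he heE
    by_contra he0
    obtain ⟨v, hv, w, hw, rfl⟩ := Submodule.mem_sup.1 he
    obtain ⟨r, rfl⟩ := Submodule.mem_span_singleton.1 hw
    refine h r _ heE he0 ?_
    rw [map_add, (Submodule.mkQ_apply U v), (Submodule.Quotient.mk_eq_zero U).2 hv, zero_add]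
  have hinj : Function.Injective (U.mkQ ∘ₗ E.subtype) := by
    rw [← LinearMap.ker_eq_bot, LinearMap.ker_eq_bot']
    intro e he
    exact Subtype.ext (hU.1 e.1 ((Submodule.Quotient.mk_eq_zero U).1 he) e.2)
  obtain ⟨g, hg⟩ := Module.Injective.out (U.mkQ ∘ₗ E.subtype) hinj E.subtype
  replace hg : ∀ e ∈ E, g (U.mkQ e) = e := fun e he => hg ⟨e, he⟩
  refine ⟨g ∘ₗ U.mkQ, fun x => ?_, hg⟩
  refine hE.2 (y := LinearMap.range (g ∘ₗ U.mkQ)) ?_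
    (fun e he => ⟨e, hg e he⟩) (LinearMap.mem_range_self _ x)
  rintro _ ⟨y, rfl⟩ hy
  have hyU : y ∉ U := fun h => hy (by
    rw [LinearMap.comp_apply, Submodule.mkQ_apply, (Submodule.Quotient.mk_eq_zero U).2 h, map_zero])
  obtain ⟨r, e, he, he0, hre⟩ := hess y hyU
  obtain ⟨s, hs0, hs⟩ := hE.1 e he he0
  have : (s * r) • (g ∘ₗ U.mkQ) y = s • e := by
    rw [mul_smul, ← map_smul, LinearMap.comp_apply, hre, hg e he]
  exact ⟨s * r, this ▸ hs0, this ▸ hs⟩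

variable (R) in
/-- Every module has an injective hull. -/
theorem Module.exists_injective_hull (M : Type u) [AddCommGroup M] [Module R M] :
    ∃ (E : Type u) (_ : AddCommGroup E) (_ : Module R E) (ι : M →ₗ[R] E),
      Module.Injective R E ∧ Function.Injective ι ∧ ι.IsEssential := by
  let J : ModuleCat.{u} R := CategoryTheory.Injective.under (ModuleCat.of R M)
  have : Module.Injective R J :=
    (Module.injective_iff_injective_object R J).2
      (CategoryTheory.Injective.injective_under (ModuleCat.of R M))
  let ι : M →ₗ[R] J := (CategoryTheory.Injective.ι (ModuleCat.of R M)).hom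
  have hι : Function.Injective ι := (ModuleCat.mono_iff_injective _).1 inferInstance
  obtain ⟨E, hE, hNE⟩ := (LinearMap.range ι).exists_maximal_essential
  obtain ⟨π, hπE, hπ⟩ := Submodule.exists_retraction_of_maximal_essential hE
  refine ⟨E, inferInstance, inferInstance, ι.codRestrict E fun x => hNE ⟨x, rfl⟩, ⟨?_⟩,
    fun x y h => hι (congrArg Subtype.val h), ?_⟩
  · intro X Y _ _ _ _ f hf g
    obtain ⟨h, hh⟩ := Module.Injective.out f hf (E.subtype ∘ₗ g)
    refine ⟨π.codRestrict E hπE ∘ₗ h, fun x => Subtype.ext ?_⟩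
    change π (h (f x)) = _
    rw [hh]
    exact hπ _ (g x).2
  · intro x hx
    obtain ⟨r, hr0, y, hy⟩ := hE.1 x.1 x.2 fun h => hx (Subtype.ext h)
    exact ⟨r, fun h => hr0 (congrArg Subtype.val h), y, Subtype.ext hy⟩

/-- An essential extension of a torsion module is torsion. -/
theorem LinearMap.IsEssential.exists_mem_killedBy [IsNoetherianRing R] {M E : Type*}
    [AddCommGroup M] [Module R M] [AddCommGroup E] [Module R E] {f : M →ₗ[R] E}
    (hf : f.IsEssential) {a : Ideal R} (hM : ∀ z : M, ∃ k, z ∈ killedBy M (a ^ k)) (x : E) :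
    ∃ k, x ∈ killedBy E (a ^ k) := by
  let S := Submodule.span R {x}
  let K : Submodule R S := (LinearMap.range f).comap S.subtype
  obtain ⟨c, hc⟩ := Ideal.exists_pow_inf_eq_pow_smul a K
  have htor : ∀ z ∈ K, ∃ k, z ∈ killedBy S (a ^ k) := by
    rintro z ⟨y, hy⟩
    obtain ⟨k, hk⟩ := hM y
    refine ⟨k, fun r hr => Subtype.ext ?_⟩
    change r • (z : E) = 0
    rw [← show f y = z from hy, ← map_smul, hk r hr, map_zero]
  obtain ⟨k, hk⟩ : ∃ k, K ≤ killedBy S (a ^ k) := by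
    obtain ⟨s, hs⟩ := (inferInstance : IsNoetherian R S).noetherian K
    have hsK : ∀ z ∈ s, z ∈ K := fun z hz => hs ▸ Submodule.subset_span hz
    choose! k hk using htor
    refine ⟨s.sup k, ?_⟩
    rw [← hs, Submodule.span_le]
    intro z hz
    exact killedBy_anti (Ideal.pow_le_pow_right (Finset.le_sup hz)) (hk z (hsK z hz))
  refine ⟨c + k, fun r hr => ?_⟩
  by_contra h0
  obtain ⟨s, hs0, hs⟩ := hf _ h0
  let w : S := ⟨x, Submodule.mem_span_singleton_self x⟩
  have hw : s • r • w ∈ a ^ (c + k) • (⊤ : Submodule R S) ⊓ K :=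
    ⟨Submodule.smul_mem _ s (Submodule.smul_mem_smul hr trivial), hs⟩
  rw [hc _ (Nat.le_add_right _ _), Nat.add_sub_cancel_left] at hw
  have hbot : a ^ k • (a ^ c • (⊤ : Submodule R S) ⊓ K) ≤ ⊥ := by
    rw [Submodule.smul_le]
    intro t ht z hz
    exact (Submodule.mem_bot R).2 (hk hz.2 t ht)
  exact hs0 (congrArg Subtype.val ((Submodule.mem_bot R).1 (hbot hw)))

/-- An essential extension has the same socle. -/
theorem LinearMap.IsEssential.mem_range [IsLocalRing R] {M E : Type*}
    [AddCommGroup M] [Module R M] [AddCommGroup E] [Module R E] {f : M →ₗ[R] E}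
    (hf : f.IsEssential) {x : E} (hx : x ∈ killedBy E (IsLocalRing.maximalIdeal R)) :
    x ∈ LinearMap.range f := by
  by_cases h0 : x = 0
  · rw [h0]
    exact zero_mem _
  obtain ⟨r, hr0, hr⟩ := hf x h0
  have : IsUnit r := by
    by_contra h
    exact hr0 (hx r h)
  obtain ⟨v, rfl⟩ := this
  have := (LinearMap.range f).smul_mem (↑v⁻¹ : R) hr
  rwa [← mul_smul, Units.inv_mul, one_smul] at this

end

section

variable {R : Type u} [CommRing R]

/-- The homomorphism from a cyclic module determined by an element killed by the ideal. -/
noncomputable def killedHom (N : ModuleCat.{u} R) (q : Ideal R) :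
    killedBy N q →ₗ[R] (ModuleCat.of R (R ⧸ q) ⟶ N) where
  toFun z := ModuleCat.ofHom (q.liftQ (LinearMap.toSpanSingleton R N z.1) fun c hc => z.2 c hc)
  map_add' z w := by
    ext
    change (1 : R) • (z.1 + w.1) = (1 : R) • z.1 + (1 : R) • w.1
    exact smul_add _ _ _
  map_smul' r z := by
    ext
    change (1 : R) • (r • z.1) = r • (1 : R) • z.1
    rw [one_smul, one_smul]

theorem killedHom_mk {N : ModuleCat.{u} R} {q : Ideal R} (z : killedBy N q) (r : R) :
    (killedHom N q z).hom (Submodule.Quotient.mk r) = r • z.1 := rfl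

theorem cyclic_hom_ext {N : ModuleCat.{u} R} {q : Ideal R} {g h : ModuleCat.of R (R ⧸ q) ⟶ N}
    (w : g.hom (Submodule.Quotient.mk (1 : R)) = h.hom (Submodule.Quotient.mk (1 : R))) :
    g = h := by
  apply ModuleCat.hom_ext
  apply Submodule.linearMap_qext
  apply LinearMap.ext_ring
  exact w

theorem killedHom_bijective (N : ModuleCat.{u} R) (q : Ideal R) :
    Function.Bijective (killedHom N q) := by
  constructor
  · intro z w h
    have := congrArg (fun g => g.hom (Submodule.Quotient.mk (1 : R))) h
    change (1 : R) • z.1 = (1 : R) • w.1 at this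
    rw [one_smul, one_smul] at this
    exact Subtype.ext this
  · intro g
    refine ⟨⟨g.hom (Submodule.Quotient.mk (1 : R)), fun c hc => ?_⟩, cyclic_hom_ext ?_⟩
    · rw [← map_smul, ← Submodule.Quotient.mk_smul, smul_eq_mul, mul_one,
        (Submodule.Quotient.mk_eq_zero q).2 hc, map_zero]
    · rw [killedHom_mk, one_smul]

theorem killedHom_comp {D N : ModuleCat.{u} R} (f : D ⟶ N) {q : Ideal R} (z : killedBy D q)
    (w : killedBy N q) (h : f.hom z.1 = w.1) : killedHom D q z ≫ f = killedHom N q w :=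
  cyclic_hom_ext (by
    change f.hom ((1 : R) • z.1) = (1 : R) • w.1
    rw [one_smul, one_smul, h])

theorem exists_killedHom_comp_iff {D N : ModuleCat.{u} R} (f : D ⟶ N) {q : Ideal R}
    (z : killedBy N q) :
    (∃ k, k ≫ f = killedHom N q z) ↔ z.1 ∈ (killedBy D q).map f.hom := by
  constructor
  · rintro ⟨k, hk⟩
    obtain ⟨w, rfl⟩ := (killedHom_bijective D q).2 k
    refine ⟨w.1, w.2, ?_⟩
    have := congrArg (fun g => g.hom (Submodule.Quotient.mk (1 : R))) hk
    change f.hom ((1 : R) • w.1) = (1 : R) • z.1 at this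
    rwa [one_smul, one_smul] at this
  · rintro ⟨w, hw, h⟩
    exact ⟨_, killedHom_comp f ⟨w, hw⟩ z h⟩

/-- The projection between cyclic modules. -/
noncomputable abbrev cyclicMap {q' q : Ideal R} (h : q' ≤ q) :
    ModuleCat.of R (R ⧸ q') ⟶ ModuleCat.of R (R ⧸ q) :=
  ModuleCat.ofHom (Submodule.factor h)

theorem cyclicMap_comp_killedHom {N : ModuleCat.{u} R} {q' q : Ideal R} (h : q' ≤ q)
    (z : killedBy N q) :
    cyclicMap h ≫ killedHom N q z = killedHom N q' ⟨z.1, killedBy_anti h z.2⟩ :=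
  cyclic_hom_ext rfl

theorem smul_derivedExt_eq_zero (n : ℕ) (X Y : ModuleCat.{u} R) {r : R} (hr : ∀ x : X, r • x = 0)
    (x : Abelian.Ext X Y n) : r • x = 0 := by
  have h : r • 𝟙 X = 0 := by
    ext z
    exact hr z
  have := Abelian.Ext.smul_comp (R := R) (Abelian.Ext.mk₀ (𝟙 X)) x (zero_add n) r
  rw [Abelian.Ext.mk₀_id_comp] at this
  rw [← this, ← Abelian.Ext.mk₀_smul, h, Abelian.Ext.mk₀_zero, Abelian.Ext.zero_comp]

variable (a : Ideal R) [IsLocalRing R]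

/-- Torsion modules all of whose `Ext` modules from the residue field are Artinian. -/
structure IsCofiniteTorsion (M : ModuleCat.{u} R) : Prop where
  torsion : ∀ z : M, ∃ k, z ∈ killedBy M (a ^ k)
  isArtinian : ∀ j, IsArtinian R
    (Abelian.Ext (ModuleCat.of R (R ⧸ IsLocalRing.maximalIdeal R)) M j)

variable {a}

theorem IsCofiniteTorsion.isArtinian_killedBy {M : ModuleCat.{u} R} (h : IsCofiniteTorsion a M) :
    IsArtinian R (killedBy M (IsLocalRing.maximalIdeal R)) := by
  have := h.isArtinian 0
  let e := (LinearEquiv.ofBijective _ (killedHom_bijective M (IsLocalRing.maximalIdeal R))).trans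
    (Abelian.Ext.linearEquiv₀ (R := R)).symm
  exact isArtinian_of_injective e.toLinearMap e.injective

theorem isCofiniteTorsion_of_finite [IsNoetherianRing R] {M : ModuleCat.{u} R}
    [Module.Finite R M] (h : ∀ c ∈ a, ∀ z : M, c • z = 0) : IsCofiniteTorsion a M where
  torsion z := ⟨1, fun c hc => h c (by rwa [pow_one] at hc) z⟩
  isArtinian j := by
    have : Module.Finite R (Abelian.Ext (ModuleCat.of R (R ⧸ IsLocalRing.maximalIdeal R)) M j) :=
      inferInstance
    refine (isFiniteLength_iff_isNoetherian_isArtinian.1 (isFiniteLength_of_pow_smul_eq_zero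
      (m := IsLocalRing.maximalIdeal R) 1 _ (fun c hc z => ?_) (Or.inl inferInstance))).2
    rw [pow_one] at hc
    refine smul_derivedExt_eq_zero j _ _ (fun x => ?_) z
    obtain ⟨x, rfl⟩ := Submodule.Quotient.mk_surjective _ x
    rw [← Submodule.Quotient.mk_smul, Submodule.Quotient.mk_eq_zero]
    exact Ideal.mul_mem_right _ _ hc

/-- Embedding into an injective module, preserving cofiniteness. -/
theorem IsCofiniteTorsion.exists_shortExact [IsNoetherianRing R] {M : ModuleCat.{u} R}
    (h : IsCofiniteTorsion a M) :
    ∃ (J N : ModuleCat.{u} R) (f : M ⟶ J) (g : J ⟶ N) (w : f ≫ g = 0),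
      (ShortComplex.mk f g w).ShortExact ∧ CategoryTheory.Injective J ∧
      IsCofiniteTorsion a J ∧ IsCofiniteTorsion a N := by
  obtain ⟨E, _, _, ι, hE, hι, hess⟩ := Module.exists_injective_hull R M
  have htE : ∀ z : E, ∃ k, z ∈ killedBy E (a ^ k) := hess.exists_mem_killedBy h.torsion
  let J := ModuleCat.of R E
  let N := ModuleCat.of R (E ⧸ LinearMap.range ι)
  let f : M ⟶ J := ModuleCat.ofHom ι
  let g : J ⟶ N := ModuleCat.ofHom (LinearMap.range ι).mkQ
  have w : f ≫ g = 0 := by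
    ext z
    exact (Submodule.Quotient.mk_eq_zero _).2 (LinearMap.mem_range_self ι z)
  have hS : (ShortComplex.mk f g w).ShortExact :=
    { exact := (ShortComplex.ShortExact.moduleCat_exact_iff_function_exact _).mpr
        (LinearMap.exact_map_mkQ_range ι)
      mono_f := (ModuleCat.mono_iff_injective _).mpr hι
      epi_g := (ModuleCat.epi_iff_surjective _).mpr (Submodule.mkQ_surjective _) }
  have hJ : CategoryTheory.Injective J := (Module.injective_iff_injective_object R E).1 hE
  have hJc : IsCofiniteTorsion a J := by
    refine ⟨htE, fun j => ?_⟩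
    cases j with
    | zero =>
      have := h.isArtinian 0
      refine isArtinian_of_surjective _ (Abelian.Ext.postcompOfLinear (Abelian.Ext.mk₀ f) R
        (ModuleCat.of R (R ⧸ IsLocalRing.maximalIdeal R)) (add_zero 0)) fun x => ?_
      obtain ⟨x, rfl⟩ := (Abelian.Ext.mk₀_bijective _ _).2 x
      obtain ⟨v, rfl⟩ := (killedHom_bijective J _).2 x
      obtain ⟨y, hy⟩ := hess.mem_range v.2
      have hy' : y ∈ killedBy M (IsLocalRing.maximalIdeal R) := fun c hc => hι (by
        rw [map_smul, hy, map_zero]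
        exact v.2 c hc)
      refine ⟨Abelian.Ext.mk₀ (killedHom M _ ⟨y, hy'⟩), ?_⟩
      rw [← killedHom_comp f ⟨y, hy'⟩ v hy]
      exact Abelian.Ext.mk₀_comp_mk₀ _ _
    | succ j =>
      have : Subsingleton
          (Abelian.Ext (ModuleCat.of R (R ⧸ IsLocalRing.maximalIdeal R)) J (j + 1)) :=
        subsingleton_of_forall_eq 0 Abelian.Ext.eq_zero_of_injective
      infer_instance
  refine ⟨J, N, f, g, w, hS, hJ, hJc, fun z => ?_, fun j => ?_⟩
  · obtain ⟨z, rfl⟩ := Submodule.Quotient.mk_surjective _ z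
    obtain ⟨k, hk⟩ := htE z
    refine ⟨k, fun c hc => ?_⟩
    rw [← Submodule.Quotient.mk_smul, hk c hc, Submodule.Quotient.mk_zero]
  · have := h.isArtinian (j + 1)
    have := hJc.isArtinian j
    let X := ModuleCat.of R (R ⧸ IsLocalRing.maximalIdeal R)
    refine isArtinian_of_range_eq_ker
      (Abelian.Ext.postcompOfLinear (Abelian.Ext.mk₀ g) R X (add_zero j))
      (Abelian.Ext.postcompOfLinear hS.extClass R X (rfl : j + 1 = j + 1)) ?_
    apply le_antisymm
    · rintro _ ⟨x, rfl⟩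
      rw [LinearMap.mem_ker]
      change (x.comp (Abelian.Ext.mk₀ g) (add_zero j)).comp hS.extClass rfl = 0
      rw [Abelian.Ext.comp_assoc_of_second_deg_zero]
      exact (congrArg (fun y => x.comp y rfl) hS.comp_extClass).trans
        (Abelian.Ext.comp_zero _ _ _ _ _)
    · intro x hx
      exact Abelian.Ext.covariant_sequence_exact₃ X hS x rfl hx

/-- `Ext` into a cofinite module is computed by a map of cofinite modules. -/
theorem IsCofiniteTorsion.exists_connecting [IsNoetherianRing R] (i : ℕ) :
    ∀ {M : ModuleCat.{u} R}, IsCofiniteTorsion a M →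
    ∃ (D N : ModuleCat.{u} R) (f : D ⟶ N)
      (δ : ∀ X : ModuleCat.{u} R, (X ⟶ N) →ₗ[R] Abelian.Ext X M (i + 1)),
      IsCofiniteTorsion a D ∧ IsCofiniteTorsion a N ∧
      (∀ X, Function.Surjective (δ X)) ∧
      (∀ X h, δ X h = 0 ↔ ∃ k, k ≫ f = h) ∧
      ∀ X X' (g : X' ⟶ X) h,
        δ X' (g ≫ h) = (Abelian.Ext.mk₀ g).comp (δ X h) (zero_add _) := by
  induction i with
  | zero =>
    intro M hM
    obtain ⟨J, N, f, g, w, hS, hJ, hJc, hNc⟩ := hM.exists_shortExact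
    refine ⟨J, N, g, fun X => Abelian.Ext.postcompOfLinear hS.extClass R X (zero_add 1) ∘ₗ
      (Abelian.Ext.linearEquiv₀ (R := R)).symm.toLinearMap, hJc, hNc, fun X x => ?_,
      fun X h => ?_, fun X X' g h => ?_⟩
    · obtain ⟨y, rfl⟩ := Abelian.Ext.covariant_sequence_exact₁ X hS x
        (Abelian.Ext.eq_zero_of_injective (I := J) _) (zero_add 1)
      obtain ⟨y, rfl⟩ := (Abelian.Ext.mk₀_bijective _ _).2 y
      exact ⟨y, rfl⟩
    · change (Abelian.Ext.mk₀ h).comp hS.extClass (zero_add 1) = 0 ↔ _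
      constructor
      · intro hh
        obtain ⟨y, hy⟩ := Abelian.Ext.covariant_sequence_exact₃ X hS _ _ hh
        obtain ⟨y, rfl⟩ := (Abelian.Ext.mk₀_bijective _ _).2 y
        rw [Abelian.Ext.mk₀_comp_mk₀] at hy
        exact ⟨y, (Abelian.Ext.mk₀_bijective _ _).1 hy⟩
      · rintro ⟨k, rfl⟩
        rw [← Abelian.Ext.mk₀_comp_mk₀, Abelian.Ext.comp_assoc_of_second_deg_zero]
        exact (congrArg (fun y => (Abelian.Ext.mk₀ k).comp y (zero_add 1))
          hS.comp_extClass).trans (Abelian.Ext.comp_zero _ _ _ _ _)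
    · change (Abelian.Ext.mk₀ (g ≫ h)).comp hS.extClass (zero_add 1) = 
        (Abelian.Ext.mk₀ g).comp ((Abelian.Ext.mk₀ h).comp hS.extClass (zero_add 1)) _
      rw [Abelian.Ext.mk₀_comp_mk₀_assoc]
  | succ i ih =>
    intro M hM
    obtain ⟨J, M₁, f, g, w, hS, hJ, hJc, hMc⟩ := hM.exists_shortExact
    obtain ⟨D, N, d, δ, hD, hN, hsurj, hker, hnat⟩ := ih hMc
    refine ⟨D, N, d, fun X => Abelian.Ext.postcompOfLinear hS.extClass R X rfl ∘ₗ δ X, hD, hN,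
      fun X x => ?_, fun X h => ?_, fun X X' g h => ?_⟩
    · obtain ⟨y, rfl⟩ := Abelian.Ext.covariant_sequence_exact₁ X hS x
        (Abelian.Ext.eq_zero_of_injective (I := J) _) rfl
      obtain ⟨y, rfl⟩ := hsurj X y
      exact ⟨y, rfl⟩
    · rw [← hker]
      change (δ X h).comp hS.extClass rfl = 0 ↔ _
      constructor
      · intro hh
        obtain ⟨y, hy⟩ := Abelian.Ext.covariant_sequence_exact₃ X hS _ _ hh
        rw [← hy, Abelian.Ext.eq_zero_of_injective (I := J) y, Abelian.Ext.zero_comp]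
      · intro hh
        rw [hh, Abelian.Ext.zero_comp]
    · change (δ X' (g ≫ h)).comp hS.extClass rfl =
        (Abelian.Ext.mk₀ g).comp ((δ X h).comp hS.extClass rfl) _
      rw [hnat, Abelian.Ext.comp_assoc _ _ _ _ _ (by lia)]

end

/-- The modules `Ext(R ⧸ q, M)`, for all ideals `q`, are computed by a single map of torsion
modules with Artinian socles. -/
theorem exists_extObj_presentation {R : Type u} [CommRing R] [IsNoetherianRing R] [IsLocalRing R]
    {a : Ideal R} (M : ModuleCat.{u} R) [Module.Finite R M] (ha : ∀ c ∈ a, ∀ z : M, c • z = 0)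
    (i : ℕ) :
    ∃ (D N : ModuleCat.{u} R) (f : D ⟶ N)
      (τ : ∀ q : Ideal R, killedBy N q →ₗ[R] extObj i (ModuleCat.of R (R ⧸ q)) M),
      (∀ z : D, ∃ k, z ∈ killedBy D (a ^ k)) ∧ (∀ z : N, ∃ k, z ∈ killedBy N (a ^ k)) ∧
      IsArtinian R (killedBy D (IsLocalRing.maximalIdeal R)) ∧
      IsArtinian R (killedBy N (IsLocalRing.maximalIdeal R)) ∧
      (∀ q, Function.Surjective (τ q)) ∧
      (∀ q z, τ q z = 0 ↔ z.1 ∈ (killedBy D q).map f.hom) ∧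
      ∀ q q' (h : q' ≤ q) z,
        (extObjMap i (cyclicMap h) M).hom (τ q z) = τ q' ⟨z.1, killedBy_anti h z.2⟩ := by
  have hM : IsCofiniteTorsion a M := isCofiniteTorsion_of_finite ha
  cases i with
  | zero =>
    refine ⟨ModuleCat.of R PUnit, M, 0, fun q => extZeroClass
      (projectiveResolution (ModuleCat.of R (R ⧸ q))) M ∘ₗ killedHom M q,
      fun z => ⟨0, fun c _ => rfl⟩, hM.torsion, inferInstance,
      hM.isArtinian_killedBy, fun q => (extZeroClass_surjective _ _).comp
        (killedHom_bijective M q).2, fun q z => ?_, fun q q' h z => ?_⟩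
    · rw [LinearMap.comp_apply, extZeroClass_eq_zero_iff, ← exists_killedHom_comp_iff]
      constructor
      · intro h
        exact ⟨0, by rw [h, Limits.zero_comp]⟩
      · rintro ⟨k, hk⟩
        rw [← hk, Limits.comp_zero]
    · rw [LinearMap.comp_apply, LinearMap.comp_apply, ← cyclicMap_comp_killedHom h]
      exact extZeroClass_naturality _ _ _ _ _
  | succ i =>
    obtain ⟨D, N, f, δ, hD, hN, hsurj, hker, hnat⟩ := hM.exists_connecting i
    refine ⟨D, N, f, fun q => (derivedExtEquiv
      (projectiveResolution (ModuleCat.of R (R ⧸ q))) M i).toLinearMap ∘ₗ δ _ ∘ₗ killedHom N q,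
      hD.torsion, hN.torsion, hD.isArtinian_killedBy, hN.isArtinian_killedBy,
      fun q => (derivedExtEquiv
        (projectiveResolution (ModuleCat.of R (R ⧸ q))) M i).surjective.comp
          ((hsurj _).comp (killedHom_bijective N q).2),
      fun q z => ?_, fun q q' h z => ?_⟩
    · rw [← exists_killedHom_comp_iff, ← hker]
      exact (derivedExtEquiv
        (projectiveResolution (ModuleCat.of R (R ⧸ q))) M i).map_eq_zero_iff
    · rw [LinearMap.comp_apply, LinearMap.comp_apply, LinearMap.comp_apply, LinearMap.comp_apply,
        ← cyclicMap_comp_killedHom h, hnat]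
      exact derivedExtEquiv_naturality _ _ _ _ _ _

theorem exists_map_smul_eq_zero_of_isColimit {R : Type u} [CommRing R] {C : Type}
    [SmallCategory C] [IsFiltered C] (G : C ⥤ ModuleCat.{u} R) {c : Limits.Cocone G}
    (hc : Limits.IsColimit c) {s : R} (hs : ∀ y : c.pt, s • y = 0) {j : C} (x : G.obj j) :
    ∃ (j' : C) (f : j ⟶ j'), (G.map f).hom (s • x) = 0 := by
  have : Limits.PreservesFilteredColimitsOfSize.{0, 0} (forget (ModuleCat.{u} R)) :=
    Limits.preservesFilteredColimitsOfSize_shrink.{0, u, 0, u} _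
  have h0 : (c.ι.app j).hom (s • x) = (c.ι.app j).hom 0 := by
    rw [map_smul, hs, map_zero]
  obtain ⟨j', f, g, h⟩ := Limits.Concrete.isColimit_exists_of_rep_eq G hc _ _ h0
  exact ⟨j', f, h.trans (map_zero _)⟩

/-- An element annihilating a local cohomology module annihilates each element of the directed
system of `Ext` modules after passing to a later stage. -/
theorem exists_extObjMap_smul_eq_zero {R : Type u} [CommRing R] {J : Ideal R} {i : ℕ}
    {M : ModuleCat.{u} R} {s : R}
    (hs : s ∈ Module.annihilator R ↥((localCohomology J i).obj M)) {k : ℕ}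
    (x : extObj i (ModuleCat.of R (R ⧸ J ^ k)) M) :
    ∃ (k' : ℕ) (h : k ≤ k'),
      (extObjMap i (cyclicMap (Ideal.pow_le_pow_right (I := J) h)) M).hom (s • x) = 0 := by
  let F := localCohomology.diagram (localCohomology.idealPowersDiagram J) i
  let E := (evaluation (ModuleCat.{u} R) (ModuleCat.{u} R)).obj M
  have hc : Limits.IsColimit (E.mapCocone (Limits.colimit.cocone F)) :=
    Limits.isColimitOfPreserves E (Limits.colimit.isColimit F)
  obtain ⟨j, f, hf⟩ := exists_map_smul_eq_zero_of_isColimit (F ⋙ E) hc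
    (fun y => Module.mem_annihilator.1 hs y) (j := Opposite.op (Opposite.op k)) x
  exact ⟨j.unop.unop, f.unop.unop.down.down, hf⟩

section

variable {R : Type*} [CommRing R] (A : Type*) [AddCommGroup A] [Module R A]

/-- The submodule of elements killed by a power of an ideal. -/
def powTorsion (J : Ideal R) : Submodule R A where
  carrier := {z | ∃ k, z ∈ killedBy A (J ^ k)}
  add_mem' := by
    rintro z w ⟨k, hk⟩ ⟨l, hl⟩
    exact ⟨k + l, add_mem (killedBy_anti (Ideal.pow_le_pow_right (Nat.le_add_right k l)) hk)
      (killedBy_anti (Ideal.pow_le_pow_right (Nat.le_add_left l k)) hl)⟩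
  zero_mem' := ⟨0, zero_mem _⟩
  smul_mem' := fun r _ ⟨k, hk⟩ => ⟨k, Submodule.smul_mem _ r hk⟩

theorem isArtinian_powTorsion {J : Ideal R} (hJ : J.FG) [IsArtinian R (killedBy A J)] :
    IsArtinian R (powTorsion A J) := by
  let g : killedBy (powTorsion A J) J →ₗ[R] killedBy A J :=
    ((powTorsion A J).subtype ∘ₗ Submodule.subtype _).codRestrict _
      fun z c hc => congrArg Subtype.val (z.2 c hc)
  have hg : Function.Injective g := fun z w h =>
    Subtype.ext (Subtype.ext (congrArg (fun v : killedBy A J => v.1) h))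
  have := isArtinian_of_injective g hg
  refine isArtinian_of_killedBy hJ fun z => ?_
  obtain ⟨k, hk⟩ := z.2
  exact ⟨k, fun c hc => Subtype.ext (hk c hc)⟩

variable {A}

/-- The restriction of a linear map to the elements killed by a power of an ideal. -/
def powTorsionMap {B : Type*} [AddCommGroup B] [Module R B] (f : A →ₗ[R] B) (J : Ideal R) :
    powTorsion A J →ₗ[R] powTorsion B J :=
  f.restrict fun z ⟨k, hk⟩ => ⟨k, fun c hc => by rw [← map_smul, hk c hc, map_zero]⟩

theorem mem_powTorsion_of_pow_le_sup {I J a : Ideal R} {e k n : ℕ} (he : J ^ e ≤ I ⊔ a) {z : A}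
    (hI : z ∈ killedBy A (I ^ n)) (ha : z ∈ killedBy A (a ^ k)) : z ∈ powTorsion A J := by
  refine ⟨e * (n + k), fun c hc => ?_⟩
  rw [pow_mul] at hc
  obtain ⟨x, hx, y, hy, rfl⟩ := Submodule.mem_sup.1
    (Ideal.sup_pow_add_le_pow_sup_pow (Ideal.pow_right_mono he (n + k) hc))
  rw [add_smul, hI x hx, ha y hy, add_zero]

end

/-- The modules `Ext(R ⧸ I ^ n, M)` are computed by a single map of Artinian modules. -/
theorem exists_extObj_equiv_killedCoker {R : Type u} [CommRing R] [IsNoetherianRing R]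
    [IsLocalRing R] (M : ModuleCat.{u} R) [Module.Finite R M] {I a : Ideal R} {e : ℕ}
    (he : IsLocalRing.maximalIdeal R ^ e ≤ I ⊔ a) (ha : ∀ c ∈ a, ∀ z : M, c • z = 0) (i : ℕ) :
    ∃ (D C : ModuleCat.{u} R) (f : D →ₗ[R] C), IsArtinian R D ∧ IsArtinian R C ∧
      (∀ n, Nonempty (killedCoker f (I ^ n) ≃ₗ[R] extObj i (ModuleCat.of R (R ⧸ I ^ n)) M)) ∧
      (∀ n, ∀ z ∈ killedBy C (I ^ n), ∀ s ∈ a, s • z ∈ (killedBy D (I ^ n)).map f) ∧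
      ∀ s ∈ Module.annihilator R
          ↥((localCohomology (IsLocalRing.maximalIdeal R) i).obj M) ⊔ a,
        ∀ z : C, s • z ∈ LinearMap.range f := by
  obtain ⟨D, N, f, τ, hD, hN, hDa, hNa, hsurj, hker, hnat⟩ := exists_extObj_presentation M ha i
  set m := IsLocalRing.maximalIdeal R with hm
  have hmfg : m.FG := IsNoetherian.noetherian m
  have hsmul : ∀ q, ∀ z ∈ killedBy N q, ∀ s ∈ a, s • z ∈ (killedBy D q).map f.hom := by
    intro q z hz s hs
    refine (hker q (s • ⟨z, hz⟩)).1 ?_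
    rw [map_smul]
    exact smul_extObj_eq_zero _ _ _ (ha s hs) _
  have hlift : ∀ n (z : powTorsion N m), z.1 ∈ (killedBy D (I ^ n)).map f.hom →
      z ∈ (killedBy (powTorsion D m) (I ^ n)).map (powTorsionMap f.hom m) := by
    rintro n z ⟨w, hw, hwz⟩
    obtain ⟨k, hk⟩ := hD w
    exact ⟨⟨w, mem_powTorsion_of_pow_le_sup he hw hk⟩, fun c hc => Subtype.ext (hw c hc),
      Subtype.ext hwz⟩
  have hrange : ∀ k (z : powTorsion N m), z.1 ∈ (killedBy D (m ^ k)).map f.hom →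
      z ∈ LinearMap.range (powTorsionMap f.hom m) := by
    rintro k z ⟨w, hw, hwz⟩
    exact ⟨⟨w, k, hw⟩, Subtype.ext hwz⟩
  refine ⟨ModuleCat.of R (powTorsion D m), ModuleCat.of R (powTorsion N m),
    powTorsionMap f.hom m, isArtinian_powTorsion D hmfg, isArtinian_powTorsion N hmfg,
    fun n => ?_, fun n z hz s hs => ?_, fun s hs z => ?_⟩
  · let g : killedBy (powTorsion N m) (I ^ n) →ₗ[R] killedBy N (I ^ n) :=
      ((powTorsion N m).subtype ∘ₗ Submodule.subtype _).codRestrict _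
        fun z c hc => congrArg Subtype.val (z.2 c hc)
    have hg : Function.Surjective (τ (I ^ n) ∘ₗ g) := by
      refine (hsurj _).comp fun z => ?_
      obtain ⟨k, hk⟩ := hN z.1
      exact ⟨⟨⟨z.1, mem_powTorsion_of_pow_le_sup he z.2 hk⟩,
        fun c hc => Subtype.ext (z.2 c hc)⟩, rfl⟩
    refine ⟨(Submodule.quotEquivOfEq _ _ ?_).trans (LinearMap.quotKerEquivOfSurjective _ hg)⟩
    ext z
    rw [LinearMap.mem_ker, LinearMap.comp_apply, hker]
    refine ⟨?_, hlift n z.1⟩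
    rintro ⟨w, hw, hwz⟩
    exact ⟨w.1, fun c hc => congrArg Subtype.val (hw c hc), congrArg Subtype.val hwz⟩
  · exact hlift n _ (hsmul _ z.1 (fun c hc => congrArg Subtype.val (hz c hc)) s hs)
  · obtain ⟨k, hk⟩ := z.2
    obtain ⟨r, hr, t, ht, rfl⟩ := Submodule.mem_sup.1 hs
    rw [add_smul]
    refine add_mem ?_ (hrange k _ (hsmul _ z.1 hk t ht))
    obtain ⟨k', h, h'⟩ := exists_extObjMap_smul_eq_zero hr (τ (m ^ k) ⟨z.1, hk⟩)
    rw [← map_smul, hnat] at h'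
    exact hrange k' _ ((hker _ _).1 h')

/-- Corollary 7, second part. Let `(R, m)` be a commutative Noetherian
local ring, `M` a finitely generated `R`-module, and `I` an ideal with `I + ann_R M`
`m`-primary.  Fix `i` with `0 ≤ i ≤ dim M`.  Then `Ext_R^i(R/Iⁿ, M)` has finite length for
all `n ≥ 1`, and any polynomial `p ∈ ℚ[X]` with `λ(Ext_R^i(R/Iⁿ, M)) = p(n)` for all `n ≫ 0`
satisfies `deg p ≤ max {dim R/ann_R H_m^i(M), ℓ(I) - 1}` (the inequality
`deg p ≤ ℓ(I) - 1` being encoded as `deg p + 1 ≤ ℓ(I)`). -/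
theorem stmt_15 {R : Type u} [CommRing R] [IsNoetherianRing R] [IsLocalRing R]
    (M : Type u) [AddCommGroup M] [Module R M] [Module.Finite R M]
    (I : Ideal R)
    (hprimary : (I + Module.annihilator R M).radical = IsLocalRing.maximalIdeal R)
    (i : ℕ) (hi : (i : WithBot ℕ∞) ≤ ringKrullDim (R ⧸ Module.annihilator R M)) :
    (∀ n : ℕ, 1 ≤ n →
      IsFiniteLength R (extModule R i (R ⧸ (I ^ n : Ideal R)) M)) ∧
    ∀ p : Polynomial ℚ,
      (∃ N₀ : ℕ, ∀ n ≥ N₀, ∃ ℓ : ℕ,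
        moduleLength R (extModule R i (R ⧸ (I ^ n : Ideal R)) M) = ℓ ∧
        (ℓ : ℚ) = p.eval (n : ℚ)) →
      (polyDeg p ≤ ringKrullDim (R ⧸ Module.annihilator R
          ↥((localCohomology (IsLocalRing.maximalIdeal R) i).obj (ModuleCat.of R M))) ∨
        polyDeg p + 1 ≤ analyticSpread I (IsLocalRing.maximalIdeal R)) := by
  set m := IsLocalRing.maximalIdeal R with hm
  set a := Module.annihilator R M with ha
  obtain ⟨e, he⟩ : ∃ e, m ^ e ≤ I ⊔ a :=
    Ideal.exists_pow_le_of_le_radical_of_fg hprimary.ge (IsNoetherian.noetherian m)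
  obtain ⟨D, C, f, hD, hC, hequiv, hann, hrange⟩ := exists_extObj_equiv_killedCoker
    (ModuleCat.of R M) he (fun c hc z => Module.mem_annihilator.1 hc z) i
  refine ⟨fun n _ => ?_, ?_⟩
  · exact (hequiv n).some.isFiniteLength (isFiniteLength_killedCoker f I a e he n (hann n))
  rintro p ⟨N₀, hp⟩
  obtain ⟨n₀, K₁, K₂, d, hd, hlen⟩ :=
    exists_length_killedCoker_le f I a _ le_sup_right e he hann hrange
  obtain ⟨h, c, hh, hsum⟩ := exists_sum_length_le I
  have hp' : ∀ t ≥ N₀, ∃ l : ℕ, (l : ℚ) = p.eval ((n₀ + t : ℕ) : ℚ) ∧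
      (l : ℕ∞) ≤ (K₁ * (n₀ + t) ^ d : ℕ) + K₂ *
        Module.length R (↥(I ^ t) ⧸ (m • ⊤ : Submodule R ↥(I ^ t))) := by
    intro t ht
    obtain ⟨l, hl, hlp⟩ := hp (n₀ + t) (by omega)
    refine ⟨l, hlp, le_trans (le_of_eq ?_) (hlen t)⟩
    rw [(hequiv (n₀ + t)).some.length_eq, ← WithBot.coe_inj, Module.coe_length]
    exact hl.symm
  have hdeg : p ≠ 0 → polyDeg p = ((p.natDegree : ℕ) : WithBot ℕ∞) := fun h0 => by
    rw [polyDeg, Polynomial.degree_eq_natDegree h0]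
    rfl
  rcases Polynomial.natDegree_le_of_eval_le hsum hp' with h0 | ⟨h1, h2⟩ | h3
  · left
    rw [h0, polyDeg, Polynomial.degree_zero]
    exact bot_le
  · by_cases h0 : p = 0
    · left
      rw [h0, polyDeg, Polynomial.degree_zero]
      exact bot_le
    left
    rw [hdeg h0]
    refine (Nat.cast_le.2 h1).trans ((hd.resolve_left h2).le.trans ?_)
    exact ringKrullDim_le_of_surjective (Ideal.Quotient.factor le_sup_left)
      (Ideal.Quotient.factor_surjective le_sup_left)
  · right
    by_cases h0 : p = 0
    · rw [h0, polyDeg, Polynomial.degree_zero]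
      exact bot_le
    rw [hdeg h0]
    refine le_trans ?_ hh
    exact_mod_cast h3
end

section
/- Let (R, m) be a Cohen–Macaulay commutative Noetherian local ring of Krull dimension d, and let I be an m-primary ideal. Then Ext_R^d(R/I^n, R) has finite length for all n ≥ 1, and there exists a polynomial p with rational coefficients of degree exactly d such that λ(Ext_R^d(R/I^n, R)) = p(n) for all sufficiently large n. -/
set_option synthInstance.maxHeartbeats 1000000

open CategoryTheory

universe u

section ExtRegular

open CategoryTheory Limits
variable {R : Type u} [CommRing R]

instance preservesLimits_linearYoneda_obj (Y : ModuleCat.{u} R) :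
    PreservesLimits ((linearYoneda R (ModuleCat.{u} R)).obj Y) := by
  have : PreservesLimits ((linearYoneda R (ModuleCat.{u} R)).obj Y ⋙ forget (ModuleCat.{u} R)) :=
    inferInstanceAs (PreservesLimits (yoneda.obj Y))
  exact preservesLimits_of_reflects_of_preserves _ (forget (ModuleCat.{u} R))

/-- `Ext⁰(N, M)` is the module of linear maps from `N` to `M`. -/
noncomputable def extZeroEquiv (N M : ModuleCat.{u} R) :
    ((Ext R (ModuleCat.{u} R) 0).obj (Opposite.op N)).obj M ≃ₗ[R] (N →ₗ[R] M) :=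
  letI : PreservesFiniteLimits ((linearYoneda R (ModuleCat.{u} R)).obj M) :=
    PreservesLimits.preservesFiniteLimits _
  letI := preservesFiniteColimits_rightOp ((linearYoneda R (ModuleCat.{u} R)).obj M)
  (((linearYoneda R (ModuleCat.{u} R)).obj M).rightOp.leftDerivedZeroIsoSelf.app
    N).unop.symm.toLinearEquiv ≪≫ₗ ModuleCat.homLinearEquiv

/-- Postcomposition with `g` on the complexes of homomorphisms out of a projective resolution. -/
noncomputable def homMap {N : ModuleCat.{u} R} (P : ProjectiveResolution N)
    {M M' : ModuleCat.{u} R} (g : M ⟶ M') :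
    P.complex.linearYonedaObj R M ⟶ P.complex.linearYonedaObj R M' where
  f i := ModuleCat.ofHom (Linear.rightComp R (P.complex.X i) g)
  comm' i j _ := by
    ext φ : 2
    let ψ : P.complex.X i ⟶ M := φ
    exact (Category.assoc (P.complex.d j i) ψ g).symm

/-- The image of a short complex under homomorphisms out of a projective resolution. -/
noncomputable def homShortComplex {N : ModuleCat.{u} R} (P : ProjectiveResolution N)
    (S : ShortComplex (ModuleCat.{u} R)) :
    ShortComplex (CochainComplex (ModuleCat.{u} R) ℕ) :=
  ShortComplex.mk (homMap P S.f) (homMap P S.g) (by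
    ext i φ : 3
    let ψ : P.complex.X i ⟶ S.X₁ := φ
    exact (Category.assoc ψ S.f S.g).trans (by rw [S.zero, comp_zero]; rfl))

lemma homShortComplex_shortExact {N : ModuleCat.{u} R} (P : ProjectiveResolution N)
    {S : ShortComplex (ModuleCat.{u} R)} (hS : S.ShortExact) :
    (homShortComplex P S).ShortExact := by
  have := hS.mono_f
  have := hS.epi_g
  refine HomologicalComplex.shortExact_of_degreewise_shortExact _ fun i => ?_
  refine ModuleCat.shortComplex_shortExact _ ?_ ?_ ?_
  · intro (φ : P.complex.X i ⟶ S.X₂)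
    constructor
    · intro h
      exact ⟨hS.exact.lift φ h, hS.exact.lift_f φ h⟩
    · rintro ⟨ψ, hψ⟩
      let ψ' : P.complex.X i ⟶ S.X₁ := ψ
      have hψ' : ψ' ≫ S.f = φ := hψ
      change φ ≫ S.g = 0
      rw [← hψ', Category.assoc, S.zero, comp_zero]
  · intro φ ψ h
    exact (cancel_mono S.f).1 h
  · intro (φ : P.complex.X i ⟶ S.X₃)
    exact ⟨Projective.factorThru φ S.g, Projective.factorThru_comp φ S.g⟩

lemma homologyMap_smul_eq_zero {N : ModuleCat.{u} R} (P : ProjectiveResolution N)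
    (M : ModuleCat.{u} R) {x : R} (hx : x • 𝟙 N = 0) (n : ℕ) :
    HomologicalComplex.homologyMap (homMap P (x • 𝟙 M)) n = 0 := by
  have h : Homotopy (x • 𝟙 P.complex) 0 := ProjectiveResolution.liftHomotopyZero _ (by
    ext
    have : P.π.f 0 = P.π.f 0 ≫ 𝟙 _ := (Category.comp_id _).symm
    rw [HomologicalComplex.comp_f, HomologicalComplex.smul_f_apply, Linear.smul_comp,
      HomologicalComplex.id_f, Category.id_comp, this, ← Linear.comp_smul]
    erw [hx, comp_zero]
    rfl)
  rw [← cancel_epi (HomologicalComplex.homologyπ _ n), comp_zero,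
    HomologicalComplex.homologyπ_naturality]
  set K := P.complex.linearYonedaObj R M
  have key : HomologicalComplex.iCycles K n ≫ (homMap P (x • 𝟙 M)).f n =
      (HomologicalComplex.iCycles K n ≫
        ModuleCat.ofHom (Linear.leftComp R M (h.hom ((ComplexShape.down ℕ).next n) n))) ≫
          K.d _ n := by
    ext z : 2
    let ψ : P.complex.X n ⟶ M := (HomologicalComplex.iCycles K n).hom z
    have hψ : ∀ j, P.complex.d j n ≫ ψ = 0 := fun j =>
      congrArg (fun q => q.hom z) (HomologicalComplex.iCycles_d K n j)
    have hc := congrArg (fun q => q ≫ ψ) (h.comm n)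
    change ψ ≫ (x • 𝟙 M) = P.complex.d _ _ ≫ h.hom _ _ ≫ ψ
    rw [Linear.comp_smul, Category.comp_id]
    simpa [dNext, prevD, hψ] using hc
  refine Eq.trans ?_ (HomologicalComplex.liftCycles_homologyπ_eq_zero_of_boundary _ _ _ rfl _ key)
  congr 1

lemma exists_extSucc {N : ModuleCat.{u} R} {M : ModuleCat.{u} R} {x : R} (hx : x • 𝟙 N = 0)
    (hM : IsSMulRegular M x) (n : ℕ) :
    ∃ δ : ((Ext R (ModuleCat.{u} R) n).obj (Opposite.op N)).obj
        (ModuleCat.of R (QuotSMulTop x M)) →ₗ[R]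
        ((Ext R (ModuleCat.{u} R) (n + 1)).obj (Opposite.op N)).obj M,
      Function.Surjective δ ∧
      (Subsingleton (((Ext R (ModuleCat.{u} R) n).obj (Opposite.op N)).obj M) →
        Function.Injective δ) := by
  let P := projectiveResolution N
  have hS := homShortComplex_shortExact P hM.smulShortComplex_shortExact
  let e := (P.isoExt (R := R) n (ModuleCat.of R (QuotSMulTop x M))).toLinearEquiv
  let e' := (P.isoExt (R := R) (n + 1) M).toLinearEquiv
  let D := (hS.δ n (n + 1) rfl).hom
  have hD : Function.Surjective D := by
    intro y
    refine (ShortComplex.moduleCat_exact_iff _).1 (hS.homology_exact₁ n (n + 1) rfl) y ?_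
    exact congrArg (fun q => q.hom y) (homologyMap_smul_eq_zero P M hx (n + 1))
  have hD' : Subsingleton (((Ext R (ModuleCat.{u} R) n).obj (Opposite.op N)).obj M) →
      Function.Injective D := by
    intro h
    rw [injective_iff_map_eq_zero]
    intro y hy
    obtain ⟨z, hz⟩ := (ShortComplex.moduleCat_exact_iff _).1 (hS.homology_exact₃ n (n + 1) rfl) y hy
    have : Subsingleton ((P.complex.linearYonedaObj R M).homology n) :=
      (P.isoExt (R := R) n M).toLinearEquiv.symm.toEquiv.subsingleton
    have hz0 : z = 0 := Subsingleton.elim (α := (P.complex.linearYonedaObj R M).homology n) _ _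
    rw [← hz, hz0, map_zero]
  exact ⟨e'.symm.toLinearMap ∘ₗ D ∘ₗ e.toLinearMap,
    e'.symm.surjective.comp (hD.comp e.surjective),
    fun h => e'.symm.injective.comp ((hD' h).comp e.injective)⟩

open RingTheory.Sequence in
lemma ext_of_isWeaklyRegular (N : ModuleCat.{u} R) (rs : List R) :
    ∀ (M : ModuleCat.{u} R), IsWeaklyRegular M rs → (∀ r ∈ rs, r • 𝟙 N = 0) →
      (∀ i < rs.length,
        Subsingleton (((Ext R (ModuleCat.{u} R) i).obj (Opposite.op N)).obj M)) ∧
      Nonempty (((Ext R (ModuleCat.{u} R) rs.length).obj (Opposite.op N)).obj M ≃ₗ[R]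
        (N →ₗ[R] M ⧸ (Ideal.ofList rs • ⊤ : Submodule R M))) := by
  induction rs with
  | nil =>
    intro M _ _
    refine ⟨by simp, ⟨extZeroEquiv N M ≪≫ₗ LinearEquiv.congrRight
      (Submodule.quotEquivOfEqBot _ (by simp)).symm⟩⟩
  | cons x xs ih =>
    intro M hM hN
    obtain ⟨hx, hxs⟩ := (isWeaklyRegular_cons_iff M x xs).1 hM
    obtain ⟨h1, ⟨e⟩⟩ := ih (ModuleCat.of R (QuotSMulTop x M)) hxs
      fun r hr => hN r (List.mem_cons_of_mem _ hr)
    have hx0 : x • 𝟙 N = 0 := hN x List.mem_cons_self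
    have hsub : ∀ i < (x :: xs).length,
        Subsingleton (((Ext R (ModuleCat.{u} R) i).obj (Opposite.op N)).obj M) := by
      rintro (_ | i) hi
      · refine (extZeroEquiv N M).toEquiv.subsingleton_congr.2 ⟨fun f g => ?_⟩
        ext z
        apply hx
        have hz : x • z = 0 := congrArg (fun q => q.hom z) hx0
        change x • f z = x • g z
        rw [← map_smul, ← map_smul, hz, map_zero, map_zero]
      · obtain ⟨δ, hδ, -⟩ := exists_extSucc hx0 hx i
        have := h1 i (by simpa using hi)
        exact hδ.subsingleton
    refine ⟨hsub, ?_⟩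
    obtain ⟨δ, hδ, hδ'⟩ := exists_extSucc hx0 hx xs.length
    exact ⟨(LinearEquiv.ofBijective δ ⟨hδ' (hsub _ (by simp)), hδ⟩).symm ≪≫ₗ e ≪≫ₗ
      LinearEquiv.congrRight
        (Submodule.quotOfListConsSMulTopEquivQuotSMulTopInner M x xs).symm⟩

end ExtRegular

section PowerRegular

open RingTheory.Sequence IsLocalRing

lemma isWeaklyRegular_append_singleton_iff {R : Type*} [CommRing R] (rs : List R) (r : R) :
    IsWeaklyRegular R (rs ++ [r]) ↔ IsWeaklyRegular R rs ∧
      ∀ t, r * t ∈ Ideal.ofList rs → t ∈ Ideal.ofList rs := by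
  rw [isWeaklyRegular_append_iff, isWeaklyRegular_singleton_iff]
  refine and_congr_right' ?_
  have h : (Ideal.ofList rs • ⊤ : Submodule R R) = Ideal.ofList rs := by simp
  rw [h, isSMulRegular_iff_right_eq_zero_of_smul]
  constructor
  · intro H t ht
    have := H (Ideal.Quotient.mk _ t) (Ideal.Quotient.eq_zero_iff_mem.2 ht)
    exact Ideal.Quotient.eq_zero_iff_mem.1 this
  · intro H t
    obtain ⟨t, rfl⟩ := Ideal.Quotient.mk_surjective t
    intro ht
    exact Ideal.Quotient.eq_zero_iff_mem.2 (H t (Ideal.Quotient.eq_zero_iff_mem.1 ht))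

lemma isWeaklyRegular_append_singleton_pow {R : Type*} [CommRing R] {rs : List R} {r : R}
    (h : IsWeaklyRegular R (rs ++ [r])) (n : ℕ) : IsWeaklyRegular R (rs ++ [r ^ n]) := by
  rw [isWeaklyRegular_append_singleton_iff] at h ⊢
  refine ⟨h.1, ?_⟩
  induction n with
  | zero => simp
  | succ n ih => exact fun t ht => ih t (h.2 _ (by rwa [← mul_assoc, ← pow_succ']))

lemma isWeaklyRegular_map_pow {R : Type*} [CommRing R] [IsNoetherianRing R] [IsLocalRing R]
    (l : List (R × ℕ)) : ∀ l' : List (R × ℕ), (∀ p ∈ l' ++ l, p.1 ∈ maximalIdeal R ∧ 0 < p.2) →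
      IsWeaklyRegular R (l'.map (fun p => p.1 ^ p.2) ++ l.map Prod.fst) →
      IsWeaklyRegular R ((l' ++ l).map fun p => p.1 ^ p.2) := by
  induction l with
  | nil => intro l' _ h; simpa using h
  | cons p l ih =>
    intro l' hm h
    have hm' : ∀ q ∈ l', q.1 ^ q.2 ∈ maximalIdeal R := fun q hq =>
      Ideal.pow_mem_of_mem _ (hm q (by simp [hq])).1 _ (hm q (by simp [hq])).2
    have h1 : IsWeaklyRegular R
        ((l'.map (fun p => p.1 ^ p.2) ++ l.map Prod.fst) ++ [p.1]) := by
      refine isWeaklyRegular_of_perm_of_subset_maximalIdeal h ?_ ?_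
      · simp only [List.map_cons, List.append_assoc]
        exact List.Perm.append_left _ (List.perm_append_singleton _ _).symm
      · simp only [List.mem_append, List.mem_map, List.map_cons, List.mem_cons]
        rintro r (⟨q, hq, rfl⟩ | rfl | ⟨q, hq, rfl⟩)
        · exact hm' q hq
        · exact (hm p (by simp)).1
        · exact (hm q (by simp [hq])).1
    have h2 := isWeaklyRegular_append_singleton_pow h1 p.2
    have h3 : IsWeaklyRegular R ((l' ++ [p]).map (fun p => p.1 ^ p.2) ++ l.map Prod.fst) := by
      refine isWeaklyRegular_of_perm_of_subset_maximalIdeal h2 ?_ ?_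
      · simp only [List.map_append, List.map_cons, List.append_assoc, List.map_nil]
        exact List.Perm.append_left _ (List.perm_append_comm)
      · simp only [List.mem_append, List.mem_map, List.mem_cons, List.not_mem_nil, or_false]
        rintro r ((⟨q, hq, rfl⟩ | ⟨q, hq, rfl⟩) | rfl)
        · exact hm' q hq
        · exact (hm q (by simp [hq])).1
        · exact Ideal.pow_mem_of_mem _ (hm p (by simp)).1 _ (hm p (by simp)).2
    have := ih (l' ++ [p]) (by simpa using hm) h3
    simpa using this

lemma isWeaklyRegular_ofFn_pow {R : Type*} [CommRing R] [IsNoetherianRing R] [IsLocalRing R]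
    {d : ℕ} {x : Fin d → R} (hx : ∀ i, x i ∈ maximalIdeal R)
    (h : IsWeaklyRegular R ((List.finRange d).map x)) {a : Fin d → ℕ} (ha : ∀ i, 0 < a i) :
    IsWeaklyRegular R ((List.finRange d).map fun i => x i ^ a i) := by
  have := isWeaklyRegular_map_pow ((List.finRange d).map fun i => (x i, a i)) []
    (by
      intro p hp
      obtain ⟨i, _, rfl⟩ := List.mem_map.1 hp
      exact ⟨hx i, ha i⟩) (by simpa [Function.comp_def] using h)
  simpa [Function.comp_def] using this

/-- Each `x i` is a nonzerodivisor modulo any positive powers of the other members of the family. -/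
def PowerRegular {R ι : Type*} [CommRing R] (x : ι → R) : Prop :=
  ∀ a : ι → ℕ, (∀ j, 0 < a j) → ∀ i r,
    x i * r ∈ Ideal.span ((fun j => x j ^ a j) '' {i}ᶜ) →
      r ∈ Ideal.span ((fun j => x j ^ a j) '' {i}ᶜ)

lemma powerRegular_of_isWeaklyRegular
    {R : Type*} [CommRing R] [IsNoetherianRing R] [IsLocalRing R]
    {d : ℕ} {x : Fin d → R} (hx : ∀ i, x i ∈ maximalIdeal R)
    (h : IsWeaklyRegular R ((List.finRange d).map x)) : PowerRegular x := by
  intro a ha i r hr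
  have h1 := isWeaklyRegular_ofFn_pow hx h (a := Function.update a i 1) (fun j => by
    by_cases hj : j = i
    · subst hj; simp
    · simp [hj, ha])
  have h2 : IsWeaklyRegular R
      ((((List.finRange d).erase i).map fun j => x j ^ a j) ++ [x i]) := by
    refine isWeaklyRegular_of_perm_of_subset_maximalIdeal h1 ?_ ?_
    · refine ((List.perm_cons_erase (List.mem_finRange i)).map _).trans ?_
      have : ((List.finRange d).erase i).map (fun j => x j ^ (Function.update a i 1) j) =
          ((List.finRange d).erase i).map (fun j => x j ^ a j) := by
        refine List.map_congr_left fun j hj => ?_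
        have : j ≠ i := ((List.nodup_finRange d).mem_erase_iff.1 hj).1
        simp [this]
      simp only [List.map_cons, this]
      simpa using (List.perm_append_singleton _ _).symm
    · intro y hy
      obtain ⟨j, _, rfl⟩ := List.mem_map.1 hy
      refine Ideal.pow_mem_of_mem _ (hx j) _ ?_
      by_cases hj : j = i
      · subst hj; simp
      · simp [hj, ha]
  have h3 := ((isWeaklyRegular_append_singleton_iff _ _).1 h2).2
  have h4 : Ideal.ofList (((List.finRange d).erase i).map fun j => x j ^ a j) =
      Ideal.span ((fun j => x j ^ a j) '' {i}ᶜ) := by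
    rw [Ideal.ofList]
    refine congrArg Ideal.span (Set.ext fun y => ?_)
    simp [(List.nodup_finRange d).mem_erase_iff]
  rw [h4] at h3
  exact h3 r hr

end PowerRegular

section PowerIdeal

variable {R : Type*} [CommRing R] {ι : Type*}

/-- The ideal generated by the powers `x i ^ a i`. -/
def powerIdeal (x : ι → R) (a : ι → ℕ) : Ideal R := Ideal.span (Set.range fun i => x i ^ a i)

lemma pow_mem_powerIdeal (x : ι → R) (a : ι → ℕ) (i : ι) {n : ℕ} (h : a i ≤ n) :
    x i ^ n ∈ powerIdeal x a :=
  Ideal.mem_of_dvd _ (pow_dvd_pow _ h) (Ideal.subset_span ⟨i, rfl⟩)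

variable {x : ι → R}

lemma mem_powerIdeal_iff (a : ι → ℕ) (i : ι) (r : R) :
    r ∈ powerIdeal x a ↔
      ∃ c, r - c * x i ^ a i ∈ Ideal.span ((fun j => x j ^ a j) '' {i}ᶜ) := by
  have : Set.range (fun j => x j ^ a j) = insert (x i ^ a i) ((fun j => x j ^ a j) '' {i}ᶜ) := by
    rw [← Set.image_univ, ← Set.union_compl_self {i}, Set.image_union, Set.image_singleton,
      Set.insert_eq]
  rw [powerIdeal, this, Ideal.mem_span_insert]
  constructor
  · rintro ⟨c, z, hz, rfl⟩
    exact ⟨c, by simpa using hz⟩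
  · rintro ⟨c, hc⟩
    exact ⟨c, _, hc, by ring⟩

lemma span_image_compl_le_powerIdeal (a : ι → ℕ) (i : ι) :
    Ideal.span ((fun j => x j ^ a j) '' {i}ᶜ) ≤ powerIdeal x a :=
  Ideal.span_mono (Set.image_subset_range _ _)

lemma PowerRegular.mem_of_pow_mul_mem (hx : PowerRegular x) {a : ι → ℕ} (ha : ∀ j, 0 < a j)
    {i : ι} (n : ℕ) {r : R} (h : x i ^ n * r ∈ Ideal.span ((fun j => x j ^ a j) '' {i}ᶜ)) :
    r ∈ Ideal.span ((fun j => x j ^ a j) '' {i}ᶜ) := by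
  induction n generalizing r with
  | zero => simpa using h
  | succ n ih => exact hx a ha i _ (ih (by rwa [← mul_assoc, ← pow_succ]))

variable [DecidableEq ι]

lemma mem_powerIdeal_update_iff (a : ι → ℕ) (i : ι) (n : ℕ) (r : R) :
    r ∈ powerIdeal x (Function.update a i n) ↔
      ∃ c, r - c * x i ^ n ∈ Ideal.span ((fun j => x j ^ a j) '' {i}ᶜ) := by
  rw [mem_powerIdeal_iff _ i]
  have : (fun j => x j ^ (Function.update a i n) j) '' {i}ᶜ = (fun j => x j ^ a j) '' {i}ᶜ :=
    Set.image_congr fun j hj => by rw [Function.update_of_ne hj]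
  simp [this]

lemma PowerRegular.pow_mul_mem_update_iff (hx : PowerRegular x) {a : ι → ℕ} (ha : ∀ j, 0 < a j)
    (i : ι) (m n : ℕ) (r : R) :
    x i ^ n * r ∈ powerIdeal x (Function.update a i (m + n)) ↔
      r ∈ powerIdeal x (Function.update a i m) := by
  rw [mem_powerIdeal_update_iff, mem_powerIdeal_update_iff]
  constructor
  · rintro ⟨c, hc⟩
    refine ⟨c, hx.mem_of_pow_mul_mem ha n ?_⟩
    convert hc using 1
    ring
  · rintro ⟨c, hc⟩
    refine ⟨c, ?_⟩
    convert Ideal.mul_mem_left _ (x i ^ n) hc using 1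
    ring

lemma PowerRegular.prod_pow_mul_mem (hx : PowerRegular x) {a b : ι → ℕ} (ha : ∀ j, 0 < a j)
    (s : Finset ι) {r : R} (h : (∏ i ∈ s, x i ^ b i) * r ∈ powerIdeal x (s.piecewise (a + b) a)) :
    r ∈ powerIdeal x a := by
  induction s using Finset.induction_on generalizing r with
  | empty => simpa using h
  | insert i s hi ih =>
    apply ih
    have hpos : ∀ j, 0 < (s.piecewise (a + b) a) j := fun j => by
      by_cases hj : j ∈ s
      · simp [hj, ha]
      · simp [hj, ha]
    rw [Finset.prod_insert hi, mul_assoc, Finset.piecewise_insert, Pi.add_apply,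
      hx.pow_mul_mem_update_iff hpos] at h
    rwa [Function.update_eq_self_iff.2] at h
    simp [hi]

lemma prod_pow_mul_mem_powerIdeal (m n : ℕ) (hmn : n ≤ m) (s : Finset ι) {r : R}
    (h : r ∈ powerIdeal x (s.piecewise (fun _ => n) fun _ => m)) :
    (∏ i ∈ s, x i ^ (m - n)) * r ∈ powerIdeal x fun _ => m := by
  rw [powerIdeal] at h
  induction h using Submodule.span_induction with
  | mem y hy =>
    obtain ⟨j, rfl⟩ := hy
    by_cases hj : j ∈ s
    · refine Ideal.mem_of_dvd _ ?_ (pow_mem_powerIdeal x (fun _ => m) j le_rfl)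
      have : x j ^ m = x j ^ (m - n) * x j ^ n := by rw [← pow_add]; congr 1; lia
      simp only [hj, Finset.piecewise_eq_of_mem]
      rw [this]
      exact mul_dvd_mul_right (Finset.dvd_prod_of_mem (fun i => x i ^ (m - n)) hj) _
    · simp only [hj, not_false_eq_true, Finset.piecewise_eq_of_notMem]
      exact Ideal.mul_mem_left _ _ (pow_mem_powerIdeal x (fun _ => m) j le_rfl)
  | zero => simp
  | add y z _ _ hy hz => rw [mul_add]; exact add_mem hy hz
  | smul c y _ hy =>
    rw [smul_eq_mul, mul_left_comm]; exact Ideal.mul_mem_left _ _ hy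

lemma PowerRegular.exists_sub_prod_pow_mul_mem (hx : PowerRegular x) {m n : ℕ} (hn : 0 < n)
    (hmn : n ≤ m) {r : R} (hr : ∀ j, x j ^ n * r ∈ powerIdeal x fun _ => m) (s : Finset ι) :
    ∃ r', r - (∏ i ∈ s, x i ^ (m - n)) * r' ∈ powerIdeal x (fun _ => m) ∧
      ∀ j, x j ^ n * r' ∈ powerIdeal x (s.piecewise (fun _ => n) fun _ => m) := by
  induction s using Finset.induction_on with
  | empty => exact ⟨r, by simp, by simpa using hr⟩
  | insert i s hi ih =>
    obtain ⟨r', h1, h2⟩ := ih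
    set a := s.piecewise (fun _ => n) fun _ => m with ha_def
    have hai : a i = m := by simp [ha_def, hi]
    have hpos : ∀ j, 0 < a j := fun j => by
      by_cases hj : j ∈ s
      · simp [ha_def, hj, hn]
      · simp [ha_def, hj]; lia
    obtain ⟨c, hc⟩ := (mem_powerIdeal_iff a i _).1 (h2 i)
    have hm : x i ^ m = x i ^ n * x i ^ (m - n) := by rw [← pow_add]; congr 1; lia
    have ho : r' - c * x i ^ (m - n) ∈ Ideal.span ((fun j => x j ^ a j) '' {i}ᶜ) := by
      refine hx.mem_of_pow_mul_mem hpos n ?_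
      convert hc using 1
      rw [hai, hm]; ring
    have ho' := span_image_compl_le_powerIdeal a i ho
    refine ⟨c, ?_, fun j => ?_⟩
    · have := add_mem h1 (prod_pow_mul_mem_powerIdeal m n hmn s ho')
      rw [Finset.prod_insert hi]
      convert this using 1
      ring
    · rw [Finset.piecewise_insert, ← ha_def, ← hx.pow_mul_mem_update_iff hpos i n (m - n),
        Nat.add_sub_cancel' hmn, ← hai, Function.update_eq_self, hai]
      have := sub_mem (h2 j) (Ideal.mul_mem_left _ (x j ^ n) ho')
      convert this using 1
      ring

lemma PowerRegular.length_update (hx : PowerRegular x) {a : ι → ℕ} (ha : ∀ j, 0 < a j) (i : ι)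
    (m : ℕ) :
    Module.length R (R ⧸ powerIdeal x (Function.update a i (m + 1))) =
      Module.length R (R ⧸ powerIdeal x (Function.update a i m)) +
        Module.length R (R ⧸ powerIdeal x (Function.update a i 1)) := by
  have key := hx.pow_mul_mem_update_iff ha i m 1
  simp only [pow_one] at key
  have hle : powerIdeal x (Function.update a i (m + 1)) ≤
      powerIdeal x (Function.update a i 1) := by
    intro r hr
    rw [mem_powerIdeal_update_iff] at hr ⊢
    obtain ⟨c, hc⟩ := hr
    exact ⟨c * x i ^ m, by convert hc using 1; ring⟩
  have hle' : powerIdeal x (Function.update a i m) ≤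
      Submodule.comap (LinearMap.mulLeft R (x i)) (powerIdeal x (Function.update a i (m + 1))) :=
    fun r hr => (key r).2 hr
  refine Module.length_eq_add_of_exact (Submodule.mapQ _ _ (LinearMap.mulLeft R (x i)) hle')
    (Submodule.factor hle) ?_ (Submodule.factor_surjective hle) ?_
  · rw [← LinearMap.ker_eq_bot, LinearMap.ker_eq_bot']
    intro r
    obtain ⟨r, rfl⟩ := Submodule.Quotient.mk_surjective _ r
    rw [Submodule.mapQ_apply, Submodule.Quotient.mk_eq_zero, Submodule.Quotient.mk_eq_zero]
    exact (key r).1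
  · intro r
    obtain ⟨r, rfl⟩ := Submodule.Quotient.mk_surjective _ r
    rw [← Submodule.mkQ_apply, Submodule.factor_mk, Submodule.mkQ_apply,
      Submodule.Quotient.mk_eq_zero, mem_powerIdeal_update_iff]
    constructor
    · rintro ⟨c, hc⟩
      refine ⟨Submodule.Quotient.mk c, ?_⟩
      rw [Submodule.mapQ_apply, eq_comm, Submodule.mkQ_apply, Submodule.Quotient.eq,
        mem_powerIdeal_update_iff]
      exact ⟨0, by convert hc using 1; simp; ring⟩
    · rintro ⟨c, hc⟩
      obtain ⟨c, rfl⟩ := Submodule.Quotient.mk_surjective _ c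
      rw [Submodule.mapQ_apply, eq_comm, Submodule.mkQ_apply, Submodule.Quotient.eq,
        mem_powerIdeal_update_iff] at hc
      obtain ⟨e, he⟩ := hc
      refine ⟨c + e * x i ^ m, ?_⟩
      convert he using 1
      simp; ring

lemma PowerRegular.length_update_mul (hx : PowerRegular x) {a : ι → ℕ} (ha : ∀ j, 0 < a j) (i : ι)
    {m : ℕ} (hm : 0 < m) :
    Module.length R (R ⧸ powerIdeal x (Function.update a i m)) =
      m * Module.length R (R ⧸ powerIdeal x (Function.update a i 1)) := by
  induction m, hm using Nat.le_induction with
  | base => simp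
  | succ m _ ih => rw [hx.length_update ha, ih]; push_cast; ring

lemma PowerRegular.length_powerIdeal [Fintype ι] (hx : PowerRegular x) {n : ℕ} (hn : 0 < n) :
    Module.length R (R ⧸ powerIdeal x fun _ => n) =
      (n : ℕ∞) ^ Fintype.card ι * Module.length R (R ⧸ powerIdeal x fun _ => 1) := by
  have key : ∀ s : Finset ι, Module.length R (R ⧸ powerIdeal x
      (s.piecewise (fun _ => n) fun _ => 1)) =
        (n : ℕ∞) ^ s.card * Module.length R (R ⧸ powerIdeal x fun _ => 1) := by
    intro s
    induction s using Finset.induction_on with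
    | empty => rw [Finset.piecewise_empty, Finset.card_empty, pow_zero, one_mul]
    | insert i s hi ih =>
      have hpos : ∀ j, 0 < (s.piecewise (fun _ => n) fun _ => 1) j := fun j => by
        by_cases hj : j ∈ s
        · simp [hj, hn]
        · simp [hj]
      rw [Finset.piecewise_insert, hx.length_update_mul hpos i hn, Function.update_eq_self_iff.2,
        ih, Finset.card_insert_of_notMem hi]
      · ring
      · simp [hi]
  have := key Finset.univ
  rwa [Finset.piecewise_univ, Finset.card_univ] at this

end PowerIdeal

section Colimit

variable {R : Type u} [CommRing R] {ι : Type*}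

/-- A module of functions which is the colimit of the quotients `R ⧸ (x i ^ k)` along
multiplication by the product of the `x i`; `f k` is the canonical map from the `k`-th stage,
precomposed with the projection from `R`. -/
structure IsPowerColimit [Fintype ι] (x : ι → R) {H : Type*} [AddCommGroup H] [Module R H]
    (f : ℕ → R →ₗ[R] H) : Prop where
  apply_eq_zero_iff : ∀ k, 0 < k → ∀ r, f k r = 0 ↔ r ∈ powerIdeal x fun _ => k
  apply_add : ∀ k l r, f (k + l) ((∏ i, x i ^ l) * r) = f k r
  exists_apply : ∀ h, ∃ k r, f k r = h

lemma prod_pow_mul_mem_powerIdeal_add [Fintype ι] (x : ι → R) (k l : ℕ) {r : R}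
    (h : r ∈ powerIdeal x fun _ => k) : (∏ i, x i ^ l) * r ∈ powerIdeal x fun _ => k + l := by
  classical
  have := prod_pow_mul_mem_powerIdeal (x := x) (k + l) k (by lia) Finset.univ (r := r)
    (by rwa [Finset.piecewise_univ])
  simpa using this

lemma PowerRegular.exists_isPowerColimit [Fintype ι] {x : ι → R} (hx : PowerRegular x) :
    ∃ (H : Type u) (_ : AddCommGroup H) (_ : Module R H) (f : ℕ → R →ₗ[R] H),
      IsPowerColimit x f := by
  classical
  have hle : ∀ i j : ℕ, i ≤ j → powerIdeal x (fun _ => i) ≤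
      Submodule.comap (LinearMap.mulLeft R (∏ l, x l ^ (j - i))) (powerIdeal x fun _ => j) := by
    intro i j hij r hr
    have := prod_pow_mul_mem_powerIdeal_add x i (j - i) hr
    rwa [Nat.add_sub_cancel' hij] at this
  let F : ∀ i j : ℕ, i ≤ j →
      (R ⧸ powerIdeal x fun _ => i) →ₗ[R] (R ⧸ powerIdeal x fun _ => j) :=
    fun i j hij => Submodule.mapQ _ _ _ (hle i j hij)
  have hF : ∀ i j hij r, F i j hij (Submodule.Quotient.mk r) =
      Submodule.Quotient.mk ((∏ l, x l ^ (j - i)) * r) := fun i j hij r => rfl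
  have hsys : DirectedSystem (fun k : ℕ => R ⧸ powerIdeal x fun _ => k) fun i j h => F i j h := by
    constructor
    · intro i r
      obtain ⟨r, rfl⟩ := Submodule.Quotient.mk_surjective _ r
      rw [hF _ _ le_rfl]; simp
    · intro k j i hij hjk r
      obtain ⟨r, rfl⟩ := Submodule.Quotient.mk_surjective _ r
      rw [hF _ _ hij, hF _ _ hjk, hF _ _ (hij.trans hjk), ← mul_assoc, ← Finset.prod_mul_distrib]
      congr 3
      funext l
      rw [← pow_add]
      congr 1
      lia
  refine ⟨Module.DirectLimit (fun k : ℕ => R ⧸ powerIdeal x fun _ => k) F, inferInstance,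
    inferInstance, fun k => Module.DirectLimit.of R ℕ _ F k ∘ₗ Submodule.mkQ _, ?_, ?_, ?_⟩
  · intro k hk r
    rw [LinearMap.comp_apply, Submodule.mkQ_apply]
    constructor
    · intro h
      obtain ⟨j, hkj, hj⟩ := Module.DirectLimit.of.zero_exact h
      rw [hF _ _ hkj, Submodule.Quotient.mk_eq_zero] at hj
      have := hx.prod_pow_mul_mem (a := fun _ => k) (b := fun _ => j - k) (fun _ => hk)
        Finset.univ (r := r)
      rw [Finset.piecewise_univ] at this
      refine this ?_
      convert hj using 2
      funext l
      simp only [Pi.add_apply]; lia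
    · intro h
      rw [(Submodule.Quotient.mk_eq_zero _).2 h, map_zero]
  · intro k l r
    have := Module.DirectLimit.of_f (f := F) (i := k) (j := k + l) (hij := Nat.le_add_right k l)
      (x := Submodule.Quotient.mk r)
    rw [hF _ _ (Nat.le_add_right k l)] at this
    simpa using this
  · intro h
    obtain ⟨k, r, rfl⟩ := Module.DirectLimit.exists_of h
    obtain ⟨r, rfl⟩ := Submodule.Quotient.mk_surjective _ r
    exact ⟨k, r, rfl⟩

variable {H : Type*} [AddCommGroup H] [Module R H]

lemma IsPowerColimit.torsionBySet_eq_range [Fintype ι] {x : ι → R} {f : ℕ → R →ₗ[R] H}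
    (hf : IsPowerColimit x f) (hx : PowerRegular x) {n : ℕ} (hn : 0 < n) :
    Submodule.torsionBySet R H (powerIdeal x fun _ => n) = LinearMap.range (f n) := by
  classical
  apply le_antisymm
  · intro h hh
    rw [Submodule.mem_torsionBySet_iff] at hh
    obtain ⟨m, r, hr⟩ : ∃ m r, f (n + m) r = h := by
      obtain ⟨k, r, rfl⟩ := hf.exists_apply h
      exact ⟨k, (∏ i, x i ^ n) * r, by rw [add_comm, hf.apply_add]⟩
    have h1 : ∀ j, x j ^ n * r ∈ powerIdeal x fun _ => n + m := by
      intro j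
      rw [← hf.apply_eq_zero_iff _ (by lia), ← smul_eq_mul, map_smul, hr]
      exact hh ⟨_, pow_mem_powerIdeal x (fun _ => n) j le_rfl⟩
    obtain ⟨r', h2, -⟩ := hx.exists_sub_prod_pow_mul_mem hn (Nat.le_add_right n m) h1 Finset.univ
    rw [← hf.apply_eq_zero_iff _ (by lia), map_sub, sub_eq_zero, hr, Nat.add_sub_cancel_left,
      hf.apply_add] at h2
    exact ⟨r', h2.symm⟩
  · rintro _ ⟨r, rfl⟩
    rw [Submodule.mem_torsionBySet_iff]
    rintro ⟨a, ha⟩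
    change a • f n r = 0
    rw [← map_smul, hf.apply_eq_zero_iff n hn, smul_eq_mul]
    exact Ideal.mul_mem_right _ _ ha

lemma IsPowerColimit.length_torsionBySet [Fintype ι] {x : ι → R} {f : ℕ → R →ₗ[R] H}
    (hf : IsPowerColimit x f) (hx : PowerRegular x) {n : ℕ} (hn : 0 < n) :
    Module.length R (Submodule.torsionBySet R H (powerIdeal x fun _ => n)) =
      Module.length R (R ⧸ powerIdeal x fun _ => n) := by
  have hker : LinearMap.ker (f n) = powerIdeal x fun _ => n := by
    ext r
    exact hf.apply_eq_zero_iff n hn r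
  rw [hf.torsionBySet_eq_range hx hn, ← (f n).quotKerEquivRange.length_eq, hker]

lemma nonempty_homEquiv_torsionBySet {Q : Type*} [AddCommGroup Q] [Module R Q] (𝔞 : Ideal R)
    (g : Q →ₗ[R] H) (hg : Function.Injective g)
    (h : Submodule.torsionBySet R H 𝔞 ≤ LinearMap.range g) :
    Nonempty ((R ⧸ 𝔞 →ₗ[R] Q) ≃ₗ[R] Submodule.torsionBySet R H 𝔞) := by
  let e : (R ⧸ 𝔞 →ₗ[R] Q) →ₗ[R] Submodule.torsionBySet R H 𝔞 :=
    { toFun φ := ⟨g (φ (Submodule.Quotient.mk 1)), by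
        rw [Submodule.mem_torsionBySet_iff]
        rintro ⟨a, ha⟩
        change a • g _ = 0
        rw [← map_smul, ← map_smul, ← Submodule.Quotient.mk_smul, smul_eq_mul, mul_one,
          (Submodule.Quotient.mk_eq_zero _).2 ha, map_zero, map_zero]⟩
      map_add' _ _ := by ext; simp
      map_smul' _ _ := by ext; simp }
  refine ⟨LinearEquiv.ofBijective e ⟨fun φ ψ hφψ => ?_, ?_⟩⟩
  · refine Submodule.linearMap_qext _ (LinearMap.ext_ring ?_)
    exact hg (congrArg Subtype.val hφψ)
  · rintro ⟨y, hy⟩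
    obtain ⟨q, rfl⟩ := h hy
    rw [Submodule.mem_torsionBySet_iff] at hy
    refine ⟨Submodule.liftQ _ (LinearMap.toSpanSingleton R Q q) fun a ha => ?_, ?_⟩
    · rw [LinearMap.mem_ker, LinearMap.toSpanSingleton_apply]
      apply hg
      rw [map_smul, map_zero]
      exact hy ⟨a, ha⟩
    · ext
      change g (Submodule.liftQ _ (LinearMap.toSpanSingleton R Q q) _ (Submodule.Quotient.mk 1)) = _
      rw [Submodule.liftQ_apply]
      simp

end Colimit

lemma Polynomial.exists_eval_add_one (q : Polynomial ℚ) :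
    ∃ p : Polynomial ℚ, ∀ x, p.eval (x + 1) = p.eval x + q.eval x := by
  induction q using Polynomial.induction_on' with
  | add q₁ q₂ h₁ h₂ =>
    obtain ⟨p₁, h₁⟩ := h₁
    obtain ⟨p₂, h₂⟩ := h₂
    exact ⟨p₁ + p₂, fun x => by simp only [Polynomial.eval_add, h₁, h₂]; ring⟩
  | monomial n a =>
    refine ⟨Polynomial.C (a / (n + 1)) * Polynomial.bernoulli (n + 1), fun x => ?_⟩
    have h := Polynomial.bernoulli_eval_one_add (n + 1) x
    rw [add_comm x 1, Polynomial.eval_mul, Polynomial.eval_mul, h]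
    have : (n + 1 : ℚ) ≠ 0 := by positivity
    simp
    field_simp

/-- The values of `f` at large natural numbers are those of a rational polynomial. -/
def EventuallyPolynomial (f : ℕ → ℚ) : Prop :=
  ∃ p : Polynomial ℚ, ∃ N, ∀ n ≥ N, f n = p.eval (n : ℚ)

lemma EventuallyPolynomial.of_sub {f g : ℕ → ℚ} (hg : EventuallyPolynomial g)
    (h : ∀ n, f (n + 1) = f n + g n) : EventuallyPolynomial f := by
  obtain ⟨q, N, hq⟩ := hg
  obtain ⟨p, hp⟩ := q.exists_eval_add_one
  refine ⟨p + Polynomial.C (f N - p.eval (N : ℚ)), N, fun n hn => ?_⟩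
  induction n, hn using Nat.le_induction with
  | base => simp
  | succ n hn ih =>
    rw [h, ih, hq n hn]
    push_cast
    simp only [Polynomial.eval_add, Polynomial.eval_C, hp]
    ring

lemma EventuallyPolynomial.sub {f g : ℕ → ℚ} (hf : EventuallyPolynomial f)
    (hg : EventuallyPolynomial g) : EventuallyPolynomial fun n => f n - g n := by
  obtain ⟨p, N, hp⟩ := hf
  obtain ⟨q, N', hq⟩ := hg
  refine ⟨p - q, max N N', fun n hn => ?_⟩
  simp only [Polynomial.eval_sub, hp n (le_of_max_le_left hn), hq n (le_of_max_le_right hn)]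

lemma exists_forall_eq_of_antitone {α : Type*} [PartialOrder α] (S : Set α)
    (hS : ∀ g : ℕ → α, Antitone g → (∀ k, g k ∈ S) → ∃ k₀, ∀ k ≥ k₀, g k = g k₀)
    (F : ℕ → ℕ → α) (hF : ∀ k i, F k i ∈ S) (h₁ : ∀ i, Antitone fun k => F k i)
    (h₂ : ∀ k, Antitone (F k)) : ∃ k₀, ∀ k ≥ k₀, ∀ i, F k i = F k₀ i := by
  obtain ⟨a, ha⟩ := hS (fun k => F k k)
    (fun k l h => (h₂ l h).trans (h₁ k h)) fun k => hF k k
  choose b hb using fun i => hS (fun k => F k i) (h₁ i) fun k => hF k i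
  have key : ∀ k ≥ a, ∀ i ≥ a, F k i = F a a := fun k hk i hi => by
    apply le_antisymm ((h₂ k hi).trans (h₁ a hk))
    refine (ha (max k i) (hk.trans (le_max_left _ _))).ge.trans ?_
    exact (h₂ _ (le_max_right k i)).trans (h₁ i (le_max_left k i))
  refine ⟨max a ((Finset.range a).sup b), fun k hk i => ?_⟩
  by_cases hi : a ≤ i
  · rw [key k (le_of_max_le_left hk) i hi, key _ (le_max_left _ _) i hi]
  · have hbi : b i ≤ (Finset.range a).sup b :=
      Finset.le_sup (Finset.mem_range.2 (not_le.1 hi))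
    have h1 := hb i k (hbi.trans (le_of_max_le_right hk))
    have h2 := hb i (max a ((Finset.range a).sup b)) (hbi.trans (le_max_right _ _))
    exact h1.trans h2.symm

section InverseSystem

universe v

variable {R : Type*} [CommRing R]

/-- A family of submodules stable under operators lowering the degree by one. -/
def IsStableFamily {r : ℕ} {M : ℕ → Type v} [∀ n, AddCommGroup (M n)] [∀ n, Module R (M n)]
    (X : Fin r → ∀ n, M (n + 1) →ₗ[R] M n) (N : ∀ n, Submodule R (M n)) : Prop :=
  ∀ i n, ∀ m ∈ N (n + 1), X i n m ∈ N n

/-- The descending chain condition for stable families of submodules. -/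
def IsArtinianFamily {r : ℕ} {M : ℕ → Type v} [∀ n, AddCommGroup (M n)] [∀ n, Module R (M n)]
    (X : Fin r → ∀ n, M (n + 1) →ₗ[R] M n) : Prop :=
  ∀ N : ℕ → ∀ n, Submodule R (M n), Antitone N → (∀ k, IsStableFamily X (N k)) →
    ∃ k₀, ∀ k ≥ k₀, N k = N k₀

/-- The operators lowering the degree commute with each other. -/
def IsCommutingFamily {r : ℕ} {M : ℕ → Type v} [∀ n, AddCommGroup (M n)] [∀ n, Module R (M n)]
    (X : Fin r → ∀ n, M (n + 1) →ₗ[R] M n) : Prop :=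
  ∀ i j n m, X i n (X j (n + 1) m) = X j n (X i (n + 1) m)

variable {r : ℕ} {M : ℕ → Type v} [∀ n, AddCommGroup (M n)] [∀ n, Module R (M n)]

/-- The operators induced on the kernels of the first operator. -/
def kerFamily (X : Fin (r + 1) → ∀ n, M (n + 1) →ₗ[R] M n) (hX : IsCommutingFamily X) :
    Fin r → ∀ n, LinearMap.ker (X 0 (n + 1)) →ₗ[R] LinearMap.ker (X 0 n) :=
  fun j n => (X j.succ (n + 1)).restrict fun m hm => by
    rw [LinearMap.mem_ker] at hm ⊢
    rw [hX, hm, map_zero]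

/-- The operators induced on the cokernels of the first operator. -/
def cokerFamily (X : Fin (r + 1) → ∀ n, M (n + 1) →ₗ[R] M n) (hX : IsCommutingFamily X) :
    Fin r → ∀ n, (M (n + 1) ⧸ LinearMap.range (X 0 (n + 1))) →ₗ[R]
      (M n ⧸ LinearMap.range (X 0 n)) :=
  fun j n => Submodule.mapQ _ _ (X j.succ n) <| by
    rintro _ ⟨m, rfl⟩
    exact ⟨X j.succ (n + 1) m, hX _ _ _ _⟩

variable {X : Fin (r + 1) → ∀ n, M (n + 1) →ₗ[R] M n} (hX : IsCommutingFamily X)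

lemma isCommutingFamily_kerFamily :
    IsCommutingFamily (M := fun n => LinearMap.ker (X 0 n)) (kerFamily X hX) :=
  fun _ _ _ _ => Subtype.ext (hX _ _ _ _)

lemma cokerFamily_mk (j : Fin r) (n : ℕ) (m : M (n + 1)) :
    cokerFamily X hX j n (Submodule.Quotient.mk m) = Submodule.Quotient.mk (X j.succ n m) := rfl

lemma isCommutingFamily_cokerFamily : IsCommutingFamily
    (M := fun n => M n ⧸ LinearMap.range (X 0 n)) (cokerFamily X hX) := by
  intro i j n m
  obtain ⟨m, rfl⟩ := Submodule.Quotient.mk_surjective _ m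
  simp only [cokerFamily_mk]
  rw [hX]

lemma IsArtinianFamily.ker (h : IsArtinianFamily X) :
    IsArtinianFamily (M := fun n => LinearMap.ker (X 0 n)) (kerFamily X hX) := by
  intro N hN hs
  let N' : ℕ → ∀ n, Submodule R (M n) := fun k n =>
    n.casesOn ⊤ fun n => (N k n).map (LinearMap.ker (X 0 n)).subtype
  suffices h' : Antitone N' ∧ ∀ k, IsStableFamily X (N' k) by
    obtain ⟨k₀, hk₀⟩ := h N' h'.1 h'.2
    refine ⟨k₀, fun k hk => funext fun n => ?_⟩
    have := congrFun (hk₀ k hk) (n + 1)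
    exact Submodule.map_injective_of_injective (Submodule.injective_subtype _) this
  constructor
  · rintro k l hkl (_ | n)
    · exact le_rfl
    · exact Submodule.map_mono (hN hkl n)
  · rintro k i (_ | n) m hm
    · trivial
    · obtain ⟨m, hm, rfl⟩ := hm
      induction i using Fin.cases with
      | zero =>
        have : X 0 (n + 1) m = 0 := m.2
        change X 0 (n + 1) m ∈ _
        rw [this]
        exact zero_mem _
      | succ j => exact ⟨_, hs k j n m hm, rfl⟩

lemma IsArtinianFamily.coker (h : IsArtinianFamily X) :
    IsArtinianFamily (M := fun n => M n ⧸ LinearMap.range (X 0 n)) (cokerFamily X hX) := by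
  intro N hN hs
  let N' : ℕ → ∀ n, Submodule R (M n) := fun k n =>
    (N k n).comap (LinearMap.range (X 0 n)).mkQ
  suffices h' : Antitone N' ∧ ∀ k, IsStableFamily X (N' k) by
    obtain ⟨k₀, hk₀⟩ := h N' h'.1 h'.2
    refine ⟨k₀, fun k hk => funext fun n => ?_⟩
    have := congrFun (hk₀ k hk) n
    exact Submodule.comap_injective_of_surjective (Submodule.mkQ_surjective _) this
  constructor
  · exact fun k l hkl n => Submodule.comap_mono (hN hkl n)
  · rintro k i n m hm
    rw [Submodule.mem_comap] at hm ⊢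
    induction i using Fin.cases with
    | zero =>
      rw [Submodule.mkQ_apply,
        (Submodule.Quotient.mk_eq_zero _).2 (LinearMap.mem_range_self (X 0 n) m)]
      exact zero_mem _
    | succ j => exact hs k j n _ hm

lemma length_ker_add_length_eq {M₁ M₂ : Type*} [AddCommGroup M₁] [AddCommGroup M₂] [Module R M₁]
    [Module R M₂] (f : M₁ →ₗ[R] M₂) :
    Module.length R M₁ + Module.length R (M₂ ⧸ LinearMap.range f) =
      Module.length R M₂ + Module.length R (LinearMap.ker f) := by
  rw [Module.length_eq_add_of_exact (LinearMap.ker f).subtype f.rangeRestrict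
      (Submodule.injective_subtype _) f.surjective_rangeRestrict
      (fun x => by simp [← Subtype.coe_inj]),
    Module.length_eq_add_of_exact (LinearMap.range f).subtype (LinearMap.range f).mkQ
      (Submodule.injective_subtype _) (Submodule.mkQ_surjective _)
      (fun x => by simp)]
  ring

theorem IsArtinianFamily.eventuallyPolynomial_length {r : ℕ} : ∀ {M : ℕ → Type v}
    [∀ n, AddCommGroup (M n)] [∀ n, Module R (M n)] {X : Fin r → ∀ n, M (n + 1) →ₗ[R] M n},
    IsCommutingFamily X → IsArtinianFamily X → (∀ n, Module.length R (M n) ≠ ⊤) →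
      EventuallyPolynomial fun n => ((Module.length R (M n)).toNat : ℚ) := by
  induction r with
  | zero =>
    intro M _ _ X hX h hfin
    obtain ⟨k₀, hk₀⟩ := h (fun k n => if k ≤ n then ⊤ else ⊥) (by
      intro k l hkl n
      by_cases h : l ≤ n
      · simp [h, hkl.trans h]
      · simp [h]) (fun k i => i.elim0)
    refine ⟨0, k₀, fun n hn => ?_⟩
    have := congrFun (hk₀ (n + 1) (by lia)) n
    have hsub : Subsingleton (M n) := by
      rw [← Submodule.subsingleton_iff R, ← subsingleton_iff_bot_eq_top]
      simpa [hn] using this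
    simp
  | succ r ih =>
    intro M _ _ X hX h hfin
    have hK : ∀ n, Module.length R (LinearMap.ker (X 0 n)) ≠ ⊤ := fun n =>
      ne_top_of_le_ne_top (hfin (n + 1))
        (Module.length_le_of_injective _ (Submodule.injective_subtype _))
    have hC : ∀ n, Module.length R (M n ⧸ LinearMap.range (X 0 n)) ≠ ⊤ := fun n =>
      ne_top_of_le_ne_top (hfin n)
        (Module.length_le_of_surjective _ (Submodule.mkQ_surjective _))
    refine ((ih (isCommutingFamily_kerFamily hX) (h.ker hX) hK).sub
      (ih (isCommutingFamily_cokerFamily hX) (h.coker hX) hC)).of_sub fun n => ?_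
    have key := congrArg ENat.toNat (length_ker_add_length_eq (X 0 n))
    rw [ENat.toNat_add (hfin _) (hC _), ENat.toNat_add (hfin _) (hK _)] at key
    have key' : ((_ : ℕ) : ℚ) = (_ : ℕ) := congrArg _ key
    push_cast at key'
    linarith

/-- The images of a family of submodules under the first operator. -/
def shiftFamily (X : Fin (r + 1) → ∀ n, M (n + 1) →ₗ[R] M n) (N : ∀ n, Submodule R (M n)) :
    ∀ n, Submodule R (M n) :=
  fun n => (N (n + 1)).map (X 0 n)

lemma shiftFamily_mono : Monotone (shiftFamily X) :=
  fun _ _ h n => Submodule.map_mono (h (n + 1))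

lemma IsStableFamily.shift (hX : IsCommutingFamily X) {N : ∀ n, Submodule R (M n)}
    (h : IsStableFamily X N) :
    IsStableFamily X (shiftFamily X N) := by
  rintro i n _ ⟨m, hm, rfl⟩
  exact ⟨X i (n + 1) m, h i _ m hm, hX _ _ _ _⟩

lemma IsStableFamily.shift_le {N : ∀ n, Submodule R (M n)} (h : IsStableFamily X N) :
    shiftFamily X N ≤ N := by
  rintro n _ ⟨m, hm, rfl⟩
  exact h 0 n m hm

lemma Submodule.eq_of_le_of_map_eq_of_comap_eq {M₁ M₂ : Type*} [AddCommGroup M₁] [AddCommGroup M₂]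
    [Module R M₁] [Module R M₂] (f : M₁ →ₗ[R] M₂) {P Q : Submodule R M₁} (h : P ≤ Q)
    (hm : P.map f = Q.map f)
    (hc : P.comap (LinearMap.ker f).subtype = Q.comap (LinearMap.ker f).subtype) : P = Q := by
  refine le_antisymm h fun q hq => ?_
  obtain ⟨p, hp, hpq⟩ : f q ∈ P.map f := hm ▸ Submodule.mem_map_of_mem hq
  have hqp : q - p ∈ LinearMap.ker f := by simp [hpq]
  have : (⟨q - p, hqp⟩ : LinearMap.ker f) ∈ P.comap (LinearMap.ker f).subtype := by
    rw [hc]; exact sub_mem hq (h hp)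
  have : q - p ∈ P := this
  simpa using add_mem this hp

lemma exists_forall_eq_of_antitone_submodule {M : Type*} [AddCommGroup M] [Module R M]
    [IsArtinian R M] (g : ℕ → Submodule R M) (hg : Antitone g) : ∃ k₀, ∀ k ≥ k₀, g k = g k₀ := by
  obtain ⟨k₀, h⟩ := IsArtinian.monotone_stabilizes ⟨fun k => OrderDual.toDual (g k), hg⟩
  exact ⟨k₀, fun k hk => (h k hk).symm⟩

theorem isArtinianFamily_of_ker_eq_bot {r : ℕ} : ∀ {M : ℕ → Type v}
    [∀ n, AddCommGroup (M n)] [∀ n, Module R (M n)] {X : Fin r → ∀ n, M (n + 1) →ₗ[R] M n},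
    IsCommutingFamily X → (∀ n, IsArtinian R (M n)) →
      (∃ n₀, ∀ n ≥ n₀, ∀ m, (∀ i, X i n m = 0) → m = 0) → IsArtinianFamily X := by
  induction r with
  | zero =>
    rintro M _ _ X hX hM ⟨n₀, hn₀⟩ N hN hs
    choose b hb using fun n => exists_forall_eq_of_antitone_submodule (fun k => N k n)
      fun k l h => hN h n
    refine ⟨(Finset.range (n₀ + 1)).sup b, fun k hk => funext fun n => ?_⟩
    by_cases hn : n < n₀ + 1
    · have hbn : b n ≤ (Finset.range (n₀ + 1)).sup b := Finset.le_sup (Finset.mem_range.2 hn)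
      exact (hb n k (hbn.trans hk)).trans (hb n _ hbn).symm
    · obtain ⟨n, rfl⟩ : ∃ l, n = l + 1 := ⟨n - 1, by lia⟩
      have : ∀ m : M (n + 1), m = 0 := fun m => hn₀ n (by lia) m fun i => i.elim0
      ext m
      simp [this m]
  | succ r ih =>
    rintro M _ _ X hX hM ⟨n₀, hn₀⟩ N hN hs
    have hK : IsArtinianFamily (M := fun n => LinearMap.ker (X 0 n)) (kerFamily X hX) := by
      refine ih (isCommutingFamily_kerFamily hX) (fun n => inferInstance)
        ⟨n₀, fun n hn m hm => ?_⟩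
      refine Subtype.ext (hn₀ (n + 1) (by lia) _ fun i => ?_)
      induction i using Fin.cases with
      | zero => exact m.2
      | succ j => exact congrArg Subtype.val (hm j)
    have hst : ∀ k i, IsStableFamily X ((shiftFamily X)^[i] (N k)) := by
      intro k i
      induction i with
      | zero => exact hs k
      | succ i ih => rw [Function.iterate_succ_apply']; exact ih.shift hX
    have hanti₁ : ∀ i, Antitone fun k => (shiftFamily X)^[i] (N k) := fun i k l h =>
      (shiftFamily_mono.iterate i) (hN h)
    have hanti₂ : ∀ k, Antitone fun i => (shiftFamily X)^[i] (N k) := fun k =>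
      antitone_nat_of_succ_le fun i => by
        rw [Function.iterate_succ_apply']
        exact (hst k i).shift_le
    obtain ⟨k₁, hk₁⟩ := exists_forall_eq_of_antitone
      {P | IsStableFamily (M := fun n => LinearMap.ker (X 0 n)) (kerFamily X hX) P}
      (fun g hg => hK g hg)
      (fun k i n => ((shiftFamily X)^[i] (N k) (n + 1)).comap (LinearMap.ker (X 0 n)).subtype)
      (fun k i j n m hm => hst k i j.succ (n + 1) m hm)
      (fun i k l h n => Submodule.comap_mono (hanti₁ i h (n + 1)))
      (fun k i j h n => Submodule.comap_mono (hanti₂ k h (n + 1)))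
    obtain ⟨k₂, hk₂⟩ := exists_forall_eq_of_antitone (Set.univ : Set (Submodule R (M 0)))
      (fun g hg _ => exists_forall_eq_of_antitone_submodule g hg)
      (fun k i => (shiftFamily X)^[i] (N k) 0) (fun _ _ => trivial)
      (fun i k l h => hanti₁ i h 0) (fun k i j h => hanti₂ k h 0)
    have key : ∀ n i, ∀ k ≥ max k₁ k₂,
        (shiftFamily X)^[i] (N k) n = (shiftFamily X)^[i] (N (max k₁ k₂)) n := by
      intro n
      induction n with
      | zero =>
        intro i k hk
        rw [hk₂ k (le_of_max_le_right hk), hk₂ _ (le_max_right k₁ k₂)]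
      | succ n ihn =>
        intro i k hk
        refine Submodule.eq_of_le_of_map_eq_of_comap_eq (X 0 n) (hanti₁ i hk (n + 1)) ?_ ?_
        · have := ihn (i + 1) k hk
          rwa [Function.iterate_succ_apply', Function.iterate_succ_apply'] at this
        · have h1 := congrFun (hk₁ k (le_of_max_le_left hk) i) n
          have h2 := congrFun (hk₁ _ (le_max_left k₁ k₂) i) n
          exact h1.trans h2.symm
    exact ⟨max k₁ k₂, fun k hk => funext fun n => key n 0 k hk⟩

end InverseSystem

section TorsionFiltration

variable {R : Type*} [CommRing R] {H : Type*} [AddCommGroup H] [Module R H] (I : Ideal R)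

lemma mem_torsionBySet_pow_succ_iff {r : ℕ} {a : Fin r → R} (ha : Ideal.span (Set.range a) = I)
    (n : ℕ) (m : H) :
    m ∈ Submodule.torsionBySet R H (I ^ (n + 1) : Ideal R) ↔
      ∀ i, a i • m ∈ Submodule.torsionBySet R H (I ^ n : Ideal R) := by
  simp only [Submodule.mem_torsionBySet_iff, Subtype.forall, SetLike.mem_coe]
  constructor
  · intro h i b hb
    rw [smul_smul]
    refine h _ ?_
    rw [pow_succ]
    exact Ideal.mul_mem_mul hb (ha ▸ Ideal.subset_span ⟨i, rfl⟩)
  · intro h b hb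
    rw [pow_succ] at hb
    induction hb using Submodule.mul_induction_on' with
    | mem_mul_mem b hb c hc =>
      rw [← ha] at hc
      induction hc using Submodule.span_induction with
      | mem _ hc =>
        obtain ⟨i, rfl⟩ := hc
        rw [mul_smul, h i b hb]
      | zero => simp
      | add c c' _ _ hc hc' => rw [mul_add, add_smul, hc, hc', add_zero]
      | smul e c _ hc => rw [smul_eq_mul, mul_left_comm, mul_smul, hc, smul_zero]
    | add c _ c' _ hc hc' => rw [add_smul, hc, hc', add_zero]

theorem eventuallyPolynomial_length_torsionBySet (hI : I.FG)
    (hfin : ∀ n, Module.length R (Submodule.torsionBySet R H (I ^ n : Ideal R)) ≠ ⊤) :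
    EventuallyPolynomial fun n =>
      ((Module.length R (Submodule.torsionBySet R H (I ^ n : Ideal R))).toNat : ℚ) := by
  obtain ⟨r, a, ha⟩ := Submodule.fg_iff_exists_fin_generating_family.1 hI
  let T : ℕ → Submodule R H := fun n => Submodule.torsionBySet R H (I ^ n : Ideal R)
  have hT : ∀ n m, m ∈ T (n + 1) ↔ ∀ i, a i • m ∈ T n :=
    mem_torsionBySet_pow_succ_iff I ha
  have hmono : ∀ n, T n ≤ T (n + 1) := fun n =>
    Submodule.torsionBySet_le_torsionBySet_of_subset (Ideal.pow_le_pow_right (Nat.le_succ n))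
  let X' : Fin r → ∀ n, T (n + 1) →ₗ[R] T n := fun i n =>
    (LinearMap.lsmul R H (a i)).restrict fun m hm => (hT n m).1 hm i
  let M : ℕ → Type _ := fun n => T (n + 1) ⧸ (T n).submoduleOf (T (n + 1))
  let X : Fin r → ∀ n, M (n + 1) →ₗ[R] M n := fun i n =>
    Submodule.mapQ _ _ (X' i (n + 1)) fun m hm => (hT n m).1 hm i
  have hX : ∀ i n m, X i n (Submodule.Quotient.mk m) = Submodule.Quotient.mk (X' i (n + 1) m) :=
    fun _ _ _ => rfl
  have hcomm : IsCommutingFamily X := by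
    intro i j n m
    obtain ⟨m, rfl⟩ := Submodule.Quotient.mk_surjective _ m
    rw [hX, hX, hX, hX]
    exact congrArg _ (Subtype.ext (smul_comm (a i) (a j) (m : H)))
  have hlen : ∀ n, Module.length R (T (n + 1)) =
      Module.length R (T n) + Module.length R (M n) := fun n =>
    Module.length_eq_add_of_exact (Submodule.inclusion (hmono n))
      ((T n).submoduleOf (T (n + 1))).mkQ (Submodule.inclusion_injective _)
      (Submodule.mkQ_surjective _) (fun m => by
        rw [Submodule.mkQ_apply, Submodule.Quotient.mk_eq_zero]
        change (m : H) ∈ T n ↔ _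
        exact ⟨fun h => ⟨⟨m, h⟩, rfl⟩, by rintro ⟨m, rfl⟩; exact m.2⟩)
  have hM : ∀ n, Module.length R (M n) ≠ ⊤ := fun n h =>
    hfin (n + 1) ((hlen n).trans (by rw [h, add_top]))
  have hart : IsArtinianFamily X := by
    refine isArtinianFamily_of_ker_eq_bot hcomm (fun n =>
      (isFiniteLength_iff_isNoetherian_isArtinian.1 (Module.length_ne_top_iff.1 (hM n))).2)
      ⟨0, fun n _ m hm => ?_⟩
    obtain ⟨m, rfl⟩ := Submodule.Quotient.mk_surjective _ m
    refine (Submodule.Quotient.mk_eq_zero _).2 ((hT n m).2 fun i => ?_)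
    have := hm i
    rw [hX] at this
    have h := (Submodule.Quotient.mk_eq_zero ((T n).submoduleOf (T (n + 1)))).1 this
    exact h
  refine (hart.eventuallyPolynomial_length hcomm hM).of_sub fun n => ?_
  have key := congrArg ENat.toNat (hlen n)
  rw [ENat.toNat_add (hfin _) (hM _)] at key
  exact_mod_cast key

end TorsionFiltration

section Degree

open Filter

lemma Polynomial.degree_eq_of_bounds {d t c N : ℕ} {p : Polynomial ℚ} {f : ℕ → ℕ} (ht : 0 < t)
    (hp : ∀ n ≥ N, (f n : ℚ) = p.eval (n : ℚ)) (hle : ∀ n > 0, f n ≤ n ^ d * c)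
    (hge : ∀ n > 0, n ^ d ≤ f (t * ((d + 1) * n))) : p.degree = d := by
  apply le_antisymm
  · by_contra! h
    have h1 := (p.abs_div_tendsto_atTop_atTop_of_degree_gt (Polynomial.X ^ d) (by simpa using h)
      (by simp)).comp tendsto_natCast_atTop_atTop
    obtain ⟨n, hn1, hn2, hn3⟩ := ((h1.eventually_gt_atTop (c : ℚ)).and
      ((eventually_ge_atTop N).and (eventually_gt_atTop 0))).exists
    have hn : (0 : ℚ) < n ^ d := by positivity
    simp only [Function.comp_apply, ← hp n hn2, Polynomial.eval_pow, Polynomial.eval_X] at hn1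
    rw [abs_of_nonneg (by positivity), lt_div_iff₀ hn] at hn1
    have := hle n hn3
    have : (f n : ℚ) ≤ n ^ d * c := by exact_mod_cast this
    linarith
  · by_contra! h
    set l : Polynomial ℚ := Polynomial.C ((t * (d + 1) : ℕ) : ℚ) * Polynomial.X
    have hl : ∀ n : ℕ, l.eval (n : ℚ) = ((t * ((d + 1) * n) : ℕ) : ℚ) := by
      intro n; simp [l]; ring
    have hd : (p.comp l).degree < (Polynomial.X ^ d : Polynomial ℚ).degree := by
      rw [Polynomial.degree_X_pow]
      by_cases hp0 : p = 0
      · rw [hp0, Polynomial.zero_comp, ← hp0]; exact h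
      have h1 : p.natDegree < d := (Polynomial.natDegree_lt_iff_degree_lt hp0).2 h
      have h2 : (p.comp l).natDegree ≤ p.natDegree := by
        rw [Polynomial.natDegree_comp]
        exact (Nat.mul_le_mul_left _ ((Polynomial.natDegree_C_mul_le _ _).trans
          Polynomial.natDegree_X_le)).trans (by rw [mul_one])
      exact Polynomial.degree_le_natDegree.trans_lt (by exact_mod_cast h2.trans_lt h1)
    have hlim := (Polynomial.div_tendsto_atTop_zero_of_degree_lt _ _ hd).comp
      tendsto_natCast_atTop_atTop
    obtain ⟨n, hn1, hn2, hn3⟩ := ((hlim.eventually_lt_const zero_lt_one).and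
      ((eventually_ge_atTop N).and (eventually_gt_atTop 0))).exists
    have hn : (0 : ℚ) < n ^ d := by positivity
    have hN : N ≤ t * ((d + 1) * n) :=
      hn2.trans ((Nat.le_mul_of_pos_left n d.succ_pos).trans (Nat.le_mul_of_pos_left _ ht))
    simp only [Function.comp_apply, Polynomial.eval_comp, hl, ← hp _ hN, Polynomial.eval_pow,
      Polynomial.eval_X] at hn1
    rw [div_lt_one hn] at hn1
    have : (n : ℚ) ^ d ≤ f (t * ((d + 1) * n)) := by exact_mod_cast hge n hn3
    linarith

end Degree

section Pigeonhole

lemma span_image_pow_le {R ι : Type*} [CommRing R] (x : ι → R) (n : ℕ) (s : Finset ι) :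
    Ideal.span (x '' s) ^ (s.card * n + 1) ≤ Ideal.span ((fun i => x i ^ n) '' s) := by
  classical
  induction s using Finset.induction_on with
  | empty => simp
  | insert i s hi ih =>
    rw [Finset.card_insert_of_notMem hi, Finset.coe_insert, Set.image_insert_eq,
      Set.image_insert_eq, Ideal.span_insert, Ideal.span_insert,
      show (s.card + 1) * n + 1 = n + (s.card * n + 1) by ring]
    refine Ideal.sup_pow_add_le_pow_sup_pow.trans (sup_le_sup ?_ ih)
    rw [Ideal.span_singleton_pow]

lemma powerIdeal_one_pow_le {R ι : Type*} [CommRing R] [Fintype ι] (x : ι → R) (n : ℕ) :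
    (powerIdeal x fun _ => 1) ^ (Fintype.card ι * n + 1) ≤ powerIdeal x fun _ => n := by
  simpa [powerIdeal] using span_image_pow_le x n Finset.univ

end Pigeonhole

section CohenMacaulay

open RingTheory.Sequence IsLocalRing

lemma ofList_map_finRange {R : Type*} [CommRing R] {d : ℕ} (x : Fin d → R) (a : Fin d → ℕ) :
    Ideal.ofList ((List.finRange d).map fun i => x i ^ a i) = powerIdeal x a := by
  rw [Ideal.ofList, powerIdeal]
  refine congrArg Ideal.span (Set.ext fun y => ?_)
  simp

lemma exists_isWeaklyRegular_mem {R : Type*} [CommRing R] [IsNoetherianRing R] [IsLocalRing R]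
    {rs : List R} (hmem : ∀ r ∈ rs, r ∈ maximalIdeal R) (hreg : IsWeaklyRegular R rs)
    {I : Ideal R} (hI : maximalIdeal R ≤ I.radical) :
    ∃ x : Fin rs.length → R, (∀ i, x i ∈ I) ∧ (∀ i, x i ∈ maximalIdeal R) ∧
      IsWeaklyRegular R ((List.finRange rs.length).map x) := by
  obtain ⟨c, hc⟩ := Ideal.exists_pow_le_of_le_radical_of_fg hI
    (IsNoetherian.noetherian (maximalIdeal R))
  have hrs : ∀ i, rs.get i ∈ maximalIdeal R := fun i => hmem _ (List.get_mem _ _)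
  refine ⟨fun i => rs.get i ^ (c + 1),
    fun i => hc (Ideal.pow_le_pow_right (Nat.le_succ c) (Ideal.pow_mem_pow (hrs i) _)),
    fun i => Ideal.pow_mem_of_mem _ (hrs i) _ c.succ_pos, ?_⟩
  exact isWeaklyRegular_ofFn_pow (a := fun _ => c + 1) hrs (by rwa [List.map_get_finRange])
    fun _ => c.succ_pos

lemma isArtinianRing_quotient_powerIdeal {R : Type*} [CommRing R] [IsNoetherianRing R]
    [IsLocalRing R] {d : ℕ} (hdim : ringKrullDim R = d) {x : Fin d → R}
    (hx : ∀ i, x i ∈ maximalIdeal R) (h : IsWeaklyRegular R ((List.finRange d).map x)) :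
    IsArtinianRing (R ⧸ powerIdeal x fun _ => 1) := by
  have hreg : IsRegular R ((List.finRange d).map x) :=
    .of_isWeaklyRegular_of_mem_maximalIdeal R (by simpa using hx) h
  have hd := ringKrullDim_add_length_eq_ringKrullDim_of_isRegular _ hreg
  have hof : Ideal.ofList ((List.finRange d).map x) = powerIdeal x fun _ => 1 := by
    simpa using ofList_map_finRange x fun _ => 1
  rw [hof, hdim, List.length_map, List.length_finRange] at hd
  rw [isArtinianRing_iff_krullDimLE_zero, Ring.krullDimLE_iff]
  generalize ringKrullDim (R ⧸ powerIdeal x fun _ => 1) = k at hd ⊢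
  induction k with
  | bot => simp
  | coe k =>
    induction k with
    | top =>
      have : (⊤ : ℕ∞) + d = d := by exact_mod_cast hd
      simp at this
    | coe k =>
      have : k + d = d := by exact_mod_cast hd
      have : k = 0 := by lia
      simp [this]

lemma isFiniteLength_quotient {R : Type*} [CommRing R] [IsNoetherianRing R] (J : Ideal R)
    [IsArtinianRing (R ⧸ J)] : IsFiniteLength R (R ⧸ J) :=
  isFiniteLength_iff_isNoetherian_isArtinian.2
    ⟨inferInstance, isArtinian_of_surjective_algebraMap (R := R ⧸ J) Ideal.Quotient.mk_surjective⟩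

lemma nonempty_extEquiv_torsionBySet {R : Type u} [CommRing R] [IsNoetherianRing R]
    [IsLocalRing R] {d : ℕ} {x : Fin d → R} (hx : ∀ i, x i ∈ maximalIdeal R)
    (h : IsWeaklyRegular R ((List.finRange d).map x)) {H : Type u} [AddCommGroup H] [Module R H]
    {f : ℕ → R →ₗ[R] H} (hf : IsPowerColimit x f) {n : ℕ} (hn : 0 < n) {𝔞 : Ideal R}
    (h𝔞 : (powerIdeal x fun _ => n) ≤ 𝔞) :
    Nonempty (extModule R d (R ⧸ 𝔞) R ≃ₗ[R] Submodule.torsionBySet R H (𝔞 : Set R)) := by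
  have hpow := isWeaklyRegular_ofFn_pow (a := fun _ => n) hx h fun _ => hn
  obtain ⟨e⟩ := (ext_of_isWeaklyRegular (ModuleCat.of R (R ⧸ 𝔞)) _ (ModuleCat.of R R) hpow (by
    intro r hr
    obtain ⟨i, -, rfl⟩ := List.mem_map.1 hr
    refine ModuleCat.hom_ext (LinearMap.ext fun q => ?_)
    obtain ⟨q, rfl⟩ := Ideal.Quotient.mk_surjective q
    exact Ideal.Quotient.eq_zero_iff_mem.2
      (Ideal.mul_mem_right _ _ (h𝔞 (pow_mem_powerIdeal x (fun _ => n) i le_rfl))))).2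
  rw [List.length_map, List.length_finRange] at e
  have hof : (Ideal.ofList ((List.finRange d).map fun i => x i ^ n) • ⊤ : Submodule R R) =
      powerIdeal x fun _ => n := by
    rw [ofList_map_finRange x fun _ => n, smul_eq_mul, Ideal.mul_top]
  have hker : LinearMap.ker (f n) = powerIdeal x fun _ => n :=
    Submodule.ext fun r => hf.apply_eq_zero_iff n hn r
  let e' : (R ⧸ (Ideal.ofList ((List.finRange d).map fun i => x i ^ n) • ⊤ : Submodule R R)) ≃ₗ[R]
      LinearMap.range (f n) :=
    Submodule.quotEquivOfEq _ _ (hof.trans hker.symm) ≪≫ₗ (f n).quotKerEquivRange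
  obtain ⟨e''⟩ := nonempty_homEquiv_torsionBySet 𝔞
    ((LinearMap.range (f n)).subtype ∘ₗ e'.toLinearMap)
    ((Submodule.subtype_injective _).comp e'.injective) (by
      rw [LinearMap.range_comp, LinearEquiv.range, Submodule.map_top, Submodule.range_subtype,
        ← hf.torsionBySet_eq_range (powerRegular_of_isWeaklyRegular hx h) hn]
      exact Submodule.torsionBySet_le_torsionBySet_of_subset h𝔞)
  exact ⟨e ≪≫ₗ e''⟩

end CohenMacaulay

/-- Corollary 7, last part. Let `(R, m)` be a Cohen–Macaulay commutative
Noetherian local ring of Krull dimension `d` (Cohen–Macaulayness being expressed by the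
existence of a regular sequence of length `d` contained in `m`), and `I` an `m`-primary
ideal.  Then `Ext_R^d(R/Iⁿ, R)` has finite length for all `n ≥ 1`, and there is a
polynomial `p ∈ ℚ[X]` of degree exactly `d` with `λ(Ext_R^d(R/Iⁿ, R)) = p(n)` for all
`n ≫ 0`. -/
theorem stmt_16 {R : Type u} [CommRing R] [IsNoetherianRing R] [IsLocalRing R]
    (d : ℕ) (hdim : ringKrullDim R = d)
    (hCM : ∃ rs : List R, rs.length = d ∧ (∀ r ∈ rs, r ∈ IsLocalRing.maximalIdeal R) ∧
      RingTheory.Sequence.IsRegular R rs)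
    (I : Ideal R) (hI : I.radical = IsLocalRing.maximalIdeal R) :
    (∀ n : ℕ, 1 ≤ n →
      IsFiniteLength R (extModule R d (R ⧸ (I ^ n : Ideal R)) R)) ∧
    ∃ p : Polynomial ℚ, p.degree = (d : ℕ) ∧
      ∃ N₀ : ℕ, ∀ n ≥ N₀, ∃ ℓ : ℕ,
        moduleLength R (extModule R d (R ⧸ (I ^ n : Ideal R)) R) = ℓ ∧
        (ℓ : ℚ) = p.eval (n : ℚ) := by
  obtain ⟨rs, rfl, hrs, hreg⟩ := hCM
  obtain ⟨x, hxI, hxm, hx⟩ := exists_isWeaklyRegular_mem hrs hreg.toIsWeaklyRegular hI.ge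
  have hpr := powerRegular_of_isWeaklyRegular hxm hx
  obtain ⟨H, _, _, f, hf⟩ := hpr.exists_isPowerColimit
  have hart := isArtinianRing_quotient_powerIdeal hdim hxm hx
  obtain ⟨t, ht⟩ := IsLocalRing.exists_maximalIdeal_pow_le_of_isArtinianRing_quotient
    (powerIdeal x fun _ => 1)
  have hIm : I ≤ IsLocalRing.maximalIdeal R := hI ▸ Ideal.le_radical
  have hIt : I ^ (t + 1) ≤ powerIdeal x fun _ => 1 :=
    ((Ideal.pow_le_pow_right t.le_succ).trans (Ideal.pow_right_mono hIm t)).trans ht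
  have hJ : ∀ n, (powerIdeal x fun _ => n) ≤ I ^ n := fun n =>
    Ideal.span_le.2 (by rintro _ ⟨i, rfl⟩; exact Ideal.pow_mem_pow (hxI i) n)
  have hlen : ∀ n > 0, Module.length R (Submodule.torsionBySet R H (powerIdeal x fun _ => n)) =
      (n : ℕ∞) ^ rs.length * Module.length R (R ⧸ powerIdeal x fun _ => 1) := fun n hn => by
    rw [hf.length_torsionBySet hpr hn, hpr.length_powerIdeal hn, Fintype.card_fin]
  obtain ⟨c, hc⟩ := ENat.ne_top_iff_exists.1
    (Module.length_ne_top_iff.2 (isFiniteLength_quotient (powerIdeal x fun _ => 1)))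
  have hc0 : 0 < c := by
    have : Nontrivial (R ⧸ powerIdeal x fun _ => 1) := Ideal.Quotient.nontrivial_iff.2 <|
      ne_top_of_le_ne_top (IsLocalRing.maximalIdeal.isMaximal R).ne_top
        (Ideal.span_le.2 (by rintro _ ⟨i, rfl⟩; simpa using hxm i))
    have := Module.length_pos (R := R) (M := R ⧸ powerIdeal x fun _ => 1)
    rw [← hc] at this
    exact_mod_cast this
  have hmono : ∀ {𝔞 𝔟 : Ideal R}, 𝔞 ≤ 𝔟 → Module.length R (Submodule.torsionBySet R H (𝔟 : Set R)) ≤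
      Module.length R (Submodule.torsionBySet R H (𝔞 : Set R)) := fun h =>
    Module.length_le_of_injective _ (Submodule.inclusion_injective
      (Submodule.torsionBySet_le_torsionBySet_of_subset h))
  have hle : ∀ n > 0, Module.length R (Submodule.torsionBySet R H (I ^ n : Ideal R)) ≤
      ((n ^ rs.length * c : ℕ) : ℕ∞) := fun n hn => by
    refine (hmono (hJ n)).trans ?_
    rw [hlen n hn, ← hc]
    push_cast
    exact le_rfl
  have hfin : ∀ n, Module.length R (Submodule.torsionBySet R H (I ^ n : Ideal R)) ≠ ⊤ := fun n =>
    ne_top_of_le_ne_top (ENat.natCast_ne_top _)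
      ((hmono (Ideal.pow_le_pow_right n.le_succ)).trans (hle (n + 1) n.succ_pos))
  have hge : ∀ n > 0, ((n ^ rs.length : ℕ) : ℕ∞) ≤ Module.length R
      (Submodule.torsionBySet R H (I ^ ((t + 1) * ((rs.length + 1) * n)) : Ideal R)) :=
    fun n hn => by
    have h1 : I ^ ((t + 1) * ((rs.length + 1) * n)) ≤ powerIdeal x fun _ => n := by
      rw [pow_mul]
      refine (Ideal.pow_right_mono hIt _).trans ((Ideal.pow_le_pow_right ?_).trans
        (powerIdeal_one_pow_le x n))
      rw [Fintype.card_fin]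
      lia
    refine le_trans ?_ (hmono h1)
    rw [hlen n hn, ← hc]
    exact_mod_cast Nat.le_mul_of_pos_right _ hc0
  have hext : ∀ n > 0, Nonempty (extModule R rs.length (R ⧸ (I ^ n : Ideal R)) R ≃ₗ[R]
      Submodule.torsionBySet R H (I ^ n : Ideal R)) := fun n hn =>
    nonempty_extEquiv_torsionBySet hxm hx hf hn (hJ n)
  refine ⟨fun n hn => ?_, ?_⟩
  · obtain ⟨e⟩ := hext n hn
    exact e.symm.isFiniteLength (Module.length_ne_top_iff.1 (hfin n))
  · obtain ⟨p, N, hp⟩ := eventuallyPolynomial_length_torsionBySet I (IsNoetherian.noetherian I) hfin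
    refine ⟨p, Polynomial.degree_eq_of_bounds (c := c) t.succ_pos hp
      (fun n hn => ENat.toNat_le_of_le_natCast (hle n hn)) (fun n hn => ?_), N + 1, fun n hn => ?_⟩
    · exact ENat.natCast_le_natCast.1 ((hge n hn).trans (ENat.natCast_toNat (hfin _)).ge)
    · obtain ⟨e⟩ := hext n (by lia)
      refine ⟨_, ?_, hp n (by lia)⟩
      rw [moduleLength, ← Module.coe_length, e.length_eq]
      exact congrArg _ (ENat.natCast_toNat (hfin n)).symm
end
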